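/- arXiv:1210.3644 — 3 statements merged into one kernel-verified Lean document; each statement's English description precedes it below -/
import Mathlib

section
/- Let a, b, c be nonzero rational numbers. Suppose there exists a prime number p such that none of a, b, a·b is a square in the field ℚ_p of p-adic numbers. Then there exist x, y, z, t, u, w ∈ ℚ such that (x² − a·y²)·(z² − b·t²)·(u² − (a·b)·w²) = c. -/
namespace PE

theorem norm_of_sq (d : ℚ) (e : ℚ) (he : e ≠ 0) (h : e ^ 2 = d) (c : ℚ) :
    ∃ x y : ℚ, x ^ 2 - d * y ^ 2 = c := by
  refine ⟨(c + 1) / 2, (c - 1) / (2 * e), ?_⟩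
  subst h
  field_simp
  ring

theorem norm_div (d : ℚ) (x y z w r : ℚ) (h : x ^ 2 - d * y ^ 2 = r * (z ^ 2 - d * w ^ 2))
    (h0 : z ^ 2 - d * w ^ 2 ≠ 0) : ∃ x y : ℚ, x ^ 2 - d * y ^ 2 = r := by
  refine ⟨(x * z - d * y * w) / (z ^ 2 - d * w ^ 2), (x * w - y * z) / (z ^ 2 - d * w ^ 2), ?_⟩
  field_simp
  linear_combination (z ^ 2 - d * w ^ 2) * h

theorem ceil_sqrt (n : ℕ) (hn : 0 < n) : n ≤ (Nat.sqrt (n - 1) + 1) ^ 2 ∧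
    (Nat.sqrt (n - 1)) ^ 2 < n := by
  have h1 := Nat.sqrt_le' (n - 1)
  have h2 := Nat.lt_succ_sqrt' (n - 1)
  rw [Nat.succ_eq_add_one] at h2
  omega

theorem lemN_key (a : ℤ) (r A : ℕ) (x y z q : ℤ) (ha : a ≠ 0) (hrZ : (0 : ℤ) < r)
    (hA : A = a.natAbs) (bx : x ^ 2 ≤ A * r) (by' : y ^ 2 < r) (bz : z ^ 2 < A)
    (hq : x ^ 2 - a * y ^ 2 - r * z ^ 2 = a * r * q) :
    q = 0 ∨ q = -1 ∨ (q = 1 ∧ y = 0 ∧ z = 0 ∧ x ^ 2 = a * r ∧ 0 < a) := by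
  have hy0 := sq_nonneg y
  have hz0 := sq_nonneg z
  have hx0 := sq_nonneg x
  rcases lt_or_gt_of_ne ha with hneg | hpos
  · have hAa : (A : ℤ) = -a := by omega
    rw [hAa] at bx bz
    have h1 : q < 1 := by
      by_contra! h
      nlinarith [mul_pos (neg_pos.mpr hneg) hrZ]
    have h2 : -2 < q := by
      by_contra! h
      nlinarith [mul_pos (neg_pos.mpr hneg) hrZ]
    omega
  · have hAa : (A : ℤ) = a := by omega
    rw [hAa] at bx bz
    have har := mul_pos hpos hrZ
    have h1 : q ≤ 1 := by
      by_contra! h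
      nlinarith
    have h2 : -2 < q := by
      by_contra! h
      nlinarith
    by_cases hq1 : q = 1
    · right; right
      subst hq1
      have f1 := mul_nonneg hpos.le hy0
      have f2 := mul_nonneg hrZ.le hz0
      have e1 : a * y ^ 2 = 0 := by linarith
      have e2 : (r : ℤ) * z ^ 2 = 0 := by linarith
      have e3 : y ^ 2 = 0 := (mul_eq_zero.mp e1).resolve_left ha
      have e4 : z ^ 2 = 0 := (mul_eq_zero.mp e2).resolve_left hrZ.ne'
      refine ⟨rfl, by simpa using e3, by simpa using e4, ?_, hpos⟩
      rw [e3, e4] at hq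
      linarith
    · omega

theorem lemN (a : ℤ) (r : ℕ) (ha : a ≠ 0) (hr : 0 < r) (hcop : IsCoprime a (r : ℤ))
    (hk : ∃ k : ℤ, (r : ℤ) ∣ k ^ 2 - a) (hs : ∃ s : ℤ, a ∣ s ^ 2 - r) :
    ∃ x y : ℚ, x ^ 2 - a * y ^ 2 = r := by
  obtain ⟨k, hk⟩ := hk
  obtain ⟨s, hs⟩ := hs
  set A := a.natAbs with hA
  have hApos : 0 < A := Int.natAbs_pos.mpr ha
  have : NeZero r := ⟨hr.ne'⟩
  have : NeZero A := ⟨hApos.ne'⟩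
  obtain ⟨hY1, hY2⟩ := ceil_sqrt r hr
  obtain ⟨hZ1, hZ2⟩ := ceil_sqrt A hApos
  have hX1 := Nat.lt_succ_sqrt' (A * r)
  have hX2 := Nat.sqrt_le' (A * r)
  rw [Nat.succ_eq_add_one] at hX1
  set X := Nat.sqrt (A * r)
  set Y := Nat.sqrt (r - 1)
  set Z := Nat.sqrt (A - 1)
  let F : Fin (X + 1) × Fin (Y + 1) × Fin (Z + 1) → ZMod r × ZMod A := fun t =>
    ((((t.1 : ℕ) : ℤ) - k * ((t.2.1 : ℕ) : ℤ) : ℤ), (((t.1 : ℕ) : ℤ) - s * ((t.2.2 : ℕ) : ℤ) : ℤ))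
  have hcard : Fintype.card (ZMod r × ZMod A) < Fintype.card (Fin (X + 1) × Fin (Y + 1) × Fin (Z + 1)) := by
    simp only [Fintype.card_prod, ZMod.card, Fintype.card_fin]
    apply lt_of_pow_lt_pow_left₀ 2 (Nat.zero_le _)
    calc (r * A) ^ 2 = (A * r) * (r * A) := by ring
      _ < (X + 1) ^ 2 * (r * A) := by
        apply Nat.mul_lt_mul_of_pos_right hX1; positivity
      _ ≤ (X + 1) ^ 2 * ((Y + 1) ^ 2 * (Z + 1) ^ 2) := by gcongr
      _ = _ := by ring
  obtain ⟨t, t', hne, heq⟩ := Fintype.exists_ne_map_eq_of_card_lt F hcard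
  obtain ⟨x1, y1, z1⟩ := t
  obtain ⟨x2, y2, z2⟩ := t'
  simp only [F, Prod.mk.injEq] at heq
  obtain ⟨h1, h2⟩ := heq
  rw [ZMod.intCast_eq_intCast_iff_dvd_sub] at h1 h2
  obtain ⟨x, hx⟩ : ∃ x : ℤ, x = ((x2 : ℕ) : ℤ) - ((x1 : ℕ) : ℤ) := ⟨_, rfl⟩
  obtain ⟨y, hy⟩ : ∃ x : ℤ, x = ((y2 : ℕ) : ℤ) - ((y1 : ℕ) : ℤ) := ⟨_, rfl⟩
  obtain ⟨z, hz⟩ : ∃ x : ℤ, x = ((z2 : ℕ) : ℤ) - ((z1 : ℕ) : ℤ) := ⟨_, rfl⟩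
  have hr1 : (r : ℤ) ∣ x - k * y := by
    convert h1 using 1; rw [hx, hy]; ring
  have hr2 : a ∣ x - s * z := by
    rw [← Int.natAbs_dvd]
    convert h2 using 1; rw [hx, hz]; ring
  have hnz : ¬ (x = 0 ∧ y = 0 ∧ z = 0) := by
    rintro ⟨h1, h2, h3⟩
    apply hne
    ext <;> simp <;> omega
  have bound : ∀ (n B : ℕ) (u v : Fin (B + 1)) (w : ℤ), w = ((v : ℕ) : ℤ) - ((u : ℕ) : ℤ) →
      w ^ 2 ≤ (B : ℤ) ^ 2 := by
    intro n B u v w hw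
    have := u.2
    have := v.2
    apply sq_le_sq'
    · omega
    · omega
  have bx : x ^ 2 ≤ A * r := (bound 0 _ _ _ _ hx).trans (by exact_mod_cast hX2)
  have by' : y ^ 2 < r := lt_of_le_of_lt (bound 0 _ _ _ _ hy) (by exact_mod_cast hY2)
  have bz : z ^ 2 < A := lt_of_le_of_lt (bound 0 _ _ _ _ hz) (by exact_mod_cast hZ2)
  have hdvd : a * (r : ℤ) ∣ x ^ 2 - a * y ^ 2 - r * z ^ 2 := by
    apply hcop.mul_dvd
    · have : x ^ 2 - a * y ^ 2 - r * z ^ 2 = (x - s * z) * (x + s * z) + (s ^ 2 - r) * z ^ 2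
        - a * y ^ 2 := by ring
      rw [this]
      exact dvd_sub (dvd_add (hr2.mul_right _) (hs.mul_right _)) (dvd_mul_right _ _)
    · have : x ^ 2 - a * y ^ 2 - r * z ^ 2 = (x - k * y) * (x + k * y) + (k ^ 2 - a) * y ^ 2
        - r * z ^ 2 := by ring
      rw [this]
      exact dvd_sub (dvd_add (hr1.mul_right _) (hk.mul_right _)) (dvd_mul_right _ _)
  obtain ⟨q, hq⟩ := hdvd
  have hrZ : (0 : ℤ) < r := by exact_mod_cast hr
  have haQ : (a : ℚ) ≠ 0 := by exact_mod_cast ha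
  -- main cases
  have key := lemN_key a r A x y z q ha hrZ hA bx by' bz hq
  rcases key with rfl | rfl | ⟨rfl, rfl, rfl, hxx, hpos⟩
  · have hqQ : (x : ℚ) ^ 2 - a * y ^ 2 = r * ((z : ℚ) ^ 2 - a * 0 ^ 2) := by
      have : (x : ℤ) ^ 2 - a * y ^ 2 = r * z ^ 2 := by linarith
      have : (x : ℚ) ^ 2 - a * y ^ 2 = r * z ^ 2 := by exact_mod_cast this
      rw [this]; ring
    by_cases hz' : z = 0
    · subst hz'
      have hyne : y ≠ 0 := by
        rintro rfl
        apply hnz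
        refine ⟨?_, rfl, rfl⟩
        have : x ^ 2 = 0 := by linarith
        simpa using this
      have hxne : x ≠ 0 := by
        rintro rfl
        have : a * y ^ 2 = 0 := by linarith
        rcases mul_eq_zero.mp this with h | h
        · exact ha h
        · exact hyne (by simpa using h)
      have hyQ : (y : ℚ) ≠ 0 := by exact_mod_cast hyne
      have hxQ : (x : ℚ) ≠ 0 := by exact_mod_cast hxne
      refine norm_of_sq _ (x / y) (div_ne_zero hxQ hyQ) ?_ _
      field_simp
      simp at hqQ
      linarith
    · refine norm_div _ _ _ _ _ _ hqQ ?_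
      have : (z : ℚ) ≠ 0 := by exact_mod_cast hz'
      simpa using this
  · have hqQ : (x : ℚ) ^ 2 - a * y ^ 2 = r * ((z : ℚ) ^ 2 - a * 1 ^ 2) := by
      have : (x : ℤ) ^ 2 - a * y ^ 2 = r * (z ^ 2 - a * 1 ^ 2) := by linarith
      exact_mod_cast this
    by_cases hz' : (z : ℚ) ^ 2 - a * 1 ^ 2 = 0
    · refine norm_of_sq _ z ?_ (by linarith) _
      intro h0
      rw [h0] at hz'
      apply haQ
      linarith
    · exact norm_div _ _ _ _ _ _ hqQ hz'
  · have h1 : (r : ℤ) ∣ x := by simpa using hr1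
    obtain ⟨w, hw⟩ := h1
    have : r * w ^ 2 = a := by
      have : (r : ℤ) * (r * w ^ 2) = r * a := by rw [hw] at hxx; linarith
      exact mul_left_cancel₀ hrZ.ne' this
    have hu : IsUnit (r : ℤ) := hcop.isUnit_of_dvd' (this ▸ dvd_mul_right _ _) dvd_rfl
    have : r = 1 := by simpa [Int.isUnit_iff] using hu
    subst this
    exact ⟨1, 0, by simp⟩


/-- Nonzero rational numbers represented by `x² - d y²`. -/
def Nm (d : ℤ) : Subgroup ℚˣ where
  carrier := {c | ∃ x y : ℚ, x ^ 2 - d * y ^ 2 = c}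
  mul_mem' := by
    rintro c c' ⟨x, y, h⟩ ⟨x', y', h'⟩
    refine ⟨x * x' + d * y * y', x * y' + y * x', ?_⟩
    rw [Units.val_mul, ← h, ← h']
    ring
  one_mem' := ⟨1, 0, by simp⟩
  inv_mem' := by
    rintro c ⟨x, y, h⟩
    have hc : (c : ℚ) ≠ 0 := c.ne_zero
    refine ⟨x / c, y / c, ?_⟩
    rw [Units.val_inv_eq_inv_val]
    field_simp
    rw [h]

/-- The product of the three norm groups. -/
def HH (d : Fin 3 → ℤ) : Subgroup ℚˣ := Nm (d 0) ⊔ Nm (d 1) ⊔ Nm (d 2)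

theorem Nm_le (d : Fin 3 → ℤ) (i : Fin 3) : Nm (d i) ≤ HH d := by
  fin_cases i
  · exact le_sup_left.trans le_sup_left
  · exact le_sup_right.trans le_sup_left
  · exact le_sup_right

/-- The class of an integer modulo the product of the norm groups. -/
noncomputable def cls (d : Fin 3 → ℤ) (n : ℤ) : ℚˣ ⧸ HH d :=
  if h : (n : ℚ) ≠ 0 then QuotientGroup.mk (Units.mk0 (n : ℚ) h) else 1

theorem cls_mul (d : Fin 3 → ℤ) (m n : ℤ) (hm : m ≠ 0) (hn : n ≠ 0) :
    cls d (m * n) = cls d m * cls d n := by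
  have hm' : (m : ℚ) ≠ 0 := by exact_mod_cast hm
  have hn' : (n : ℚ) ≠ 0 := by exact_mod_cast hn
  have hmn' : ((m * n : ℤ) : ℚ) ≠ 0 := by exact_mod_cast mul_ne_zero hm hn
  rw [cls, cls, cls, dif_pos hm', dif_pos hn', dif_pos hmn', ← QuotientGroup.mk_mul]
  congr 1
  ext
  simp

theorem quot_sq (d : Fin 3 → ℤ) (g : ℚˣ ⧸ HH d) : g * g = 1 := by
  induction g using QuotientGroup.induction_on with
  | H z =>
    rw [← QuotientGroup.mk_mul, QuotientGroup.eq_one_iff]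
    apply Nm_le d 0
    exact ⟨z, 0, by push_cast; ring⟩

theorem cls_norm (d : Fin 3 → ℤ) (i : Fin 3) (n : ℤ) (h : ∃ x y : ℚ, x ^ 2 - d i * y ^ 2 = n) :
    cls d n = 1 := by
  rw [cls]
  split_ifs with h0
  · rw [QuotientGroup.eq_one_iff]
    apply Nm_le d i
    exact h
  · rfl

theorem cls_one (d : Fin 3 → ℤ) : cls d 1 = 1 := cls_norm d 0 1 ⟨1, 0, by simp⟩

theorem cls_sq_mul (d : Fin 3 → ℤ) (m n : ℤ) (hm : m ≠ 0) (hn : n ≠ 0) :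
    cls d (m * m * n) = cls d n := by
  rw [cls_mul d _ _ (mul_ne_zero hm hm) hn, cls_mul d _ _ hm hm, quot_sq, one_mul]

/-- Basic assumptions. -/
structure Dat (d : Fin 3 → ℤ) (M : ℕ) : Prop where
  ne0 : ∀ i, d i ≠ 0
  prod : ∃ e : ℤ, d 0 * d 1 * d 2 = e ^ 2
  M0 : M ≠ 0
  dvd8 : 8 ∣ M
  dvd : ∀ i, 4 * (d i).natAbs ∣ M

open NumberTheorySymbols

section
variable {d : Fin 3 → ℤ} {M : ℕ}

theorem Dat.odd (D : Dat d M) {n : ℕ} (h : n.Coprime M) : Odd n := by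
  have : n.Coprime 2 := h.coprime_dvd_right ((by norm_num : 2 ∣ 8).trans D.dvd8)
  exact (Nat.coprime_two_right.mp this)

theorem Dat.pos (D : Dat d M) {n : ℕ} (h : n.Coprime M) : 0 < n := (D.odd h).pos

theorem Dat.cop (D : Dat d M) (i : Fin 3) {n : ℕ} (h : n.Coprime M) : (d i).gcd n = 1 := by
  have : n.Coprime (d i).natAbs := h.coprime_dvd_right ((dvd_mul_left _ _).trans (D.dvd i))
  rw [Int.gcd]
  simpa using this.symm

theorem Dat.J_pm (D : Dat d M) (i : Fin 3) {n : ℕ} (h : n.Coprime M) : J(d i | n) = 1 ∨ J(d i | n) = -1 :=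
  jacobiSym.eq_one_or_neg_one (D.cop i h)

theorem coprime_modEq (D : Dat d M) {n n' : ℕ} (h : n ≡ n' [MOD M]) (hn : n'.Coprime M) : n.Coprime M := by
  rw [Nat.Coprime, h.gcd_eq]; exact hn

theorem Dat.J_mod (D : Dat d M) (i : Fin 3) {n n' : ℕ} (h : n ≡ n' [MOD M]) (hn : n'.Coprime M) :
    J(d i | n) = J(d i | n') := by
  rw [jacobiSym.mod_right _ (D.odd hn), jacobiSym.mod_right _ (D.odd (coprime_modEq D h hn)),
    (h.of_dvd (D.dvd i) : n % _ = n' % _)]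

theorem Dat.J_mul (D : Dat d M) (i : Fin 3) {n n' : ℕ} (hn : n.Coprime M) (hn' : n'.Coprime M) :
    J(d i | n * n') = J(d i | n) * J(d i | n') :=
  jacobiSym.mul_right' _ (D.pos hn).ne' (D.pos hn').ne'

theorem Dat.J_prod (D : Dat d M) {n : ℕ} (h : n.Coprime M) : J(d 0 | n) * J(d 1 | n) * J(d 2 | n) = 1 := by
  obtain ⟨e, he⟩ := D.prod
  rw [← jacobiSym.mul_left, ← jacobiSym.mul_left, he]
  apply jacobiSym.sq_one'
  have h0 := D.cop 0 h
  have h1 := D.cop 1 h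
  have h2 := D.cop 2 h
  rw [← Int.isCoprime_iff_gcd_eq_one] at *
  have := (h0.mul_left h1).mul_left h2
  rw [he] at this
  exact (IsCoprime.pow_left_iff (by norm_num)).mp this

theorem Dat.L1 (D : Dat d M) (i : Fin 3) (r : ℕ) (s : ℕ) (hr : r.Coprime M) (hk : ∃ k : ℤ, (r : ℤ) ∣ k ^ 2 - d i)
    (hs : r ≡ s * s [MOD M]) : cls d r = 1 := by
  apply cls_norm d i
  have := lemN (d i) r (D.ne0 i) (D.pos hr) (Int.isCoprime_iff_gcd_eq_one.mpr (D.cop i hr)) hk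
    ⟨s, by
      have h1 : r ≡ s * s [MOD (d i).natAbs] := hs.of_dvd ((dvd_mul_left _ _).trans (D.dvd i))
      have h2 := (Nat.modEq_iff_dvd.mp h1)
      rw [Int.natAbs_dvd] at h2
      convert h2 using 1
      push_cast; ring⟩
  simpa using this

theorem Dat.sq_prime (D : Dat d M) (i : Fin 3) {q : ℕ} (hq : q.Prime) (h : J(d i | q) = 1) :
    ∃ k : ℤ, (q : ℤ) ∣ k ^ 2 - d i := by
  have : Fact q.Prime := ⟨hq⟩
  obtain ⟨k, hk⟩ := ZMod.isSquare_of_jacobiSym_eq_one h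
  obtain ⟨k', rfl⟩ := ZMod.intCast_surjective k
  refine ⟨k', ?_⟩
  rw [← ZMod.intCast_zmod_eq_zero_iff_dvd]
  push_cast
  rw [hk]; ring

theorem sq_crt {a : ℤ} {m n : ℕ} (h : m.Coprime n) (hm : ∃ k : ℤ, (m : ℤ) ∣ k ^ 2 - a)
    (hn : ∃ k : ℤ, (n : ℤ) ∣ k ^ 2 - a) : ∃ k : ℤ, ((m * n : ℕ) : ℤ) ∣ k ^ 2 - a := by
  obtain ⟨k, hk⟩ := hm
  obtain ⟨l, hl⟩ := hn
  have hc : IsCoprime (m : ℤ) n := Nat.isCoprime_iff_coprime.mpr h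
  obtain ⟨u, v, huv⟩ := hc
  -- u m + v n = 1
  refine ⟨k * (v * n) + l * (u * m), ?_⟩
  push_cast
  apply (Nat.isCoprime_iff_coprime.mpr h).mul_dvd
  · have : (k * (v * n) + l * (u * m)) ^ 2 - a =
        (k ^ 2 - a) + m * (u * (l - k) * (k * (v * n) + l * (u * m) + k)) := by
      have : v * (n : ℤ) = 1 - u * m := by linarith
      rw [this]; ring
    rw [this]
    exact dvd_add hk (dvd_mul_right _ _)
  · have : (k * (v * n) + l * (u * m)) ^ 2 - a =
        (l ^ 2 - a) + n * (v * (k - l) * (k * (v * n) + l * (u * m) + l)) := by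
      have : u * (m : ℤ) = 1 - v * n := by linarith
      rw [this]; ring
    rw [this]
    exact dvd_add hl (dvd_mul_right _ _)

theorem Dat.ex_J (D : Dat d M) {n : ℕ} (h : n.Coprime M) : ∃ i, J(d i | n) = 1 := by
  by_contra! hh
  have h0 := (D.J_pm 0 h).resolve_left (hh 0)
  have h1 := (D.J_pm 1 h).resolve_left (hh 1)
  have h2 := (D.J_pm 2 h).resolve_left (hh 2)
  have := D.J_prod h
  rw [h0, h1, h2] at this
  norm_num at this

theorem Dat.cls_prime_eq (D : Dat d M) {q q' : ℕ} (hq : q.Prime) (hq' : q'.Prime) (hc : q'.Coprime M)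
    (h : q ≡ q' [MOD M]) : cls d q = cls d q' := by
  by_cases hne : q = q'
  · rw [hne]
  have hcq := coprime_modEq D h hc
  obtain ⟨i, hi⟩ := D.ex_J hc
  have hi' : J(d i | q) = 1 := by rw [D.J_mod i h hc, hi]
  have h1 := D.L1 i (q * q') q' (Nat.Coprime.mul_left hcq hc)
    (sq_crt ((Nat.coprime_primes hq hq').mpr hne) (D.sq_prime i hq hi') (D.sq_prime i hq' hi))
    (h.mul_right _)
  push_cast at h1
  rw [cls_mul d _ _ (by exact_mod_cast hq.ne_zero) (by exact_mod_cast hq'.ne_zero)] at h1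
  calc cls d q = cls d q * (cls d q' * cls d q') := by rw [quot_sq, mul_one]
    _ = cls d q' := by rw [← mul_assoc, h1, one_mul]

/-- Class of a prime in the given residue class. -/
noncomputable def ff (d : Fin 3 → ℤ) (M : ℕ) (n : ℕ) : ℚˣ ⧸ HH d := by
  classical
  exact if h : ∃ q : ℕ, q.Prime ∧ q ≡ n [MOD M] then cls d h.choose else 1

theorem Dat.ff_spec (D : Dat d M) {n q : ℕ} (hn : n.Coprime M) (hq : q.Prime) (h : q ≡ n [MOD M]) :
    cls d q = ff d M n := by
  have hex : ∃ q : ℕ, q.Prime ∧ q ≡ n [MOD M] := ⟨q, hq, h⟩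
  rw [ff, dif_pos hex]
  have := hex.choose_spec
  exact D.cls_prime_eq hq this.1 (coprime_modEq D this.2 hn) (h.trans this.2.symm)

theorem Dat.ex_prime (D : Dat d M) {n : ℕ} (hn : n.Coprime M) (B : ℕ) :
    ∃ q, B < q ∧ q.Prime ∧ q ≡ n [MOD M] ∧ q.Coprime M ∧ (∀ i, J(d i | q) = J(d i | n)) ∧
      cls d q = ff d M n := by
  obtain ⟨q, h1, h2, h3⟩ := Nat.forall_exists_prime_gt_and_modEq B D.M0 hn
  exact ⟨q, h1, h2, h3, coprime_modEq D h3 hn, fun i => D.J_mod i h3 hn, D.ff_spec hn h2 h3⟩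

theorem Dat.ff_congr (D : Dat d M) {n n' : ℕ} (hn : n'.Coprime M) (h : n ≡ n' [MOD M]) :
    ff d M n = ff d M n' := by
  obtain ⟨q, -, hq, hqn, -, -, hc⟩ := D.ex_prime hn 0
  rw [← hc, D.ff_spec (coprime_modEq D h hn) hq (hqn.trans h.symm)]

theorem Dat.ff_mul_K (D : Dat d M) (i : Fin 3) {m n : ℕ} (hm : m.Coprime M) (hn : n.Coprime M)
    (hJm : J(d i | m) = 1) (hJn : J(d i | n) = 1) : ff d M (m * n) = ff d M m * ff d M n := by
  obtain ⟨q1, h11, h12, h13, h14, h15, h16⟩ := D.ex_prime hm 0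
  obtain ⟨q2, h21, h22, h23, h24, h25, h26⟩ := D.ex_prime hn q1
  obtain ⟨q3, h31, h32, h33, h34, h35, h36⟩ := D.ex_prime (hm.mul_left hn) q2
  have hJ3 : J(d i | q3) = 1 := by rw [h35, D.J_mul i hm hn, hJm, hJn, one_mul]
  rw [← h16, ← h26, ← h36]
  have c12 : q1.Coprime q2 := (Nat.coprime_primes h12 h22).mpr (by omega)
  have c13 : q1.Coprime q3 := (Nat.coprime_primes h12 h32).mpr (by omega)
  have c23 : q2.Coprime q3 := (Nat.coprime_primes h22 h32).mpr (by omega)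
  have := D.L1 i (q1 * q2 * q3) (m * n) ((h14.mul_left h24).mul_left h34)
    (sq_crt (c13.mul_left c23) (sq_crt c12 (D.sq_prime i h12 (by rw [h15, hJm]))
      (D.sq_prime i h22 (by rw [h25, hJn]))) (D.sq_prime i h32 hJ3))
    ((h13.mul h23).mul h33)
  push_cast at this
  have e1 : (q1 : ℤ) ≠ 0 := by exact_mod_cast h12.ne_zero
  have e2 : (q2 : ℤ) ≠ 0 := by exact_mod_cast h22.ne_zero
  have e3 : (q3 : ℤ) ≠ 0 := by exact_mod_cast h32.ne_zero
  rw [cls_mul d _ _ (mul_ne_zero e1 e2) e3, cls_mul d _ _ e1 e2] at this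
  calc cls d q3 = (cls d q1 * cls d q2 * cls d q3) * cls d q3 := by rw [this, one_mul]
    _ = _ := by rw [mul_assoc, quot_sq, mul_one]

theorem Dat.J_sq (D : Dat d M) (i : Fin 3) {s : ℕ} (hs : s.Coprime M) : J(d i | s * s) = 1 := by
  rw [D.J_mul i hs hs]
  rcases D.J_pm i hs with h | h <;> rw [h] <;> norm_num

theorem Dat.ff_sq (D : Dat d M) {s : ℕ} (hs : s.Coprime M) : ff d M (s * s) = 1 := by
  obtain ⟨q, h1, h2, h3, h4, h5, h6⟩ := D.ex_prime (hs.mul_left hs) 0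
  rw [← h6]
  exact D.L1 0 q s h4 (D.sq_prime 0 h2 (by rw [h5, D.J_sq 0 hs])) h3

theorem Dat.ff_one (D : Dat d M) : ff d M 1 = 1 := by
  simpa using D.ff_sq (s := 1) (by simp)

theorem Dat.ff_mul_sq (D : Dat d M) {n s : ℕ} (hn : n.Coprime M) (hs : s.Coprime M) :
    ff d M (n * (s * s)) = ff d M n := by
  obtain ⟨i, hi⟩ := D.ex_J hn
  rw [D.ff_mul_K i hn (hs.mul_left hs) hi (D.J_sq i hs), D.ff_sq hs, mul_one]

theorem Dat.ff_factors (D : Dat d M) (i : Fin 3) (n : ℕ) : n.Coprime M → (∀ q, q.Prime → q ∣ n → J(d i | q) = 1) →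
    J(d i | n) = 1 ∧ cls d n = ff d M n := by
  induction n using Nat.recOnMul with
  | zero => intro h; exact absurd (D.pos h) (lt_irrefl _)
  | one => intro h _; exact ⟨jacobiSym.one_right _, by rw [D.ff_one]; exact_mod_cast cls_one d⟩
  | prime p hp => intro h1 h2; exact ⟨h2 p hp dvd_rfl, D.ff_spec h1 hp rfl⟩
  | mul a b iha ihb =>
    intro h1 h2
    have ha : a.Coprime M := h1.coprime_dvd_left (dvd_mul_right _ _)
    have hb : b.Coprime M := h1.coprime_dvd_left (dvd_mul_left _ _)
    obtain ⟨a1, a2⟩ := iha ha (fun q hq hd => h2 q hq (hd.mul_right _))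
    obtain ⟨b1, b2⟩ := ihb hb (fun q hq hd => h2 q hq (hd.mul_left _))
    refine ⟨by rw [D.J_mul i ha hb, a1, b1, one_mul], ?_⟩
    rw [D.ff_mul_K i ha hb a1 b1, ← a2, ← b2]
    push_cast
    exact cls_mul d _ _ (by exact_mod_cast (D.pos ha).ne') (by exact_mod_cast (D.pos hb).ne')

theorem Dat.lemG (D : Dat d M) (i : Fin 3) (c : ℤ) (hc : ∀ q : ℕ, q.Prime → (q : ℤ) ∣ c → q ∣ M) (r : ℕ) :
    ∀ x y : ℤ, r.Coprime M → c * r = x ^ 2 - d i * y ^ 2 →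
    J(d i | r) = 1 ∧ cls d r = ff d M r := by
  induction r using Nat.strong_induction_on with
  | _ r ih =>
    intro x y hr h
    by_cases hall : ∀ q, q.Prime → q ∣ r → J(d i | q) = 1
    · exact D.ff_factors i r hr hall
    push Not at hall
    obtain ⟨q, hq, hqr, hJ⟩ := hall
    have hqM : q.Coprime M := hr.coprime_dvd_left hqr
    have hJ' := (D.J_pm i hqM).resolve_left hJ
    have : Fact q.Prime := ⟨hq⟩
    have hqc : ¬ (q : ℤ) ∣ c := by
      intro hd
      have := hc q hq hd
      have h1 := Nat.Coprime.eq_one_of_dvd hqM this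
      exact hq.one_lt.ne' h1
    have hqrZ : (q : ℤ) ∣ r := by exact_mod_cast hqr
    obtain ⟨⟨x', rfl⟩, ⟨y', rfl⟩⟩ := jacobiSym.prime_dvd_of_eq_neg_one hJ'
      (h ▸ hqrZ.mul_left c : (q : ℤ) ∣ x ^ 2 - d i * y ^ 2)
    obtain ⟨r1, rfl⟩ := hqr
    have hq0 : (q : ℤ) ≠ 0 := by exact_mod_cast hq.ne_zero
    have h2 : c * r1 = q * (x' ^ 2 - d i * y' ^ 2) := by
      apply mul_left_cancel₀ hq0
      push_cast at h
      linear_combination h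
    have hpz : Prime (q : ℤ) := Nat.prime_iff_prime_int.mp hq
    have h3 : (q : ℤ) ∣ r1 := (hpz.dvd_or_dvd (h2 ▸ dvd_mul_right _ _)).resolve_left hqc
    obtain ⟨r2, rfl⟩ : q ∣ r1 := by exact_mod_cast h3
    have h4 : c * r2 = x' ^ 2 - d i * y' ^ 2 := by
      apply mul_left_cancel₀ hq0
      push_cast at h2
      linear_combination h2
    have hr2 : r2.Coprime M := hr.coprime_dvd_left ⟨q * q, by ring⟩
    have hpos := D.pos hr2
    obtain ⟨e1, e2⟩ := ih r2 (by nlinarith [hq.two_le, Nat.mul_le_mul hq.two_le hq.two_le]) x' y' hr2 h4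
    have er : q * (q * r2) = r2 * (q * q) := by ring
    rw [er]
    refine ⟨by rw [D.J_mul i hr2 (hqM.mul_left hqM), e1, D.J_sq i hqM, one_mul], ?_⟩
    rw [D.ff_mul_sq hr2 hqM, ← e2]
    push_cast
    rw [mul_comm]
    exact cls_sq_mul d _ _ hq0 (by exact_mod_cast hpos.ne')

def Mult (d : Fin 3 → ℤ) (M : ℕ) : Prop :=
  ∀ m n : ℕ, m.Coprime M → n.Coprime M → ff d M (m * n) = ff d M m * ff d M n

end

theorem abs_mult {U Q : Type*} [CommMonoid U] [CommGroup Q] (hQ : ∀ g : Q, g * g = 1)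
    (χ : Fin 3 → U → ℤ) (f : U → Q)
    (hpm : ∀ i u, χ i u = 1 ∨ χ i u = -1) (hχ : ∀ i u v, χ i (u * v) = χ i u * χ i v)
    (hprod : ∀ u, χ 0 u * χ 1 u * χ 2 u = 1)
    (hf : ∀ i u v, χ i u = 1 → χ i v = 1 → f (u * v) = f u * f v)
    (hsq : ∀ u, f (u * u) = 1)
    (i j k : Fin 3) (hijk : ∀ u, χ i u * χ j u * χ k u = 1)
    (u v : U) (h1 : χ i u = 1) (h2 : χ j u = -1) (h3 : χ j v = 1) (h4 : χ i v = -1)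
    (huv : f (u * v) = f u * f v) (m n : U) : f (m * n) = f m * f n := by
  have hsqχ : ∀ i u, χ i (u * u) = 1 := by
    intro i u
    rw [hχ]; rcases hpm i u with h | h <;> rw [h] <;> norm_num
  have hex : ∀ u, ∃ l, χ l u = 1 ∧ (l = i ∨ l = j ∨ l = k) := by
    intro u
    rcases hpm i u with h | h
    · exact ⟨i, h, by simp⟩
    rcases hpm j u with h' | h'
    · exact ⟨j, h', by simp⟩
    refine ⟨k, ?_, by simp⟩
    have := hijk u
    rw [h, h'] at this
    simpa using this
  have hk1 : ∀ u, χ i u = 1 → χ j u = 1 → χ k u = 1 := by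
    intro u a b
    have := hijk u
    rw [a, b] at this
    simpa using this
  -- elements of the kernel multiply well with anything
  have hker : ∀ x y, χ i x = 1 → χ j x = 1 → f (x * y) = f x * f y := by
    intro x y a b
    obtain ⟨l, hl, hl'⟩ := hex y
    apply hf l _ _ _ hl
    rcases hl' with rfl | rfl | rfl
    · exact a
    · exact b
    · exact hk1 x a b
  have hmulsq : ∀ x y, f (x * (y * y)) = f x := by
    intro x y
    rw [mul_comm, hker _ _ (hsqχ _ _) (hsqχ _ _), hsq, one_mul]
  have hfone : f 1 = 1 := by simpa using hsq 1
  -- matching representative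
  have hrep : ∀ x, ∃ w, (w = 1 ∨ w = u ∨ w = v ∨ w = u * v) ∧ χ i w = χ i x ∧ χ j w = χ j x := by
    intro x
    have hone : ∀ l, χ l 1 = 1 := by
      intro l
      have := hsqχ l 1
      simpa using this
    rcases hpm i x with a | a <;> rcases hpm j x with b | b
    · exact ⟨1, by simp, by rw [hone, a], by rw [hone, b]⟩
    · exact ⟨u, by simp, by rw [h1, a], by rw [h2, b]⟩
    · exact ⟨v, by simp, by rw [h4, a], by rw [h3, b]⟩
    · exact ⟨u * v, by simp, by rw [hχ, h1, h4, a]; rfl, by rw [hχ, h2, h3, b]; rfl⟩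
  have hsame : ∀ x w, χ i w = χ i x → χ j w = χ j x →
      f (x * w) = f x * f w ∧ χ i (x * w) = 1 ∧ χ j (x * w) = 1 := by
    intro x w a b
    refine ⟨?_, ?_, ?_⟩
    · obtain ⟨l, hl, hl'⟩ := hex x
      apply hf l _ _ hl
      rcases hl' with rfl | rfl | rfl
      · rw [a, hl]
      · rw [b, hl]
      · have e1 := hijk w
        have e2 := hijk x
        rw [a, b] at e1
        rw [hl, mul_one] at e2
        rw [e2, one_mul] at e1
        exact e1
    · rw [hχ, a, ← hχ, hsqχ]
    · rw [hχ, b, ← hχ, hsqχ]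
  have hc : ∀ a b : Q, a * (a * b) = b := by
    intro a b; rw [← mul_assoc, hQ, one_mul]
  have hW : ∀ w w', (w = 1 ∨ w = u ∨ w = v ∨ w = u * v) → (w' = 1 ∨ w' = u ∨ w' = v ∨ w' = u * v) →
      f (w * w') = f w * f w' := by
    have e1 : f (u * (u * v)) = f u * f (u * v) := by
      rw [show u * (u * v) = v * (u * u) by rw [← mul_assoc, mul_comm], hmulsq, huv, hc]
    have e2 : f (v * (u * v)) = f v * f (u * v) := by
      rw [show v * (u * v) = u * (v * v) by rw [mul_left_comm], hmulsq, huv, mul_left_comm, hQ,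
        mul_one]
    rintro w w' (rfl | rfl | rfl | rfl) (rfl | rfl | rfl | rfl) <;>
      first
      | (rw [one_mul, hfone, one_mul])
      | (rw [mul_one, hfone, mul_one])
      | (rw [hsq, hQ])
      | assumption
      | (rw [mul_comm, mul_comm (f _)]; assumption)
  obtain ⟨w, hw, a1, a2⟩ := hrep m
  obtain ⟨w', hw', b1, b2⟩ := hrep n
  obtain ⟨p1, p2, p3⟩ := hsame m w a1 a2
  obtain ⟨q1, q2, q3⟩ := hsame n w' b1 b2
  have key : f (m * n) = f ((m * w) * ((n * w') * (w * w'))) := by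
    rw [show (m * w) * ((n * w') * (w * w')) = (m * n) * (w * w) * (w' * w') by
      simp only [mul_comm, mul_left_comm, mul_assoc], hmulsq, hmulsq]
  rw [key, hker _ _ p2 p3, hker _ _ q2 q3, hW _ _ hw hw', p1, q1]
  rw [show f m * f w * (f n * f w' * (f w * f w')) = f m * f n * (f w * f w) * (f w' * f w') by
    simp only [mul_comm, mul_left_comm, mul_assoc], hQ, hQ, mul_one, mul_one]


theorem crtN (A B : ℕ) (hAB : A.Coprime B) (hA : A ≠ 0) (hB : B ≠ 0) (d x0 y0 : ℤ) :
    ∃ (x y : ℤ) (N : ℕ), (N : ℤ) = x ^ 2 - d * y ^ 2 ∧ (A : ℤ) ∣ N - (x0 ^ 2 - d * y0 ^ 2) ∧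
      (B : ℤ) ∣ N - 1 ∧ 0 < N := by
  obtain ⟨u, v, huv⟩ : IsCoprime (A : ℤ) B := Nat.isCoprime_iff_coprime.mpr hAB
  obtain ⟨y, hy⟩ : ∃ y : ℤ, y = y0 * (v * B) := ⟨_, rfl⟩
  obtain ⟨x1, hx1⟩ : ∃ x1 : ℤ, x1 = x0 * (v * B) + u * A := ⟨_, rfl⟩
  obtain ⟨T, hT⟩ : ∃ T : ℤ, T = |x1| + |d| * y ^ 2 + 1 := ⟨_, rfl⟩
  obtain ⟨x, hx⟩ : ∃ x : ℤ, x = x1 + A * B * T := ⟨_, rfl⟩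
  have hTpos : 1 ≤ T := by
    have t1 := abs_nonneg x1
    have t2 : 0 ≤ |d| * y ^ 2 := by positivity
    rw [hT]; linarith
  have hAB1 : (1 : ℤ) ≤ A * B := by
    have : 0 < A * B := Nat.pos_of_ne_zero (mul_ne_zero hA hB)
    exact_mod_cast this
  have hxbig : |d| * y ^ 2 + 1 ≤ x := by
    have h1 := neg_abs_le x1
    have h2 : T ≤ A * B * T := by nlinarith
    rw [hx]; linarith
  have hpos : 0 < x ^ 2 - d * y ^ 2 := by
    have h1 : 0 ≤ |d| * y ^ 2 := by positivity
    have h2 : d * y ^ 2 ≤ |d| * y ^ 2 := mul_le_mul_of_nonneg_right (le_abs_self d) (sq_nonneg y)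
    nlinarith
  refine ⟨x, y, (x ^ 2 - d * y ^ 2).toNat, ?_, ?_, ?_, ?_⟩
  · rw [Int.toNat_of_nonneg hpos.le]
  · rw [Int.toNat_of_nonneg hpos.le]
    have e1 : (A : ℤ) ∣ x - x0 := ⟨B * T + u * (1 - x0), by
      rw [hx, hx1]
      have : v * (B : ℤ) = 1 - u * A := by linarith
      rw [this]; ring⟩
    have e2 : (A : ℤ) ∣ y - y0 := ⟨- u * y0, by
      rw [hy]
      have : v * (B : ℤ) = 1 - u * A := by linarith
      rw [this]; ring⟩
    have : x ^ 2 - d * y ^ 2 - (x0 ^ 2 - d * y0 ^ 2) = (x - x0) * (x + x0) -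
      (y - y0) * (d * (y + y0)) := by ring
    rw [this]
    exact dvd_sub (e1.mul_right _) (e2.mul_right _)
  · rw [Int.toNat_of_nonneg hpos.le]
    have e1 : (B : ℤ) ∣ x - 1 := ⟨A * T + v * (x0 - 1), by
      rw [hx, hx1]
      have : u * (A : ℤ) = 1 - v * B := by linarith
      rw [this]; ring⟩
    have e2 : (B : ℤ) ∣ y := ⟨y0 * v, by rw [hy]; ring⟩
    have : x ^ 2 - d * y ^ 2 - 1 = (x - 1) * (x + 1) - y * (d * y) := by ring
    rw [this]
    exact dvd_sub (e1.mul_right _) (e2.mul_right _)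
  · omega

theorem modEq_of_dvd_sub {A : ℕ} {m n : ℕ} (h : (A : ℤ) ∣ (m : ℤ) - n) : m ≡ n [MOD A] :=
  (Nat.modEq_iff_dvd.mpr h).symm

theorem coprime_of_modEq_one {B n : ℕ} (h : n ≡ 1 [MOD B]) : n.Coprime B := by
  rw [Nat.Coprime, h.gcd_eq]; simp

theorem liftN (q A B e : ℕ) (hq : q.Prime) (hA : ∀ r : ℕ, r.Coprime q → r.Coprime A)
    (hqB : q.Coprime B) (hB : B ≠ 0) (d x0 y0 k0 : ℤ) (h : x0 ^ 2 - d * y0 ^ 2 = q ^ e * k0)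
    (hk : ¬ (q : ℤ) ∣ k0) :
    ∃ (x y : ℤ) (r : ℕ), r.Coprime (A * B) ∧ (q : ℤ) ^ e * r = x ^ 2 - d * y ^ 2 ∧
      q ^ e * r ≡ 1 [MOD B] := by
  obtain ⟨x, y, N, hN, h1, h2, h3⟩ := crtN (q ^ (e + 1)) B (hqB.pow_left _)
    (pow_ne_zero _ hq.ne_zero) hB d x0 y0
  obtain ⟨t, ht⟩ := h1
  have hr : (N : ℤ) = q ^ e * (k0 + q * t) := by
    rw [h] at ht; push_cast at ht; rw [pow_succ] at ht; linear_combination ht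
  have hqe : (0 : ℤ) < q ^ e := by have := hq.pos; positivity
  have hrpos : 0 < k0 + q * t := by
    have : (0 : ℤ) < N := by exact_mod_cast h3
    rw [hr] at this
    exact (mul_pos_iff_of_pos_left hqe).mp this
  obtain ⟨r, hr'⟩ : ∃ r : ℕ, (r : ℤ) = k0 + q * t := ⟨(k0 + q * t).toNat, Int.toNat_of_nonneg hrpos.le⟩
  rw [← hr'] at hr
  have hmod : q ^ e * r ≡ 1 [MOD B] := by
    apply modEq_of_dvd_sub
    push_cast
    rw [← hr]; exact h2
  refine ⟨x, y, r, ?_, by rw [← hr, hN], hmod⟩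
  apply Nat.Coprime.mul_right
  · apply hA
    rw [Nat.coprime_comm, hq.coprime_iff_not_dvd]
    intro hd
    have : (q : ℤ) ∣ r := by exact_mod_cast hd
    rw [hr'] at this
    exact hk ((Int.dvd_add_left (dvd_mul_right _ _)).mp this)
  · exact (coprime_of_modEq_one hmod).coprime_dvd_left (dvd_mul_left _ _)

section
variable {d : Fin 3 → ℤ} {M : ℕ}

theorem Dat.mult_of_pair (D : Dat d M) (i j k : Fin 3)
    (hijk : ∀ g : Fin 3 → ℤ, g i * g j * g k = g 0 * g 1 * g 2)
    (u v : ℕ) (hu : u.Coprime M) (hv : v.Coprime M) (h1 : J(d i | u) = 1) (h2 : J(d j | u) = -1)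
    (h3 : J(d j | v) = 1) (h4 : J(d i | v) = -1) (huv : ff d M (u * v) = ff d M u * ff d M v) :
    Mult d M := by
  intro m n hm hn
  let U : Submonoid ℕ :=
    { carrier := {n | n.Coprime M}
      mul_mem' := fun ha hb => Nat.Coprime.mul_left ha hb
      one_mem' := Nat.coprime_one_left M }
  exact abs_mult (U := U) (quot_sq d) (fun i u => J(d i | (u : ℕ))) (fun u => ff d M u)
    (fun i u => D.J_pm i u.2) (fun i u v => D.J_mul i u.2 v.2) (fun u => D.J_prod u.2)
    (fun i u v a b => D.ff_mul_K i u.2 v.2 a b) (fun u => D.ff_sq u.2) i j k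
    (fun u => by rw [hijk (fun i => J(d i | (u : ℕ)))]; exact D.J_prod u.2)
    ⟨u, hu⟩ ⟨v, hv⟩ h1 h2 h3 h4 huv ⟨m, hm⟩ ⟨n, hn⟩

theorem Dat.full (D : Dat d M) (hM : Mult d M) (n : ℕ) : n.Coprime M → cls d n = ff d M n := by
  induction n using Nat.recOnMul with
  | zero => intro h; exact absurd (D.pos h) (lt_irrefl _)
  | one => intro h; rw [D.ff_one]; exact_mod_cast cls_one d
  | prime p hp => intro h1; exact D.ff_spec h1 hp rfl
  | mul a b iha ihb =>
    intro h1
    have ha : a.Coprime M := h1.coprime_dvd_left (dvd_mul_right _ _)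
    have hb : b.Coprime M := h1.coprime_dvd_left (dvd_mul_left _ _)
    rw [hM a b ha hb, ← iha ha, ← ihb hb]
    push_cast
    exact cls_mul d _ _ (by exact_mod_cast (D.pos ha).ne') (by exact_mod_cast (D.pos hb).ne')

theorem Dat.ff_norm (D : Dat d M) (i : Fin 3) (N : ℕ) (x y : ℤ) (hN : N.Coprime M)
    (h : (N : ℤ) = x ^ 2 - d i * y ^ 2) : J(d i | N) = 1 ∧ ff d M N = 1 := by
  have h1 := D.lemG i 1 (by
    intro q hq hd
    have : q ∣ 1 := by exact_mod_cast hd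
    exact absurd (Nat.dvd_one.mp this) hq.one_lt.ne') N x y hN (by rw [one_mul, h])
  refine ⟨h1.1, ?_⟩
  rw [← h1.2]
  exact cls_norm d i _ ⟨x, y, by exact_mod_cast h.symm⟩

/-- norm with prescribed residue -/
theorem Dat.norm_res (D : Dat d M) (i : Fin 3) (A B : ℕ) (hM : M = A * B) (hAB : A.Coprime B) (x0 y0 : ℤ) (n : ℕ)
    (hn : n.Coprime A) (h : (A : ℤ) ∣ x0 ^ 2 - d i * y0 ^ 2 - n) :
    ∃ N : ℕ, N.Coprime M ∧ N ≡ n [MOD A] ∧ N ≡ 1 [MOD B] ∧ J(d i | N) = 1 ∧ ff d M N = 1 := by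
  have hM0 := D.M0
  rw [hM] at hM0
  obtain ⟨x, y, N, hN, h1, h2, h3⟩ := crtN A B hAB (left_ne_zero_of_mul hM0)
    (right_ne_zero_of_mul hM0) (d i) x0 y0
  have e1 : N ≡ n [MOD A] := by
    apply modEq_of_dvd_sub
    have h4 := dvd_add h1 h
    rwa [sub_add_sub_cancel] at h4
  have e2 : N ≡ 1 [MOD B] := by
    apply modEq_of_dvd_sub
    exact_mod_cast h2
  have hc : N.Coprime M := by
    rw [hM]
    apply Nat.Coprime.mul_right
    · rw [Nat.Coprime, e1.gcd_eq]; exact hn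
    · exact coprime_of_modEq_one e2
  exact ⟨N, hc, e1, e2, D.ff_norm i N x y hc hN⟩

/-- Case I. -/
theorem Dat.caseI (D : Dat d M) (p A B : ℕ) (hp : p.Prime) (hM : M = A * B) (hpA : p ∣ A) (hAB : A.Coprime B)
    (hA : ∀ r : ℕ, r.Coprime p → r.Coprime A)
    (hloc : ∀ n : ℕ, n.Coprime A → ∃ x0 y0 : ℤ, (A : ℤ) ∣ x0 ^ 2 - d 0 * y0 ^ 2 - n)
    (h1 : ∃ x0 y0 k0 : ℤ, x0 ^ 2 - d 1 * y0 ^ 2 = p * k0 ∧ ¬ (p : ℤ) ∣ k0)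
    (h2 : ∃ x0 y0 k0 : ℤ, x0 ^ 2 - d 2 * y0 ^ 2 = p * k0 ∧ ¬ (p : ℤ) ∣ k0)
    (hJ : ∀ r : ℕ, r.Coprime M → p * r ≡ 1 [MOD B] → J(d 0 | r) = -1) : Mult d M := by
  have hM0 := D.M0
  rw [hM] at hM0
  have hA0 := left_ne_zero_of_mul hM0
  have hB0 := right_ne_zero_of_mul hM0
  have hpB : p.Coprime B := hAB.coprime_dvd_left hpA
  have hcp : ∀ q : ℕ, q.Prime → (q : ℤ) ∣ (p : ℤ) ^ 1 → q ∣ M := by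
    intro q hq hd
    have : q ∣ p := by rw [pow_one] at hd; exact_mod_cast hd
    exact this.trans (hpA.trans (hM ▸ dvd_mul_right _ _))
  have hp0 : (p : ℤ) ≠ 0 := by exact_mod_cast hp.ne_zero
  have aux : ∀ j : Fin 3, (∃ x0 y0 k0 : ℤ, x0 ^ 2 - d j * y0 ^ 2 = p * k0 ∧ ¬ (p : ℤ) ∣ k0) →
      ∃ r : ℕ, r.Coprime M ∧ J(d j | r) = 1 ∧ J(d 0 | r) = -1 ∧ p * r ≡ 1 [MOD B] ∧
        cls d p * ff d M r = 1 := by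
    rintro j ⟨x0, y0, k0, e1, e2⟩
    obtain ⟨x, y, r, a1, a2, a3⟩ := liftN p A B 1 hp hA hpB hB0 (d j) x0 y0 k0 (by rw [e1]; ring) e2
    rw [← hM] at a1
    have g := D.lemG j _ hcp r x y a1 a2
    rw [pow_one] at a2 a3
    refine ⟨r, a1, g.1, hJ r a1 a3, a3, ?_⟩
    rw [← g.2, ← cls_mul d _ _ hp0 (by exact_mod_cast (D.pos a1).ne')]
    exact cls_norm d j _ ⟨x, y, by exact_mod_cast a2.symm⟩
  obtain ⟨u, u1, u2, u3, u4, u5⟩ := aux 1 h1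
  obtain ⟨v, v1, v2, v3, v4, v5⟩ := aux 2 h2
  have hu2 : J(d 2 | u) = -1 := by
    have := D.J_prod u1
    rw [u2, u3] at this
    linarith
  have hv1 : J(d 1 | v) = -1 := by
    have := D.J_prod v1
    rw [v2, v3] at this
    linarith
  have huvM := u1.mul_left v1
  have hffuv : ff d M u * ff d M v = 1 := by
    have := congrArg₂ (· * ·) u5 v5
    simp only [mul_one] at this
    rw [mul_mul_mul_comm, quot_sq, one_mul] at this
    exact this
  refine D.mult_of_pair 1 2 0 (fun g => by rw [mul_comm, ← mul_assoc]) u v u1 v1 u2 hu2 v2 hv1 ?_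
  rw [hffuv]
  have huvA : (u * v).Coprime A := huvM.coprime_dvd_right (hM ▸ dvd_mul_right _ _)
  obtain ⟨x0, y0, hx⟩ := hloc (u * v) huvA
  obtain ⟨N, n1, n2, n3, n4, n5⟩ := D.norm_res 0 A B hM hAB x0 y0 (u * v) huvA hx
  -- s ≡ 1 mod A, s ≡ p mod B
  obtain ⟨s, hs1, hs2⟩ := Nat.chineseRemainder hAB 1 p
  have hsM : s.Coprime M := by
    rw [hM]
    apply Nat.Coprime.mul_right (coprime_of_modEq_one hs1)
    rw [Nat.Coprime, hs2.gcd_eq]; exact hpB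
  rw [← D.ff_mul_sq huvM hsM, ← n5]
  symm
  apply D.ff_congr (huvM.mul_left (hsM.mul_left hsM))
  rw [hM, ← Nat.modEq_and_modEq_iff_modEq_mul hAB]
  constructor
  · have := (hs1.mul hs1).mul_left (u * v)
    rw [mul_one, mul_one] at this
    exact n2.trans this.symm
  · refine n3.trans ?_
    have e1 := (hs2.mul hs2).mul_left (u * v)
    have e2 := u4.mul v4
    rw [mul_one] at e2
    refine e2.symm.trans (Nat.ModEq.trans ?_ e1.symm)
    rw [show p * u * (p * v) = u * v * (p * p) by ring]

/-- All classes congruent to one modulo the complementary factor are trivial. -/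
def Good (d : Fin 3 → ℤ) (M A : ℕ) : Prop :=
  ∀ B : ℕ, M = A * B → A.Coprime B → ∀ n : ℕ, n.Coprime M → n ≡ 1 [MOD B] → ff d M n = 1

theorem Dat.good_of_loc (D : Dat d M) (hm : Mult d M) (A : ℕ)
    (h : ∀ n : ℕ, n.Coprime A → ∃ (i j : Fin 3) (x y x' y' : ℤ) (a b : ℕ), a.Coprime A ∧ b.Coprime A ∧
      (A : ℤ) ∣ x ^ 2 - d i * y ^ 2 - a ∧ (A : ℤ) ∣ x' ^ 2 - d j * y' ^ 2 - b ∧ a * b ≡ n [MOD A]) :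
    Good d M A := by
  intro B hM hAB n hn hn1
  obtain ⟨i, j, x, y, x', y', a, b, ha, hb, h1, h2, h3⟩ :=
    h n (hn.coprime_dvd_right (hM ▸ dvd_mul_right _ _))
  obtain ⟨N, n1, n2, n3, n4, n5⟩ := D.norm_res i A B hM hAB x y a ha h1
  obtain ⟨N', n1', n2', n3', n4', n5'⟩ := D.norm_res j A B hM hAB x' y' b hb h2
  have : ff d M (N * N') = 1 := by rw [hm N N' n1 n1', n5, n5', one_mul]
  rw [← this]
  apply D.ff_congr (n1.mul_left n1')
  rw [hM, ← Nat.modEq_and_modEq_iff_modEq_mul hAB]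
  exact ⟨((n2.mul n2').trans h3).symm, hn1.trans (n3.mul n3').symm⟩

theorem Dat.good_mul (D : Dat d M) (hm : Mult d M) (A A' : ℕ) (hAA : A.Coprime A') (h : Good d M A)
    (h' : Good d M A') : Good d M (A * A') := by
  intro B hM hAB n hn hn1
  have c1 : A.Coprime B := hAB.coprime_dvd_left (dvd_mul_right _ _)
  have c2 : A'.Coprime B := hAB.coprime_dvd_left (dvd_mul_left _ _)
  have hnA : n.Coprime A := hn.coprime_dvd_right (hM ▸ (dvd_mul_right _ _).trans (dvd_mul_right _ _))
  have hnA' : n.Coprime A' := hn.coprime_dvd_right (hM ▸ (dvd_mul_left _ _).trans (dvd_mul_right _ _))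
  have cc1 : A.Coprime (A' * B) := hAA.mul_right c1
  have cc2 : A'.Coprime (A * B) := hAA.symm.mul_right c2
  have e1 : M = A * (A' * B) := by rw [hM]; ring
  have e2 : M = A' * (A * B) := by rw [hM]; ring
  obtain ⟨u, u1, u2⟩ := Nat.chineseRemainder cc1 n 1
  obtain ⟨v, v1, v2⟩ := Nat.chineseRemainder cc2 n 1
  have uM : u.Coprime M := by
    rw [e1]
    apply Nat.Coprime.mul_right _ (coprime_of_modEq_one u2)
    rw [Nat.Coprime, u1.gcd_eq]; exact hnA
  have vM : v.Coprime M := by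
    rw [e2]
    apply Nat.Coprime.mul_right _ (coprime_of_modEq_one v2)
    rw [Nat.Coprime, v1.gcd_eq]; exact hnA'
  have : ff d M (u * v) = 1 := by
    rw [hm u v uM vM, h _ e1 cc1 u uM u2, h' _ e2 cc2 v vM v2, one_mul]
  rw [← this]
  apply D.ff_congr (uM.mul_left vM)
  rw [e1, ← Nat.modEq_and_modEq_iff_modEq_mul cc1, ← Nat.modEq_and_modEq_iff_modEq_mul
    (hAB.coprime_dvd_left (dvd_mul_left _ _))]
  refine ⟨?_, ?_, ?_⟩
  · have := u1.mul (v2.of_dvd (dvd_mul_right A B))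
    rw [mul_one] at this
    exact this.symm
  · have := (u2.of_dvd (dvd_mul_right A' B)).mul v1
    rw [one_mul] at this
    exact this.symm
  · have := (u2.of_dvd (dvd_mul_left B A')).mul (v2.of_dvd (dvd_mul_left B A))
    exact hn1.trans this.symm

theorem Dat.good_all (D : Dat d M) (hm : Mult d M) (m : ℕ) (hM : M = 8 * m) (hsq : Squarefree m) (hodd : Odd m)
    (h8 : Good d M 8) (hq : ∀ q : ℕ, q.Prime → q ∣ m → Good d M q) (n : ℕ) (hn : n.Coprime M) :
    ff d M n = 1 := by
  have key : ∀ k : ℕ, k ∣ m → Good d M k := by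
    intro k
    induction k using induction_on_primes with
    | zero => intro h; exact absurd (zero_dvd_iff.mp h) hsq.ne_zero
    | one =>
      intro _ B hB _ n hn h1
      rw [← D.ff_one]
      apply D.ff_congr (Nat.coprime_one_left _)
      rw [hB, one_mul]; exact h1
    | prime_mul p k hp ih =>
      intro h
      have hsq' := hsq.squarefree_of_dvd h
      exact D.good_mul hm p k (Nat.coprime_of_squarefree_mul hsq')
        (hq p hp ((dvd_mul_right _ _).trans h)) (ih ((dvd_mul_left _ _).trans h))
  have h8m : Nat.Coprime 8 m := by
    have : Nat.Coprime (2 ^ 3) m := Nat.Coprime.pow_left _ (Nat.coprime_two_left.mpr hodd)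
    simpa using this
  exact D.good_mul hm 8 m h8m h8 (key m dvd_rfl) 1 (by rw [hM, mul_one]) (by simp) n hn (Nat.modEq_one)

/-- Conclusion from triviality of `ff`. -/
theorem Dat.top_of (D : Dat d M) (hm : Mult d M) (h1 : ∀ n : ℕ, n.Coprime M → ff d M n = 1)
    (hq : ∀ q : ℕ, q.Prime → q ∣ M → ∃ (A B e : ℕ) (i : Fin 3) (x0 y0 k0 : ℤ), M = A * B ∧
      (∀ r : ℕ, r.Coprime q → r.Coprime A) ∧ q.Coprime B ∧
      x0 ^ 2 - d i * y0 ^ 2 = q ^ (2 * e + 1) * k0 ∧ ¬ (q : ℤ) ∣ k0) : HH d = ⊤ := by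
  have hcop : ∀ n : ℕ, n.Coprime M → cls d n = 1 := fun n hn => by rw [D.full hm n hn, h1 n hn]
  have hprime : ∀ q : ℕ, q.Prime → cls d q = 1 := by
    intro q hqp
    by_cases hqM : q ∣ M
    · obtain ⟨A, B, e, i, x0, y0, k0, hM, hA, hqB, he, hk⟩ := hq q hqp hqM
      have hM0 := D.M0
      rw [hM] at hM0
      obtain ⟨x, y, r, r1, r2, r3⟩ := liftN q A B (2 * e + 1) hqp hA hqB (right_ne_zero_of_mul hM0)
        (d i) x0 y0 k0 he hk
      rw [← hM] at r1
      have hn := cls_norm d i ((q : ℤ) ^ (2 * e + 1) * r) ⟨x, y, by exact_mod_cast r2.symm⟩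
      have hq0 : (q : ℤ) ≠ 0 := by exact_mod_cast hqp.ne_zero
      have hr0 : (r : ℤ) ≠ 0 := by exact_mod_cast (D.pos r1).ne'
      rw [show (q : ℤ) ^ (2 * e + 1) * r = q ^ e * q ^ e * (q * r) by ring,
        cls_sq_mul d _ _ (pow_ne_zero _ hq0) (mul_ne_zero hq0 hr0), cls_mul d _ _ hq0 hr0,
        hcop r r1, mul_one] at hn
      exact hn
    · exact hcop q ((hqp.coprime_iff_not_dvd).mpr hqM)
  have hnat : ∀ n : ℕ, n ≠ 0 → cls d n = 1 := by
    intro n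
    induction n using Nat.recOnMul with
    | zero => intro h; exact absurd rfl h
    | one => intro _; exact_mod_cast cls_one d
    | prime p hp => intro _; exact hprime p hp
    | mul a b iha ihb =>
      intro h
      have ha := left_ne_zero_of_mul h
      have hb := right_ne_zero_of_mul h
      push_cast
      rw [cls_mul d _ _ (by exact_mod_cast ha) (by exact_mod_cast hb), iha ha, ihb hb, one_mul]
  have hneg : cls d (-1) = 1 := by
    obtain ⟨i, hi⟩ : ∃ i, 0 < d i := by
      by_contra! hh
      have h0 := lt_of_le_of_ne (hh 0) (D.ne0 0)
      have h1 := lt_of_le_of_ne (hh 1) (D.ne0 1)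
      have h2 := lt_of_le_of_ne (hh 2) (D.ne0 2)
      obtain ⟨e, he⟩ := D.prod
      have := mul_neg_of_pos_of_neg (mul_pos_of_neg_of_neg h0 h1) h2
      rw [he] at this
      exact absurd (sq_nonneg e) (not_le.mpr this)
    have hn := cls_norm d i (-1 * ((4 * d i - 1).toNat : ℤ)) ⟨1, 2, by
      rw [Int.toNat_of_nonneg (by omega)]; push_cast; ring⟩
    rw [cls_mul d _ _ (by norm_num) (by omega), hnat _ (by omega), mul_one] at hn
    exact hn
  have clsInt : ∀ n : ℤ, n ≠ 0 → cls d n = 1 := by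
    intro n hn
    rcases Int.natAbs_eq n with h | h
    · rw [h]; exact hnat _ (Int.natAbs_ne_zero.mpr hn)
    · rw [h, neg_eq_neg_one_mul, cls_mul d _ _ (by norm_num) (by omega), hneg, one_mul]
      exact hnat _ (Int.natAbs_ne_zero.mpr hn)
  rw [eq_top_iff]
  intro c _
  have hc : (c : ℚ) ≠ 0 := c.ne_zero
  have hmem : ∀ (n : ℤ) (hn : (n : ℚ) ≠ 0), Units.mk0 (n : ℚ) hn ∈ HH d := by
    intro n hn
    have := clsInt n (by exact_mod_cast hn)
    rw [cls, dif_pos hn, QuotientGroup.eq_one_iff] at this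
    exact this
  have e1 : (((c : ℚ).num : ℤ) : ℚ) ≠ 0 := by exact_mod_cast Rat.num_ne_zero.mpr hc
  have e2 : ((((c : ℚ).den : ℤ)) : ℚ) ≠ 0 := by exact_mod_cast (c : ℚ).den_nz
  have : c = Units.mk0 _ e1 / Units.mk0 _ e2 := by
    ext
    rw [Units.val_div_eq_div_val]
    simp [Rat.num_div_den]
  rw [this]
  exact div_mem (hmem _ _) (hmem _ _)

end


theorem jac_one_mod_four (a : ℤ) (ha : a % 4 = 1) (n : ℕ) (hn : Odd n) :
    J(a | n) = J(n | a.natAbs) := by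
  rcases Int.natAbs_eq a with h | h
  · nth_rw 1 [h]
    exact jacobiSym.quadratic_reciprocity_one_mod_four (by omega) hn
  · nth_rw 1 [h]
    rw [jacobiSym.neg _ hn]
    have h3 : a.natAbs % 4 = 3 := by omega
    have hn' : n % 4 = 1 ∨ n % 4 = 3 := by
      have := Nat.odd_iff.mp hn
      omega
    rcases hn' with h4 | h4
    · rw [ZMod.χ₄_nat_one_mod_four h4, one_mul]
      exact jacobiSym.quadratic_reciprocity_one_mod_four' (Nat.odd_iff.mpr (by omega)) h4
    · rw [ZMod.χ₄_nat_three_mod_four h4, jacobiSym.quadratic_reciprocity_three_mod_four h3 h4]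
      ring

theorem jac_one_of_modEq (a : ℤ) (n : ℕ) (hn : Odd n) (h : n ≡ 1 [MOD 4 * a.natAbs]) :
    J(a | n) = 1 := by
  rw [jacobiSym.mod_right _ hn, (h : n % _ = 1 % _), ← jacobiSym.mod_right _ odd_one,
    jacobiSym.one_right]

theorem par1 (a b c e : ℤ) (q : ℤ) (hq : Prime q) (ha : Squarefree a) (h : a * b * c = e ^ 2)
    (hqa : q ∣ a) : q ∣ b ∨ q ∣ c := by
  obtain ⟨a', rfl⟩ := hqa
  have h1 : q ∣ e := hq.dvd_of_dvd_pow (h ▸ ⟨a' * b * c, by ring⟩ : q ∣ e ^ 2)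
  obtain ⟨e', rfl⟩ := h1
  have h2 : a' * b * c = q * e' ^ 2 := mul_left_cancel₀ hq.ne_zero (by linear_combination h)
  have h3 : q ∣ a' * b * c := ⟨_, h2⟩
  rcases hq.dvd_or_dvd h3 with h4 | h4
  · rcases hq.dvd_or_dvd h4 with h5 | h5
    · exact absurd (ha q (mul_dvd_mul_left q h5)) hq.not_isUnit
    · exact Or.inl h5
  · exact Or.inr h4

theorem sqf_not {q a : ℤ} (hq : Prime q) (ha : Squarefree (q * a)) : ¬ q ∣ a := fun h =>
  absurd (ha q (mul_dvd_mul_left q h)) hq.not_isUnit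

theorem par2 (a b c e : ℤ) (q : ℤ) (hq : Prime q) (ha : Squarefree a) (hb : Squarefree b)
    (hc : Squarefree c) (h : a * b * c = e ^ 2)
    (hqa : q ∣ a) (hqb : q ∣ b) (hqc : q ∣ c) : False := by
  obtain ⟨a', rfl⟩ := hqa
  obtain ⟨b', rfl⟩ := hqb
  obtain ⟨c', rfl⟩ := hqc
  have h1 : q ∣ e := hq.dvd_of_dvd_pow (h ▸ ⟨q * q * a' * b' * c', by ring⟩ : q ∣ e ^ 2)
  obtain ⟨e', rfl⟩ := h1
  have h2 : q * (a' * b' * c') = e' ^ 2 :=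
    mul_left_cancel₀ (pow_ne_zero 2 hq.ne_zero) (by linear_combination h)
  have h1 : q ∣ e' := hq.dvd_of_dvd_pow (h2 ▸ dvd_mul_right _ _ : q ∣ e' ^ 2)
  obtain ⟨e', rfl⟩ := h1
  have h3 : (a' * b' * c') = q * e' ^ 2 :=
    mul_left_cancel₀ hq.ne_zero (by linear_combination h2)
  rcases hq.dvd_or_dvd (⟨_, h3⟩ : q ∣ a' * b' * c') with h4 | h4
  · rcases hq.dvd_or_dvd h4 with h5 | h5
    · exact sqf_not hq ha h5
    · exact sqf_not hq hb h5
  · exact sqf_not hq hc h4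

theorem sq_mod8 (e : ℤ) : e ^ 2 % 8 = 0 ∨ e ^ 2 % 8 = 1 ∨ e ^ 2 % 8 = 4 := by
  have : e % 8 = 0 ∨ e % 8 = 1 ∨ e % 8 = 2 ∨ e % 8 = 3 ∨ e % 8 = 4 ∨ e % 8 = 5 ∨ e % 8 = 6 ∨
    e % 8 = 7 := by omega
  rcases this with h | h | h | h | h | h | h | h <;> simp [pow_two, Int.mul_emod, h]

theorem prod_mod8 (a b c : ℤ) : (a * b * c) % 8 = ((a % 8) * (b % 8) * (c % 8)) % 8 := by
  simp [Int.mul_emod]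

/-- odd squarefree triple with square product: possible residues -/
theorem odd_prod (a b c e : ℤ) (h : a * b * c = e ^ 2) (ha : a % 2 = 1) (hb : b % 2 = 1)
    (hc : c % 2 = 1) : ((a % 8) * (b % 8) * (c % 8)) % 8 = 1 := by
  rw [← prod_mod8, h]
  have h2 : e ^ 2 % 2 = 1 := by
    rw [← h]
    simp [Int.mul_emod, ha, hb, hc]
  have := sq_mod8 e
  omega

theorem exists_m (d : Fin 3 → ℤ) (hsq : ∀ i, Squarefree (d i)) :
    ∃ m : ℕ, Odd m ∧ Squarefree m ∧ (∀ i, (d i).natAbs ∣ 2 * m) ∧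
      ∀ q : ℕ, q.Prime → q ∣ m → ∃ i, (q : ℤ) ∣ d i := by
  classical
  let S : Finset ℕ := (Finset.univ.biUnion (fun i => (d i).natAbs.primeFactors)).erase 2
  have hS : ∀ p ∈ S, p.Prime ∧ p ≠ 2 ∧ ∃ i, (p : ℤ) ∣ d i := by
    intro p hp
    simp only [S, Finset.mem_erase, Finset.mem_biUnion, Finset.mem_univ, true_and,
      Nat.mem_primeFactors] at hp
    obtain ⟨h1, i, h2, h3, h4⟩ := hp
    exact ⟨h2, h1, i, Int.natCast_dvd.mpr h3⟩
  refine ⟨∏ p ∈ S, p, ?_, ?_, ?_, ?_⟩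
  · apply Finset.prod_induction _ Odd
    · intro a b; exact Odd.mul
    · exact odd_one
    · intro p hp
      exact (hS p hp).1.odd_of_ne_two (hS p hp).2.1
  · apply Finset.squarefree_prod_of_pairwise_isCoprime
    · intro p hp q hq hpq
      simp only [Function.onFun]
      rw [← Nat.coprime_iff_isRelPrime]
      exact (Nat.coprime_primes (hS p hp).1 (hS q hq).1).mpr hpq
    · intro p hp
      exact (hS p hp).1.prime.irreducible.squarefree
  · intro i
    have h1 : Squarefree (d i).natAbs := Int.squarefree_natAbs.mpr (hsq i)
    rw [← Nat.prod_primeFactors_of_squarefree h1]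
    have hsub : (d i).natAbs.primeFactors ⊆ insert 2 S := by
      intro p hp
      by_cases h2 : p = 2
      · simp [h2]
      · apply Finset.mem_insert_of_mem
        simp only [S, Finset.mem_erase, Finset.mem_biUnion, Finset.mem_univ, true_and]
        exact ⟨h2, i, hp⟩
    have h2 := Finset.prod_dvd_prod_of_subset _ _ (fun p : ℕ => p) hsub
    rwa [Finset.prod_insert (by simp [S])] at h2
  · intro q hq hd
    obtain ⟨p, hp, hqp⟩ := (Prime.dvd_finsetProd_iff hq.prime _).mp hd
    have := (Nat.prime_dvd_prime_iff_eq hq (hS p hp).1).mp hqp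
    subst this
    exact (hS q hp).2.2

theorem loc_odd (q : ℕ) (hq : q.Prime) (hq2 : q ≠ 2) (d : ℤ) (hd : ¬ (q : ℤ) ∣ d) (n : ℤ) :
    ∃ x y : ℤ, (q : ℤ) ∣ x ^ 2 - d * y ^ 2 - n := by
  have : Fact q.Prime := ⟨hq⟩
  have hd' : (d : ZMod q) ≠ 0 := by
    rwa [Ne, ZMod.intCast_zmod_eq_zero_iff_dvd]
  open Polynomial in
  obtain ⟨a, b, hab⟩ := FiniteField.exists_root_sum_quadratic (R := ZMod q)
    (f := X ^ 2 - C (n : ZMod q)) (g := C (-(d : ZMod q)) * X ^ 2)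
    (Polynomial.degree_X_pow_sub_C (by norm_num) _)
    (Polynomial.degree_C_mul_X_pow 2 (neg_ne_zero.mpr hd'))
    (by rw [ZMod.card]; exact hq.eq_two_or_odd.resolve_left hq2)
  obtain ⟨x, rfl⟩ := ZMod.intCast_surjective a
  obtain ⟨y, rfl⟩ := ZMod.intCast_surjective b
  refine ⟨x, y, ?_⟩
  rw [← ZMod.intCast_zmod_eq_zero_iff_dvd]
  simp at hab
  push_cast
  linear_combination hab

theorem loc_two (d : ℤ) (hd : d % 4 = 1) (n : ℕ) (hn : n % 2 = 1) :
    ∃ x y : ℤ, (8 : ℤ) ∣ x ^ 2 - d * y ^ 2 - n := by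
  have h : n % 8 = 1 ∨ n % 8 = 5 ∨ (n % 4 = 3 ∧ (8 : ℤ) ∣ 0 - d - n) ∨ (n % 4 = 3 ∧ (8 : ℤ) ∣ 4 - d - n) := by
    omega
  rcases h with h | h | ⟨_, h⟩ | ⟨_, h⟩
  · exact ⟨1, 0, by norm_num; omega⟩
  · exact ⟨1, 2, by norm_num; omega⟩
  · exact ⟨0, 1, by norm_num; omega⟩
  · exact ⟨2, 1, by norm_num; omega⟩

theorem odd_of_cop8 {n : ℕ} (h : n.Coprime 8) : n % 2 = 1 := by
  have : n.Coprime 2 := h.coprime_dvd_right (by norm_num)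
  exact Nat.odd_iff.mp (Nat.coprime_two_right.mp this)

theorem cop8_of_odd {n : ℕ} (h : n % 2 = 1) : n.Coprime 8 := by
  have : n.Coprime (2 ^ 3) := Nat.Coprime.pow_right _ (Nat.coprime_two_right.mpr (Nat.odd_iff.mpr h))
  simpa using this

theorem loc8 (d : Fin 3 → ℤ) (hsq : ∀ i, Squarefree (d i)) (e : ℤ) (hprod : d 0 * d 1 * d 2 = e ^ 2)
    (n : ℕ) (hn : n.Coprime 8) :
    ∃ (i j : Fin 3) (x y x' y' : ℤ) (a b : ℕ), a.Coprime 8 ∧ b.Coprime 8 ∧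
      ((8 : ℕ) : ℤ) ∣ x ^ 2 - d i * y ^ 2 - a ∧ ((8 : ℕ) : ℤ) ∣ x' ^ 2 - d j * y' ^ 2 - b ∧
        a * b ≡ n [MOD 8] := by
  have hn2 := odd_of_cop8 hn
  by_cases h1 : ∃ i, d i % 4 = 1
  · obtain ⟨i, hi⟩ := h1
    obtain ⟨x, y, hxy⟩ := loc_two (d i) hi n hn2
    exact ⟨i, i, x, y, 1, 0, n, 1, hn, by norm_num, hxy, by norm_num, by rw [mul_one]⟩
  push Not at h1
  -- there are an odd one and an even one
  have hno4 : ∀ i, d i % 4 ≠ 0 := by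
    intro i h4
    have := hsq i 2 (by norm_num; omega)
    exact Int.prime_two.not_isUnit this
  have ho : ∃ i, d i % 4 = 3 := by
    by_contra! hh
    have : ∀ i, (2 : ℤ) ∣ d i := by
      intro i
      have := hh i
      have := h1 i
      have := hno4 i
      omega
    exact par2 _ _ _ e 2 Int.prime_two (hsq 0) (hsq 1) (hsq 2) hprod (this 0) (this 1) (this 2)
  have he : ∃ j, d j % 4 = 2 := by
    by_contra! hh
    have h3 : ∀ i, d i % 4 = 3 := by
      intro i
      have := hh i
      have := h1 i
      have := hno4 i
      omega
    have a0 := h3 0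
    have a1 := h3 1
    have a2 := h3 2
    have := odd_prod _ _ _ e hprod (by omega) (by omega) (by omega)
    have b0 : d 0 % 8 = 3 ∨ d 0 % 8 = 7 := by omega
    have b1 : d 1 % 8 = 3 ∨ d 1 % 8 = 7 := by omega
    have b2 : d 2 % 8 = 3 ∨ d 2 % 8 = 7 := by omega
    rcases b0 with b0 | b0 <;> rcases b1 with b1 | b1 <;> rcases b2 with b2 | b2 <;>
      rw [b0, b1, b2] at this <;> norm_num at this
  obtain ⟨i, hi⟩ := ho
  obtain ⟨j, hj⟩ := he
  obtain ⟨b, hb, hbd⟩ : ∃ b : ℕ, (b = 3 ∨ b = 7) ∧ ((8 : ℕ) : ℤ) ∣ 1 ^ 2 - d j * 1 ^ 2 - b := by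
    have : d j % 8 = 2 ∨ d j % 8 = 6 := by omega
    rcases this with h | h
    · exact ⟨7, by simp, by norm_num; omega⟩
    · exact ⟨3, by simp, by norm_num; omega⟩
  have hb8 : b.Coprime 8 := by rcases hb with rfl | rfl <;> norm_num
  have e1 : ((8 : ℕ) : ℤ) ∣ 1 ^ 2 - d i * 0 ^ 2 - (1 : ℕ) := by norm_num
  have e5 : ((8 : ℕ) : ℤ) ∣ 1 ^ 2 - d i * 2 ^ 2 - (5 : ℕ) := by norm_num; omega
  have f1 : ((8 : ℕ) : ℤ) ∣ 1 ^ 2 - d j * 0 ^ 2 - (1 : ℕ) := by norm_num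
  have : n % 8 = 1 ∨ n % 8 = 5 ∨ n % 8 = b ∨ n % 8 = (5 * b) % 8 := by
    rcases hb with rfl | rfl <;> omega
  rcases this with h | h | h | h
  · exact ⟨i, j, _, _, _, _, 1, 1, by norm_num, by norm_num, e1, f1, by simp [Nat.ModEq, h]⟩
  · exact ⟨i, j, _, _, _, _, 5, 1, by norm_num, by norm_num, e5, f1, by simp [Nat.ModEq, h]⟩
  · refine ⟨i, j, _, _, _, _, 1, b, by norm_num, hb8, e1, hbd, ?_⟩
    rw [Nat.ModEq, h]
    rcases hb with rfl | rfl <;> norm_num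
  · exact ⟨i, j, _, _, _, _, 5, b, by norm_num, hb8, e5, hbd, by rw [Nat.ModEq, h]⟩

theorem val_odd (d : ℤ) (hd : Squarefree d) (q : ℕ) (hq : q.Prime) (h : (q : ℤ) ∣ d) :
    ∃ x0 y0 k0 : ℤ, x0 ^ 2 - d * y0 ^ 2 = q * k0 ∧ ¬ (q : ℤ) ∣ k0 := by
  obtain ⟨k, rfl⟩ := h
  refine ⟨0, 1, -k, by ring, ?_⟩
  rw [dvd_neg]
  exact sqf_not (Nat.prime_iff_prime_int.mp hq) hd

theorem val_two (d : ℤ) (hd : d % 4 = 3) :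
    ∃ x0 y0 k0 : ℤ, x0 ^ 2 - d * y0 ^ 2 = (2 : ℕ) * k0 ∧ ¬ ((2 : ℕ) : ℤ) ∣ k0 :=
  ⟨1, 1, (1 - d) / 2, by norm_num; omega, by norm_num; omega⟩

theorem val_two_all (d : Fin 3 → ℤ) (hsq : ∀ i, Squarefree (d i)) (e : ℤ)
    (hprod : d 0 * d 1 * d 2 = e ^ 2) :
    ∃ (f : ℕ) (i : Fin 3) (x0 y0 k0 : ℤ), x0 ^ 2 - d i * y0 ^ 2 = ((2 : ℕ) : ℤ) ^ (2 * f + 1) * k0 ∧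
      ¬ ((2 : ℕ) : ℤ) ∣ k0 := by
  by_cases h1 : ∃ i, (2 : ℤ) ∣ d i
  · obtain ⟨i, hi⟩ := h1
    obtain ⟨x, y, k, h2, h3⟩ := val_odd (d i) (hsq i) 2 Nat.prime_two hi
    exact ⟨0, i, x, y, k, by rw [h2]; ring, h3⟩
  push Not at h1
  by_cases h2 : ∃ i, d i % 4 = 3
  · obtain ⟨i, hi⟩ := h2
    obtain ⟨x, y, k, h2, h3⟩ := val_two (d i) hi
    exact ⟨0, i, x, y, k, by rw [h2]; ring, h3⟩
  push Not at h2
  have h3 : ∃ i, d i % 8 = 1 := by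
    by_contra! hh
    have h5 : ∀ i, d i % 8 = 5 := by
      intro i
      have := h1 i
      have := h2 i
      have := hh i
      omega
    have a0 := h5 0
    have a1 := h5 1
    have a2 := h5 2
    have := odd_prod _ _ _ e hprod (by omega) (by omega) (by omega)
    rw [a0, a1, a2] at this
    norm_num at this
  obtain ⟨i, hi⟩ := h3
  have : d i % 16 = 1 ∨ d i % 16 = 9 := by omega
  rcases this with h | h
  · exact ⟨1, i, 3, 1, (9 - d i) / 8, by norm_num; omega, by norm_num; omega⟩
  · exact ⟨1, i, 1, 1, (1 - d i) / 8, by norm_num; omega, by norm_num; omega⟩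


theorem cop_m8 {m : ℕ} (h : Odd m) : Nat.Coprime 8 m :=
  (cop8_of_odd (Nat.odd_iff.mp h)).symm

theorem split_m {m q : ℕ} (hsq : Squarefree m) (hodd : Odd m) (hq : q.Prime) (hqm : q ∣ m) :
    ∃ k, m = q * k ∧ q ≠ 2 ∧ q.Coprime (8 * k) ∧ 8 * m = q * (8 * k) := by
  obtain ⟨k, rfl⟩ := hqm
  have hq2 : q ≠ 2 := by
    rintro rfl
    exact absurd hodd (by simp)
  refine ⟨k, rfl, hq2, ?_, by ring⟩
  apply Nat.Coprime.mul_right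
  · exact (cop_m8 (hq.odd_of_ne_two hq2)).symm
  · rw [hq.coprime_iff_not_dvd]
    intro hk
    have := hsq q (mul_dvd_mul_left q hk)
    exact hq.prime.not_isUnit this

/-- The possible local situations at the distinguished prime. -/
def CaseHyp (d : Fin 3 → ℤ) (p : ℕ) : Prop :=
  (p ≠ 2 ∧ ¬ (p : ℤ) ∣ d 0 ∧ J(d 0 | p) = -1 ∧ (p : ℤ) ∣ d 1 ∧ (p : ℤ) ∣ d 2) ∨
  (p = 2 ∧ d 0 % 8 = 5 ∧ (((2 : ℤ) ∣ d 1 ∧ (2 : ℤ) ∣ d 2) ∨ (d 1 % 4 = 3 ∧ d 2 % 4 = 3))) ∨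
  (p = 2 ∧ d 0 % 4 = 3 ∧ (2 : ℤ) ∣ d 1 ∧ (2 : ℤ) ∣ d 2)

theorem mult_case1 {d : Fin 3 → ℤ} {m p : ℕ} (D : Dat d (8 * m)) (hsqd : ∀ i, Squarefree (d i))
    (hsq : Squarefree m) (hodd : Odd m) (hdm : ∀ i, (d i).natAbs ∣ 2 * m) (hp : p.Prime)
    (h2 : p ≠ 2) (h0 : ¬ (p : ℤ) ∣ d 0) (hJ : J(d 0 | p) = -1) (h1 : (p : ℤ) ∣ d 1)
    (h3 : (p : ℤ) ∣ d 2) : Mult d (8 * m) := by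
  have hpm : p ∣ m := by
    have : p ∣ 2 * m := (Int.natCast_dvd.mp h1).trans (hdm 1)
    rcases (hp.dvd_mul).mp this with h | h
    · exact absurd ((Nat.prime_dvd_prime_iff_eq hp Nat.prime_two).mp h) h2
    · exact h
  obtain ⟨k, hk, -, hcop, hM⟩ := split_m hsq hodd hp hpm
  have hd0 : 4 * (d 0).natAbs ∣ 8 * k := by
    have e1 : (d 0).natAbs ∣ p * (2 * k) := by
      have := hdm 0
      rwa [hk, show 2 * (p * k) = p * (2 * k) by ring] at this
    have e2 : (d 0).natAbs.Coprime p :=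
      (hp.coprime_iff_not_dvd.mpr (fun h => h0 (Int.natCast_dvd.mpr h))).symm
    have e3 := e2.dvd_of_dvd_mul_left e1
    rw [show 8 * k = 4 * (2 * k) by ring]
    exact mul_dvd_mul_left 4 e3
  refine D.caseI p p (8 * k) hp hM dvd_rfl hcop (fun r h => h)
    (fun n _ => loc_odd p hp h2 (d 0) h0 n) (val_odd _ (hsqd 1) p hp h1)
    (val_odd _ (hsqd 2) p hp h3) ?_
  intro r hr hpr
  have ho : Odd (p * r) := (hp.odd_of_ne_two h2).mul (D.odd hr)
  have e := jac_one_of_modEq (d 0) (p * r) ho (hpr.of_dvd hd0)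
  rw [jacobiSym.mul_right' _ hp.ne_zero (D.pos hr).ne', hJ] at e
  linarith

theorem mult_case2 {d : Fin 3 → ℤ} {m : ℕ} (D : Dat d (8 * m)) (hsqd : ∀ i, Squarefree (d i))
    (hodd : Odd m) (hdm : ∀ i, (d i).natAbs ∣ 2 * m)
    (h0 : d 0 % 8 = 5)
    (h1 : (((2 : ℤ) ∣ d 1 ∧ (2 : ℤ) ∣ d 2) ∨ (d 1 % 4 = 3 ∧ d 2 % 4 = 3))) : Mult d (8 * m) := by
  have hd0o : Odd (d 0).natAbs := Nat.odd_iff.mpr (by omega)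
  have hd0 : (d 0).natAbs ∣ m :=
    (Nat.Coprime.dvd_of_dvd_mul_left (Nat.coprime_two_right.mpr hd0o) (hdm 0))
  have hh : (∃ x0 y0 k0 : ℤ, x0 ^ 2 - d 1 * y0 ^ 2 = (2 : ℕ) * k0 ∧ ¬ ((2 : ℕ) : ℤ) ∣ k0) ∧
      (∃ x0 y0 k0 : ℤ, x0 ^ 2 - d 2 * y0 ^ 2 = (2 : ℕ) * k0 ∧ ¬ ((2 : ℕ) : ℤ) ∣ k0) := by
    rcases h1 with ⟨h1, h2⟩ | ⟨h1, h2⟩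
    · exact ⟨val_odd _ (hsqd 1) 2 Nat.prime_two h1, val_odd _ (hsqd 2) 2 Nat.prime_two h2⟩
    · exact ⟨val_two _ h1, val_two _ h2⟩
  refine D.caseI 2 8 m Nat.prime_two rfl (by norm_num) (cop_m8 hodd)
    (fun r h => cop8_of_odd (Nat.odd_iff.mp (Nat.coprime_two_right.mp h)))
    (fun n hn => by exact_mod_cast loc_two (d 0) (by omega) n (odd_of_cop8 hn)) hh.1 hh.2 ?_
  intro r hr hpr
  rw [jac_one_mod_four (d 0) (by omega) r (D.odd hr)]
  have e1 : J(((2 * r : ℕ) : ℤ) | (d 0).natAbs) = 1 := by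
    rw [jacobiSym.mod_left, (Int.natCast_modEq_iff.mpr (hpr.of_dvd hd0) : _ % _ = _ % _),
      ← jacobiSym.mod_left]
    simp
  have e2 : J(2 | (d 0).natAbs) = -1 := by
    rw [jacobiSym.at_two hd0o, ZMod.χ₈_nat_eq_if_mod_eight]
    rw [if_neg (by omega), if_neg (by omega)]
  push_cast at e1
  rw [jacobiSym.mul_left, e2] at e1
  linarith

theorem mult_case3 {d : Fin 3 → ℤ} {m : ℕ} (D : Dat d (8 * m))
    (hsqd : ∀ i, Squarefree (d i)) (hodd : Odd m) (hdm : ∀ i, (d i).natAbs ∣ 2 * m)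
    (h0 : d 0 % 4 = 3) (h1 : (2 : ℤ) ∣ d 1) (h2 : (2 : ℤ) ∣ d 2) : Mult d (8 * m) := by
  have hd0o : Odd (d 0).natAbs := Nat.odd_iff.mpr (by omega)
  have hd0 : (d 0).natAbs ∣ m :=
    (Nat.Coprime.dvd_of_dvd_mul_left (Nat.coprime_two_right.mpr hd0o) (hdm 0))
  obtain ⟨f1, hf1⟩ := h1
  obtain ⟨f2, hf2⟩ := h2
  have g1 : f1 % 2 = 1 := by
    have := sqf_not Int.prime_two (hf1 ▸ hsqd 1); omega
  have g2 : f2 % 2 = 1 := by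
    have := sqf_not Int.prime_two (hf2 ▸ hsqd 2); omega
  obtain ⟨e, he⟩ := D.prod
  have he2 : (2 : ℤ) ∣ e := Int.prime_two.dvd_of_dvd_pow
    (n := 2) (he ▸ ⟨d 0 * f1 * d 2, by rw [hf1]; ring⟩)
  obtain ⟨e', rfl⟩ := he2
  have he' : d 0 * f1 * f2 = e' ^ 2 := by
    rw [hf1, hf2] at he
    linarith
  have hres := odd_prod _ _ _ _ he' (by omega) g1 g2
  have hcm := cop_m8 hodd
  obtain ⟨u, u1, u2, u3, u4, u5⟩ := D.norm_res 0 8 m rfl hcm 1 2 5 (by norm_num)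
    (by norm_num; omega)
  have key : ∃ b c : ℕ, (b = 3 ∨ b = 7) ∧ (c = 3 ∨ c = 7) ∧ 5 * b ≡ c [MOD 8] ∧
      ((8 : ℕ) : ℤ) ∣ 1 ^ 2 - d 1 * 1 ^ 2 - b ∧ ((8 : ℕ) : ℤ) ∣ 1 ^ 2 - d 2 * 1 ^ 2 - c := by
    have b0 : d 0 % 8 = 3 ∨ d 0 % 8 = 7 := by omega
    have b1 : f1 % 8 = 1 ∨ f1 % 8 = 3 ∨ f1 % 8 = 5 ∨ f1 % 8 = 7 := by omega
    have b2 : f2 % 8 = 1 ∨ f2 % 8 = 3 ∨ f2 % 8 = 5 ∨ f2 % 8 = 7 := by omega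
    have b3 : (f1 % 4 = 1 ∧ f2 % 4 = 3) ∨ (f1 % 4 = 3 ∧ f2 % 4 = 1) := by
      rcases b0 with b0 | b0 <;> rcases b1 with b1 | b1 | b1 | b1 <;>
        rcases b2 with b2 | b2 | b2 | b2 <;>
        rw [b0, b1, b2] at hres <;> norm_num at hres <;> omega
    rcases b3 with ⟨b3, b4⟩ | ⟨b3, b4⟩
    · exact ⟨7, 3, by simp, by simp, by decide, by norm_num; omega, by norm_num; omega⟩
    · exact ⟨3, 7, by simp, by simp, by decide, by norm_num; omega, by norm_num; omega⟩
  obtain ⟨b, c, hb, hc, hbc, hb', hc'⟩ := key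
  obtain ⟨v, v1, v2, v3, v4, v5⟩ := D.norm_res 1 8 m rfl hcm 1 1 b
    (by rcases hb with rfl | rfl <;> norm_num) hb'
  obtain ⟨w, w1, w2, w3, w4, w5⟩ := D.norm_res 2 8 m rfl hcm 1 1 c
    (by rcases hc with rfl | rfl <;> norm_num) hc'
  have huvw : u * v ≡ w [MOD 8 * m] := by
    rw [← Nat.modEq_and_modEq_iff_modEq_mul hcm]
    exact ⟨((u2.mul v2).trans hbc).trans w2.symm, by simpa using (u3.mul v3).trans w3.symm⟩
  have hu8 : u % 8 = 5 := u2
  have hv8 : v % 8 = b := by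
    rw [(v2 : v % 8 = b % 8)]; rcases hb with rfl | rfl <;> norm_num
  refine D.mult_of_pair 0 1 2 (fun g => rfl) u v u1 v1 u4 ?_ v4 ?_ ?_
  · rw [hf1, jacobiSym.mul_left, jacobiSym.at_two (D.odd u1), ZMod.χ₈_nat_eq_if_mod_eight,
      if_neg (by omega), if_neg (by omega)]
    have : u ≡ 1 [MOD 4 * f1.natAbs] := by
      apply (Nat.modEq_and_modEq_iff_modEq_mul _).mp
      · refine ⟨?_, u3.of_dvd ?_⟩
        · show u % 4 = 1 % 4
          omega
        · have := hdm 1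
          rw [hf1, Int.natAbs_mul] at this
          exact Nat.dvd_of_mul_dvd_mul_left (by norm_num) this
      · have : Nat.Coprime (2 ^ 2) f1.natAbs :=
          Nat.Coprime.pow_left _ (Nat.coprime_two_left.mpr (Nat.odd_iff.mpr (by omega)))
        simpa using this
    rw [jac_one_of_modEq f1 u (D.odd u1) this]
    norm_num
  · have h4 : J(-d 0 | v) = 1 := by
      rw [jac_one_mod_four (-d 0) (by omega) v (D.odd v1), Int.natAbs_neg, jacobiSym.mod_left,
        (Int.natCast_modEq_iff.mpr (v3.of_dvd hd0) : _ % _ = _ % _), ← jacobiSym.mod_left]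
      simp
    rw [jacobiSym.neg _ (D.odd v1), ZMod.χ₄_nat_three_mod_four (by omega)] at h4
    linarith
  · rw [D.ff_congr w1 huvw, w5, u5, v5, one_mul]

theorem main4 (d : Fin 3 → ℤ) (hsqd : ∀ i, Squarefree (d i)) (e : ℤ)
    (he : d 0 * d 1 * d 2 = e ^ 2) (p : ℕ) (hp : p.Prime) (hc : CaseHyp d p) : HH d = ⊤ := by
  obtain ⟨m, hodd, hsq, hdm, hmq⟩ := exists_m d hsqd
  have D : Dat d (8 * m) :=
    { ne0 := fun i => (hsqd i).ne_zero
      prod := ⟨e, he⟩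
      M0 := mul_ne_zero (by norm_num) hsq.ne_zero
      dvd8 := dvd_mul_right _ _
      dvd := fun i => by
        rw [show 8 * m = 4 * (2 * m) by ring]
        exact mul_dvd_mul_left 4 (hdm i) }
  have hm : Mult d (8 * m) := by
    rcases hc with ⟨h1, h2, h3, h4, h5⟩ | ⟨-, h2, h3⟩ | ⟨-, h2, h3, h4⟩
    · exact mult_case1 D hsqd hsq hodd hdm hp h1 h2 h3 h4 h5
    · exact mult_case2 D hsqd hodd hdm h2 h3
    · exact mult_case3 D hsqd hodd hdm h2 h3 h4
  refine D.top_of hm (D.good_all hm m rfl hsq hodd ?_ ?_) ?_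
  · exact D.good_of_loc hm 8 (fun n hn => loc8 d hsqd e he n hn)
  · intro q hq hqm
    obtain ⟨k, -, hq2, -, -⟩ := split_m hsq hodd hq hqm
    apply D.good_of_loc hm q
    intro n hn
    have : ∃ i, ¬ (q : ℤ) ∣ d i := by
      by_contra! h
      exact par2 _ _ _ e q (Nat.prime_iff_prime_int.mp hq) (hsqd 0) (hsqd 1) (hsqd 2) he
        (h 0) (h 1) (h 2)
    obtain ⟨i, hi⟩ := this
    obtain ⟨x, y, hxy⟩ := loc_odd q hq hq2 (d i) hi n
    exact ⟨i, i, x, y, 1, 0, n, 1, hn, by simp, hxy, by simp, by rw [mul_one]⟩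
  · intro q hq hqM
    by_cases hq2 : q = 2
    · subst hq2
      obtain ⟨f, i, x, y, k, h1, h2⟩ := val_two_all d hsqd e he
      exact ⟨8, m, f, i, x, y, k, rfl,
        fun r h => cop8_of_odd (Nat.odd_iff.mp (Nat.coprime_two_right.mp h)),
        Nat.coprime_two_left.mpr hodd, h1, h2⟩
    · have hqm : q ∣ m := by
        rcases (hq.dvd_mul).mp hqM with h | h
        · exact absurd ((Nat.prime_dvd_prime_iff_eq hq Nat.prime_two).mp
            (hq.dvd_of_dvd_pow (show q ∣ 2 ^ 3 from h))) hq2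
        · exact h
      obtain ⟨k, -, -, hcop, hM⟩ := split_m hsq hodd hq hqm
      obtain ⟨i, hi⟩ := hmq q hq hqm
      obtain ⟨x, y, k0, h1, h2⟩ := val_odd (d i) (hsqd i) q hq hi
      exact ⟨q, 8 * k, 0, i, x, y, k0, hM, fun r h => h, hcop, by rw [h1]; ring, h2⟩


theorem padic_sq (p : ℕ) [Fact p.Prime] (d x : ℤ)
    (h : ‖((x ^ 2 - d : ℤ) : ℤ_[p])‖ < ‖((2 * x : ℤ) : ℤ_[p])‖ ^ 2) : IsSquare (d : ℚ_[p]) := by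
  obtain ⟨z, hz, -⟩ := hensels_lemma (p := p) (R := ℤ_[p])
    (F := (Polynomial.X ^ 2 - Polynomial.C (d : ℤ_[p]))) (a := (x : ℤ_[p]))
    (by
      simp only [map_sub, map_pow, Polynomial.aeval_X, Polynomial.aeval_C,
        Polynomial.derivative_X_pow, Polynomial.derivative_C]
      push_cast at h
      simpa using h)
  refine ⟨(z : ℚ_[p]), ?_⟩
  simp [sub_eq_zero] at hz
  have : ((z ^ 2 : ℤ_[p]) : ℚ_[p]) = ((d : ℤ_[p]) : ℚ_[p]) := by rw [hz]
  push_cast at this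
  rw [← this, pow_two]

theorem ns_odd (p : ℕ) [hp : Fact p.Prime] (h2 : p ≠ 2) (d : ℤ) (hd : ¬ (p : ℤ) ∣ d)
    (h : ¬ IsSquare (d : ℚ_[p])) : J(d | p) = -1 := by
  have hd' : (d : ZMod p) ≠ 0 := by rwa [Ne, ZMod.intCast_zmod_eq_zero_iff_dvd]
  rw [← jacobiSym.legendreSym.to_jacobiSym]
  rw [legendreSym.eq_neg_one_iff]
  rintro ⟨y, hy⟩
  obtain ⟨x, rfl⟩ := ZMod.intCast_surjective y
  apply h
  have e1 : (p : ℤ) ∣ x ^ 2 - d := by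
    rw [← ZMod.intCast_zmod_eq_zero_iff_dvd]
    push_cast
    rw [hy]; ring
  have hpp := Nat.prime_iff_prime_int.mp hp.out
  have e2 : ¬ (p : ℤ) ∣ 2 * x := by
    intro h3
    rcases hpp.dvd_or_dvd h3 with h4 | h4
    · exact h2 ((Nat.prime_dvd_prime_iff_eq hp.out Nat.prime_two).mp (by exact_mod_cast h4))
    · apply hd
      have : (p : ℤ) ∣ x ^ 2 := dvd_pow h4 (by norm_num)
      exact (dvd_sub_right this).mp e1
  apply padic_sq p d x
  have n1 : ‖((x ^ 2 - d : ℤ) : ℤ_[p])‖ < 1 := PadicInt.norm_int_lt_one_iff_dvd _ |>.mpr e1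
  have n2 : ‖((2 * x : ℤ) : ℤ_[p])‖ = 1 := by
    apply le_antisymm (PadicInt.norm_le_one _)
    by_contra! h3
    exact e2 (PadicInt.norm_int_lt_one_iff_dvd _ |>.mp h3)
  rw [n2]; simpa using n1

theorem ns_two [hp : Fact (Nat.Prime 2)] (d : ℤ) (h : ¬ IsSquare (d : ℚ_[2])) : d % 8 ≠ 1 := by
  intro h8
  apply h
  apply padic_sq 2 d 1
  have n1 : ‖((1 ^ 2 - d : ℤ) : ℤ_[2])‖ ≤ ((2 : ℕ) : ℝ) ^ (-(3 : ℕ) : ℤ) := by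
    rw [PadicInt.norm_int_le_pow_iff_dvd]
    norm_num
    omega
  have n2 : ‖((2 * 1 : ℤ) : ℤ_[2])‖ = 2⁻¹ := by
    have := PadicInt.norm_p (p := 2)
    push_cast at this ⊢
    simpa using this
  rw [n2]
  refine n1.trans_lt ?_
  norm_num

def NS (p : ℕ) (d : ℤ) : Prop := (p ≠ 2 → ¬ (p : ℤ) ∣ d → J(d | p) = -1) ∧ (p = 2 → d % 8 ≠ 1)

theorem ns_of (p : ℕ) [hp : Fact p.Prime] (d : ℤ) (h : ¬ IsSquare (d : ℚ_[p])) : NS p d := by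
  refine ⟨fun h2 hd => ns_odd p h2 d hd h, fun h2 => ?_⟩
  subst h2
  exact ns_two d h

theorem case_two (x y z : ℤ) (hx : x % 2 = 1) (nx : x % 8 ≠ 1) (hy : (2 : ℤ) ∣ y)
    (hz : (2 : ℤ) ∣ z) (h4 : x % 4 = 1 ∨ x % 4 = 3) : CaseHyp ![x, y, z] 2 := by
  rcases h4 with h4 | h4
  · exact Or.inr (Or.inl ⟨rfl, show x % 8 = 5 by omega, Or.inl ⟨hy, hz⟩⟩)
  · exact Or.inr (Or.inr ⟨rfl, h4, hy, hz⟩)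

theorem case_two_odd (x y z : ℤ) (hx : x % 8 = 5) (hy : y % 4 = 3) (hz : z % 4 = 3) :
    CaseHyp ![x, y, z] 2 :=
  Or.inr (Or.inl ⟨rfl, hx, Or.inr ⟨hy, hz⟩⟩)

theorem local3 (p : ℕ) (hp : p.Prime) (a b c e : ℤ) (ha : Squarefree a) (hb : Squarefree b)
    (hc : Squarefree c) (he : a * b * c = e ^ 2) (na : NS p a) (nb : NS p b) (nc : NS p c) :
    CaseHyp ![a, b, c] p ∨ CaseHyp ![b, a, c] p ∨ CaseHyp ![c, a, b] p := by
  have hpp := Nat.prime_iff_prime_int.mp hp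
  have p1 := par1 a b c e p hpp ha he
  have p2 := par1 b a c e p hpp hb (by linarith)
  have p3 := par1 c a b e p hpp hc (by linarith)
  have p4 := par2 a b c e p hpp ha hb hc he
  have key : (¬ (p : ℤ) ∣ a ∧ ¬ (p : ℤ) ∣ b ∧ ¬ (p : ℤ) ∣ c) ∨
      (¬ (p : ℤ) ∣ a ∧ (p : ℤ) ∣ b ∧ (p : ℤ) ∣ c) ∨
      (¬ (p : ℤ) ∣ b ∧ (p : ℤ) ∣ a ∧ (p : ℤ) ∣ c) ∨
      (¬ (p : ℤ) ∣ c ∧ (p : ℤ) ∣ a ∧ (p : ℤ) ∣ b) := by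
    by_cases ka : (p : ℤ) ∣ a <;> by_cases kb : (p : ℤ) ∣ b <;> by_cases kc : (p : ℤ) ∣ c <;>
      simp_all
  clear p1 p2 p3 p4
  by_cases h2 : p = 2
  · subst h2
    have na := na.2 rfl
    have nb := nb.2 rfl
    have nc := nc.2 rfl
    push_cast at key
    rcases key with ⟨k1, k2, k3⟩ | ⟨k1, k2, k3⟩ | ⟨k1, k2, k3⟩ | ⟨k1, k2, k3⟩
    · have := odd_prod a b c e he (by omega) (by omega) (by omega)
      have ra : a % 8 = 3 ∨ a % 8 = 5 ∨ a % 8 = 7 := by omega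
      have rb : b % 8 = 3 ∨ b % 8 = 5 ∨ b % 8 = 7 := by omega
      have rc : c % 8 = 3 ∨ c % 8 = 5 ∨ c % 8 = 7 := by omega
      have hfin : (a % 8 = 5 ∧ b % 4 = 3 ∧ c % 4 = 3) ∨ (b % 8 = 5 ∧ a % 4 = 3 ∧ c % 4 = 3) ∨
          (c % 8 = 5 ∧ a % 4 = 3 ∧ b % 4 = 3) := by
        rcases ra with ra | ra | ra <;> rcases rb with rb | rb | rb <;>
          rcases rc with rc | rc | rc <;> rw [ra, rb, rc] at this <;> norm_num at this <;>
          clear he <;> omega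
      rcases hfin with ⟨f1, f2, f3⟩ | ⟨f1, f2, f3⟩ | ⟨f1, f2, f3⟩
      · exact Or.inl (case_two_odd _ _ _ f1 f2 f3)
      · exact Or.inr (Or.inl (case_two_odd _ _ _ f1 f2 f3))
      · exact Or.inr (Or.inr (case_two_odd _ _ _ f1 f2 f3))
    · exact Or.inl (case_two _ _ _ (by omega) na k2 k3 (by omega))
    · exact Or.inr (Or.inl (case_two _ _ _ (by omega) nb k2 k3 (by omega)))
    · exact Or.inr (Or.inr (case_two _ _ _ (by omega) nc k2 k3 (by omega)))
  · have na := na.1 h2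
    have nb := nb.1 h2
    have nc := nc.1 h2
    rcases key with ⟨oa, ob, oc⟩ | ⟨k1, k2, k3⟩ | ⟨k1, k2, k3⟩ | ⟨k1, k2, k3⟩
    · exfalso
      have h1 : J(a * b * c | p) = -1 := by
        rw [jacobiSym.mul_left, jacobiSym.mul_left, na oa, nb ob, nc oc]; norm_num
      rw [he, jacobiSym.pow_left] at h1
      have := sq_nonneg (J(e | p))
      omega
    · exact Or.inl (Or.inl ⟨h2, k1, na k1, k2, k3⟩)
    · exact Or.inr (Or.inl (Or.inl ⟨h2, k1, nb k1, k2, k3⟩))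
    · exact Or.inr (Or.inr (Or.inl ⟨h2, k1, nc k1, k2, k3⟩))

theorem top3 (p : ℕ) (hp : p.Prime) (a b c e : ℤ) (ha : Squarefree a) (hb : Squarefree b)
    (hc : Squarefree c) (he : a * b * c = e ^ 2) (na : NS p a) (nb : NS p b) (nc : NS p c) :
    Nm a ⊔ Nm b ⊔ Nm c = ⊤ := by
  rcases local3 p hp a b c e ha hb hc he na nb nc with h | h | h
  · exact main4 ![a, b, c] (by intro i; fin_cases i <;> assumption) e (by simpa using he) p hp h
  · have := main4 ![b, a, c] (by intro i; fin_cases i <;> assumption) e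
      (by simp; linarith) p hp h
    rw [sup_comm (Nm a)]
    exact this
  · have := main4 ![c, a, b] (by intro i; fin_cases i <;> assumption) e
      (by simp; linarith) p hp h
    rw [sup_comm, ← sup_assoc]
    exact this

theorem sqf_rep (a : ℚ) (ha : a ≠ 0) : ∃ (d : ℤ) (s : ℚ), Squarefree d ∧ s ≠ 0 ∧ a = d * s ^ 2 := by
  obtain ⟨k, l, h1, h2⟩ := Nat.sq_mul_squarefree (a.num * a.den).natAbs
  have hd : (a.den : ℚ) ≠ 0 := by exact_mod_cast a.den_nz
  have hn : a.num ≠ 0 := Rat.num_ne_zero.mpr ha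
  have hl : l ≠ 0 := by
    rintro rfl
    have h3 : a.num * a.den = 0 := Int.natAbs_eq_zero.mp (by rw [← h1]; simp)
    rcases mul_eq_zero.mp h3 with h | h
    · exact hn h
    · exact a.den_nz (by exact_mod_cast h)
  have key : ∃ d : ℤ, Squarefree d ∧ a.num * a.den = d * l ^ 2 := by
    rcases Int.natAbs_eq (a.num * a.den) with h | h
    · refine ⟨k, Int.squarefree_natCast.mpr h2, ?_⟩
      rw [h, ← h1]; push_cast; ring
    · refine ⟨-k, ?_, ?_⟩
      · rw [← Int.squarefree_natAbs]; simpa using h2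
      · rw [h, ← h1]; push_cast; ring
  obtain ⟨d, h3, h4⟩ := key
  refine ⟨d, l / a.den, h3, div_ne_zero (by exact_mod_cast hl) hd, ?_⟩
  have h5 : (a.num : ℚ) * a.den = d * l ^ 2 := by exact_mod_cast h4
  nth_rw 1 [← Rat.num_div_den a]
  field_simp
  linarith

theorem final (a b c : ℚ) (ha : a ≠ 0) (hb : b ≠ 0) (hc : c ≠ 0) (p : ℕ) [hp : Fact p.Prime]
    (h1 : ¬ IsSquare (a : ℚ_[p])) (h2 : ¬ IsSquare (b : ℚ_[p]))
    (h3 : ¬ IsSquare ((a * b : ℚ) : ℚ_[p])) :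
    ∃ x y z t u w : ℚ,
      (x ^ 2 - a * y ^ 2) * (z ^ 2 - b * t ^ 2) * (u ^ 2 - (a * b) * w ^ 2) = c := by
  have ns : ∀ (r : ℚ) (d : ℤ) (s : ℚ), r = d * s ^ 2 → ¬ IsSquare (r : ℚ_[p]) → NS p d := by
    intro r d s hr h
    apply ns_of
    rintro ⟨z, hz⟩
    apply h
    refine ⟨z * s, ?_⟩
    rw [hr]
    push_cast
    rw [hz]
    ring
  obtain ⟨d1, s1, q1, z1, e1⟩ := sqf_rep a ha
  obtain ⟨d2, s2, q2, z2, e2⟩ := sqf_rep b hb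
  obtain ⟨d3, s3, q3, z3, e3⟩ := sqf_rep (a * b) (mul_ne_zero ha hb)
  have hsq : ∃ e : ℤ, d1 * d2 * d3 = e ^ 2 := by
    have : IsSquare ((d1 * d2 * d3 : ℤ) : ℚ) := by
      refine ⟨(d3 : ℚ) * s3 / (s1 * s2), ?_⟩
      have h := e3
      rw [e1, e2] at h
      push_cast
      field_simp
      linear_combination (d3 : ℚ) * h
    rw [Rat.isSquare_intCast_iff] at this
    obtain ⟨e, he⟩ := this
    exact ⟨e, by rw [he, pow_two]⟩
  obtain ⟨e, he⟩ := hsq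
  have top := top3 p hp.out d1 d2 d3 e q1 q2 q3 he (ns _ _ _ e1 h1) (ns _ _ _ e2 h2) (ns _ _ _ e3 h3)
  have hmem : Units.mk0 c hc ∈ Nm d1 ⊔ Nm d2 ⊔ Nm d3 := by rw [top]; trivial
  obtain ⟨g, hg, g3, ⟨u, w, h6⟩, hgg⟩ := Subgroup.mem_sup.mp hmem
  obtain ⟨g1, ⟨x, y, h4⟩, g2, ⟨z, t, h5⟩, hg'⟩ := Subgroup.mem_sup.mp hg
  refine ⟨x, y / s1, z, t / s2, u, w / s3, ?_⟩
  have f1 : a * (y / s1) ^ 2 = d1 * y ^ 2 := by rw [e1]; field_simp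
  have f2 : b * (t / s2) ^ 2 = d2 * t ^ 2 := by rw [e2]; field_simp
  have f3 : a * b * (w / s3) ^ 2 = d3 * w ^ 2 := by rw [e3]; field_simp
  rw [f1, f2, f3, h4, h5, h6, ← Units.val_mul, ← Units.val_mul, hg', hgg, Units.val_mk0]

end PE

/-- If there is a prime `p` such that none of `a`, `b`, `ab` is a square in `ℚ_[p]`, then
the product equation `(x² - a·y²)(z² - b·t²)(u² - (a·b)·w²) = c` has a rational
solution (Hasse principle holds since the Brauer–Manin obstruction vanishes). -/
theorem product_equation_rational_solution_of_local_biquadratic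
    (a b c : ℚ) (ha : a ≠ 0) (hb : b ≠ 0) (hc : c ≠ 0)
    (hp : ∃ (p : ℕ) (_ : Fact p.Prime),
      ¬ IsSquare (a : ℚ_[p]) ∧ ¬ IsSquare (b : ℚ_[p]) ∧ ¬ IsSquare ((a * b : ℚ) : ℚ_[p])) :
    ∃ x y z t u w : ℚ,
      (x ^ 2 - a * y ^ 2) * (z ^ 2 - b * t ^ 2) * (u ^ 2 - (a * b) * w ^ 2) = c := by
  obtain ⟨p, hpf, h1, h2, h3⟩ := hp
  exact PE.final a b c ha hb hc p h1 h2 h3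
end

section
/- Let a, b, c be nonzero rational numbers. Suppose that for every prime p, at least one of a, b, a·b is a square in ℚ_p. Let S be the set of primes p such that a is a square in ℚ_p and there do not exist z, t ∈ ℚ_p with c = z² − b·t², and let ε = 1 if (a > 0 and b < 0 and c < 0) and ε = 0 otherwise (the contribution of the real place). Then S is finite, and the equation (x² − a·y²)·(z² − b·t²)·(u² − (a·b)·w²) = c has a solution with x, y, z, t, u, w ∈ ℚ if and only if |S| + ε is even. -/
/-- The set of primes `p` such that `a` is a square in `ℚ_[p]` but `c` is not a norm
from `ℚ_[p](√b)`, i.e. `c ≠ z² - b·t²` for all `z, t ∈ ℚ_[p]`. -/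
def obstructionPrimes (a b c : ℚ) : Set Nat.Primes := fun p =>
  have : Fact (p : ℕ).Prime := ⟨p.2⟩
  IsSquare (a : ℚ_[(p : ℕ)]) ∧
    ¬ ∃ z t : ℚ_[(p : ℕ)], (c : ℚ_[(p : ℕ)]) = z ^ 2 - (b : ℚ_[(p : ℕ)]) * t ^ 2


namespace HilbertAux

open PadicInt

/-- `x` is a norm `z² - y t²`. -/
def Nrm {K : Type*} [Field K] (y x : K) : Prop := ∃ z t : K, x = z ^ 2 - y * t ^ 2

section Nrm
variable {K : Type*} [Field K]

lemma Nrm.mul {y x x' : K} (h : Nrm y x) (h' : Nrm y x') : Nrm y (x * x') := by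
  obtain ⟨z, t, rfl⟩ := h
  obtain ⟨z', t', rfl⟩ := h'
  exact ⟨z * z' + y * t * t', z * t' + t * z', by ring⟩

lemma Nrm.sq (y s : K) : Nrm y (s ^ 2) := ⟨s, 0, by ring⟩

lemma Nrm.inv {y x : K} (h : Nrm y x) : Nrm y x⁻¹ := by
  by_cases hx : x = 0
  · subst hx; simpa using h
  · have := h.mul (Nrm.sq y x⁻¹)
    convert this using 1
    field_simp

lemma Nrm.of_isSquare {y : K} (h2 : (2 : K) ≠ 0) (hy : y ≠ 0) (h : IsSquare y) (x : K) :
    Nrm y x := by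
  obtain ⟨r, rfl⟩ := h
  have hr : r ≠ 0 := by rintro rfl; simp at hy
  refine ⟨(x + 1) / 2, (x - 1) / (2 * r), ?_⟩
  field_simp
  ring

lemma Nrm.symm {x y : K} (h2 : (2 : K) ≠ 0) (hx : x ≠ 0) (h : Nrm y x) : Nrm x y := by
  obtain ⟨z, t, h⟩ := h
  by_cases ht : t = 0
  · subst ht
    exact Nrm.of_isSquare h2 hx ⟨z, by rw [h]; ring⟩ y
  · refine ⟨z / t, 1 / t, ?_⟩
    rw [h]; field_simp; ring

lemma Nrm.of_mul_left {y x x' : K} (hx : x ≠ 0) (h : Nrm y x) (h' : Nrm y (x * x')) :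
    Nrm y x' := by
  have := h.inv.mul h'
  rwa [inv_mul_cancel_left₀ hx] at this

lemma Nrm.of_sq_eq {y s r : K} (h : Nrm (y * s ^ 2) r) : Nrm y r := by
  obtain ⟨z, t, h⟩ := h
  exact ⟨z, s * t, by rw [h]; ring⟩

/-- Axiomatic properties of a symbol. -/
structure IsSym (S : K → K → ℚ) : Prop where
  pm : ∀ x y, x ≠ 0 → y ≠ 0 → S x y = 1 ∨ S x y = -1
  mul : ∀ x x' y, x ≠ 0 → x' ≠ 0 → y ≠ 0 → S (x * x') y = S x y * S x' y
  symm : ∀ x y, S x y = S y x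
  neg : ∀ x, x ≠ 0 → S x (-x) = 1
  stein : ∀ s, s ≠ 0 → s ≠ 1 → S s (1 - s) = 1

variable {S : K → K → ℚ}

lemma IsSym.sq (h : IsSym S) {s y : K} (hs : s ≠ 0) (hy : y ≠ 0) : S (s ^ 2) y = 1 := by
  rw [pow_two, h.mul _ _ _ hs hs hy]
  rcases h.pm s y hs hy with h | h <;> simp [h]

lemma IsSym.mul_right (h : IsSym S) {x y y' : K} (hx : x ≠ 0) (hy : y ≠ 0) (hy' : y' ≠ 0) :
    S x (y * y') = S x y * S x y' := by
  rw [h.symm, h.mul _ _ _ hy hy' hx, h.symm y, h.symm y']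

lemma IsSym.isSquare (h : IsSym S) {x y : K} (hx : x ≠ 0) (hy : y ≠ 0) (hs : IsSquare x) :
    S x y = 1 := by
  obtain ⟨r, rfl⟩ := hs
  rw [← pow_two]
  exact h.sq (by rintro rfl; simp at hx) hy

/-- equality when the first arguments differ by a square -/
lemma IsSym.congr (h : IsSym S) {x x' y : K} (hx : x ≠ 0) (hx' : x' ≠ 0) (hy : y ≠ 0)
    (hs : IsSquare (x / x')) : S x y = S x' y := by
  have : x = (x / x') * x' := by field_simp
  rw [this, h.mul _ _ _ (div_ne_zero hx hx') hx' hy, h.isSquare (div_ne_zero hx hx') hy hs, one_mul]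

lemma IsSym.of_nrm (h : IsSym S) {x y : K} (hx : x ≠ 0) (hy : y ≠ 0) (hn : Nrm y x) :
    S x y = 1 := by
  obtain ⟨z, t, hzt⟩ := hn
  by_cases ht : t = 0
  · subst ht
    exact h.isSquare hx hy ⟨z, by rw [hzt]; ring⟩
  by_cases hz : z = 0
  · subst hz
    have : x = (-y) * t ^ 2 := by rw [hzt]; ring
    rw [this, h.mul _ _ _ (neg_ne_zero.2 hy) (pow_ne_zero 2 ht) hy, h.sq ht hy, h.symm, h.neg y hy,
      one_mul]
  · set s := y * (t / z) ^ 2 with hs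
    have hs0 : s ≠ 0 := by positivity
    have hx1 : x = (1 - s) * z ^ 2 := by rw [hzt, hs]; field_simp
    have hs1 : 1 - s ≠ 0 := by
      intro h0; rw [h0] at hx1; simp at hx1; exact hx hx1
    rw [hx1, h.mul _ _ _ hs1 (pow_ne_zero 2 hz) hy, h.sq hz hy, mul_one]
    have h1 := h.stein s hs0 (by intro h; apply hs1; rw [h]; ring)
    rw [h.symm]
    rw [hs, h.mul _ _ _ hy (by positivity) hs1, h.sq (by positivity) hs1, mul_one] at h1
    exact h1

end Nrm

section Basics
variable {p : ℕ} [Fact p.Prime]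

lemma pne : (p : ℚ_[p]) ≠ 0 := by
  exact_mod_cast (Fact.out : p.Prime).ne_zero

/-- unit part of a `p`-adic number -/
noncomputable def up (x : ℚ_[p]) : ℤ_[p] :=
  if h : ‖x * (p : ℚ_[p]) ^ (-x.valuation)‖ ≤ 1 then ⟨_, h⟩ else 0

lemma norm_up_aux {x : ℚ_[p]} (hx : x ≠ 0) : ‖x * (p : ℚ_[p]) ^ (-x.valuation)‖ = 1 := by
  rw [norm_mul, Padic.norm_eq_zpow_neg_valuation hx, norm_zpow, Padic.norm_p, inv_zpow', neg_neg,
    ← zpow_add₀]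
  · simp
  · exact_mod_cast (Fact.out : p.Prime).ne_zero

lemma coe_up {x : ℚ_[p]} (hx : x ≠ 0) : (up x : ℚ_[p]) = x * (p : ℚ_[p]) ^ (-x.valuation) := by
  have h : up x = ⟨_, (norm_up_aux hx).le⟩ := dif_pos (norm_up_aux hx).le
  rw [h]

lemma up_spec {x : ℚ_[p]} (hx : x ≠ 0) : x = (p : ℚ_[p]) ^ x.valuation * up x := by
  rw [coe_up hx, mul_comm x, ← mul_assoc, ← zpow_add₀ pne]; simp

lemma norm_up {x : ℚ_[p]} (hx : x ≠ 0) : ‖up x‖ = 1 := by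
  rw [norm_def, coe_up hx, norm_up_aux hx]

lemma up_ne {x : ℚ_[p]} (hx : x ≠ 0) : up x ≠ 0 := by
  rw [← norm_pos_iff, norm_up hx]; norm_num

lemma isUnit_up {x : ℚ_[p]} (hx : x ≠ 0) : IsUnit (up x) := isUnit_iff.2 (norm_up hx)

lemma val_unit {u : ℤ_[p]} (hu : ‖u‖ = 1) : (u : ℚ_[p]).valuation = 0 := by
  have h0 : (u : ℚ_[p]) ≠ 0 := by
    intro h; rw [norm_def, h] at hu; simp at hu
  have := Padic.norm_eq_zpow_neg_valuation h0
  rw [← norm_def, hu] at this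
  have hp : (1 : ℝ) < p := by exact_mod_cast (Fact.out : p.Prime).one_lt
  have h3 := (zpow_eq_one_iff_right₀ (by positivity) hp.ne').1 this.symm
  simpa using h3

lemma val_eq {x : ℚ_[p]} {n : ℤ} {u : ℤ_[p]} (hu : ‖u‖ = 1) (h : x = (p : ℚ_[p]) ^ n * u) :
    x.valuation = n := by
  have h0 : (u : ℚ_[p]) ≠ 0 := by
    intro h; rw [norm_def, h] at hu; simp at hu
  rw [h, Padic.valuation_mul (zpow_ne_zero _ pne) h0, Padic.valuation_zpow, Padic.valuation_p,
    val_unit hu]; simp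

lemma up_eq {x : ℚ_[p]} {n : ℤ} {u : ℤ_[p]} (hu : ‖u‖ = 1) (h : x = (p : ℚ_[p]) ^ n * u) :
    up x = u := by
  have hx : x ≠ 0 := by
    have h0 : (u : ℚ_[p]) ≠ 0 := by
      intro h; rw [norm_def, h] at hu; simp at hu
    rw [h]; exact mul_ne_zero (zpow_ne_zero _ pne) h0
  have h1 := val_eq hu h
  have h2 := up_spec hx
  rw [h1] at h2
  apply PadicInt.ext
  exact mul_left_cancel₀ (zpow_ne_zero n pne) (h2.symm.trans h)

lemma up_coe {u : ℤ_[p]} (hu : ‖u‖ = 1) : up (u : ℚ_[p]) = u :=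
  up_eq (n := 0) hu (by simp)

lemma up_mul {x y : ℚ_[p]} (hx : x ≠ 0) (hy : y ≠ 0) : up (x * y) = up x * up y := by
  apply up_eq (n := x.valuation + y.valuation)
  · rw [norm_mul, norm_up hx, norm_up hy, one_mul]
  · rw [zpow_add₀ pne]; push_cast
    conv_lhs => rw [up_spec hx, up_spec hy]
    ring

lemma up_neg {x : ℚ_[p]} (hx : x ≠ 0) : up (-x) = - up x := by
  apply up_eq (n := x.valuation)
  · rw [norm_neg, norm_up hx]
  · push_cast
    conv_lhs => rw [up_spec hx]
    ring

lemma val_neg (x : ℚ_[p]) : (-x).valuation = x.valuation := by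
  by_cases hx : x = 0
  · simp [hx]
  apply val_eq (u := - up x)
  · rw [norm_neg, norm_up hx]
  · push_cast
    conv_lhs => rw [up_spec hx]
    ring

lemma up_one : up (1 : ℚ_[p]) = 1 := by
  have := up_coe (p := p) (u := 1) (by simp)
  simpa using this

lemma up_p : up (p : ℚ_[p]) = 1 := up_eq (n := 1) (by simp) (by simp)

/-- Case distinction for the Steinberg relation. -/
lemma one_sub_val {s : ℚ_[p]} (hs : s ≠ 0) (hv : 0 < s.valuation) :
    (1 - s).valuation = 0 ∧ up (1 - s) = 1 - (p : ℤ_[p]) ^ s.valuation.toNat * up s := by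
  have e : (1 - s : ℚ_[p]) = (p : ℚ_[p]) ^ (0 : ℤ) *
      ((1 - (p : ℤ_[p]) ^ s.valuation.toNat * up s : ℤ_[p]) : ℚ_[p]) := by
    push_cast
    conv_lhs => rw [up_spec hs]
    have : (p : ℚ_[p]) ^ s.valuation = (p : ℚ_[p]) ^ s.valuation.toNat := by
      rw [← zpow_natCast, Int.toNat_of_nonneg hv.le]
    rw [this]; simp
  have hn : ‖(1 - (p : ℤ_[p]) ^ s.valuation.toNat * up s : ℤ_[p])‖ = 1 := by
    have h1 : ‖-((p : ℤ_[p]) ^ s.valuation.toNat * up s)‖ < 1 := by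
      rw [norm_neg, norm_mul, norm_up hs, mul_one, norm_pow, PadicInt.norm_p]
      apply pow_lt_one₀ (by positivity)
      · apply inv_lt_one_of_one_lt₀
        exact_mod_cast (Fact.out : p.Prime).one_lt
      · omega
    rw [sub_eq_add_neg, PadicInt.norm_add_eq_max_of_ne]
    · simp only [norm_one]; exact max_eq_left h1.le
    · simp only [norm_one]; exact h1.ne'
  exact ⟨val_eq hn e, up_eq hn e⟩

/-- Generic Steinberg. -/
lemma stein_of {S : ℚ_[p] → ℚ_[p] → ℚ}
    (pm : ∀ x y, x ≠ 0 → y ≠ 0 → S x y = 1 ∨ S x y = -1)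
    (mul : ∀ x x' y, x ≠ 0 → x' ≠ 0 → y ≠ 0 → S (x * x') y = S x y * S x' y)
    (symm : ∀ x y, S x y = S y x)
    (neg : ∀ x, x ≠ 0 → S x (-x) = 1)
    (pos : ∀ s : ℚ_[p], s ≠ 0 → 0 < s.valuation → S s (1 - s) = 1)
    (zero : ∀ s : ℚ_[p], s ≠ 0 → 1 - s ≠ 0 → s.valuation = 0 → (1 - s).valuation = 0 →
      S s (1 - s) = 1) : IsSym S := by
  refine ⟨pm, mul, symm, neg, ?_⟩
  intro s hs hs1
  have h1 : 1 - s ≠ 0 := sub_ne_zero.2 (Ne.symm hs1)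
  rcases lt_trichotomy s.valuation 0 with h | h | h
  · have hi : s⁻¹ ≠ 0 := inv_ne_zero hs
    have h2 := pos s⁻¹ hi (by rw [Padic.valuation_inv]; omega)
    have h3 : (1 - s⁻¹) ≠ 0 := by
      intro h0; apply h1
      have : s⁻¹ = 1 := (sub_eq_zero.1 h0).symm
      rw [inv_eq_one] at this; rw [this]; ring
    have h4 : 1 - s = (-s) * (1 - s⁻¹) := by field_simp; ring
    rw [symm, h4, mul _ _ _ (neg_ne_zero.2 hs) h3 hs, symm, neg s hs, one_mul, symm]
    have h5 : S (s * s⁻¹) (1 - s⁻¹) = 1 := by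
      rw [mul_inv_cancel₀ hs]
      have := mul 1 1 (1 - s⁻¹) one_ne_zero one_ne_zero h3
      rw [mul_one] at this
      rcases pm 1 (1 - s⁻¹) one_ne_zero h3 with h | h <;> rw [h] at this ⊢
      norm_num at this
    rw [mul _ _ _ hs hi h3, h2, mul_one] at h5
    exact h5
  · have h5 : 0 ≤ (1 - s).valuation := by
      have := Padic.le_valuation_add (x := 1) (y := -s) (by rwa [← sub_eq_add_neg])
      rw [val_neg, h, Padic.valuation_one, ← sub_eq_add_neg] at this
      simpa using this
    rcases h5.eq_or_lt with h6 | h6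
    · exact zero s hs h1 h h6.symm
    · have := pos (1 - s) h1 h6
      rw [symm]
      simpa using this
  · exact pos s hs h

/-- Hensel for squares. -/
lemma isSquare_of_hensel {u w : ℤ_[p]} (h : ‖w ^ 2 - u‖ < ‖2 * w‖ ^ 2) : IsSquare u := by
  obtain ⟨z, hz, -⟩ := hensels_lemma (p := p) (R := ℤ_[p])
    (F := (Polynomial.X ^ 2 - Polynomial.C u : Polynomial ℤ_[p])) (a := w) (by simpa [one_add_one_eq_two] using h)
  refine ⟨z, ?_⟩
  simp at hz
  rw [← pow_two]
  exact (sub_eq_zero.1 hz).symm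

lemma norm_two_odd (hp : p ≠ 2) : ‖(2 : ℤ_[p])‖ = 1 := by
  have : ‖((2 : ℕ) : ℤ_[p])‖ = 1 := by
    rw [PadicInt.norm_natCast_eq_one_iff]
    exact (Nat.coprime_primes Fact.out Nat.prime_two).2 hp
  simpa using this

lemma isSquare_of_toZModPow {u : ℤ_[p]} (h : toZModPow 3 u = 1) : IsSquare u := by
  apply isSquare_of_hensel (w := 1)
  have h1 : 1 - u ∈ RingHom.ker (toZModPow 3 : ℤ_[p] →+* ZMod (p ^ 3)) := by
    rw [RingHom.mem_ker, map_sub, h]; simp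
  rw [ker_toZModPow, ← PadicInt.norm_le_pow_iff_mem_span_pow] at h1
  rw [one_pow, mul_one]
  refine lt_of_le_of_lt h1 ?_
  by_cases hp : p = 2
  · subst hp
    have : ‖(2 : ℤ_[2])‖ = 2⁻¹ := by simpa using PadicInt.norm_p (p := 2)
    rw [this]; norm_num
  · rw [norm_two_odd hp]
    have : (1 : ℝ) < p := by exact_mod_cast (Fact.out : p.Prime).one_lt
    rw [one_pow]
    apply zpow_lt_one_of_neg₀ this; norm_num

lemma toZMod_eq_zero {u : ℤ_[p]} : toZMod u = 0 ↔ ‖u‖ < 1 := by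
  rw [← RingHom.mem_ker, ker_toZMod, ← PadicInt.mem_nonunits, IsLocalRing.mem_maximalIdeal]

lemma isSquare_of_toZMod (hp : p ≠ 2) {u : ℤ_[p]} (hu : ‖u‖ = 1) (h : IsSquare (toZMod u)) :
    IsSquare u := by
  obtain ⟨r, hr⟩ := h
  obtain ⟨w, rfl⟩ := ZMod.ringHom_surjective (toZMod : ℤ_[p] →+* ZMod p) r
  apply isSquare_of_hensel (w := w)
  have hw : ‖w‖ = 1 := by
    by_contra hne
    have : ‖w‖ < 1 := lt_of_le_of_ne (PadicInt.norm_le_one w) hne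
    rw [← toZMod_eq_zero] at this
    rw [this, mul_zero, toZMod_eq_zero] at hr
    linarith
  rw [norm_mul, norm_two_odd hp, hw, one_mul, one_pow, ← toZMod_eq_zero, map_sub, map_pow, hr]
  ring

lemma isSquare_of_up {x : ℚ_[p]} (hx : x ≠ 0) (hv : Even x.valuation) (hu : IsSquare (up x)) :
    IsSquare x := by
  rw [up_spec hx]
  apply IsSquare.mul
  · obtain ⟨k, hk⟩ := hv
    exact ⟨(p : ℚ_[p]) ^ k, by rw [hk, zpow_add₀ pne]⟩
  · obtain ⟨r, hr⟩ := hu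
    exact ⟨r, by rw [hr]; push_cast; rfl⟩

end Basics
end HilbertAux


namespace HilbertAux

open PadicInt

section Odd
variable {p : ℕ} [Fact p.Prime]

/-- quadratic character of the unit part -/
noncomputable def fO (x : ℚ_[p]) : ℚ := (quadraticChar (ZMod p) (toZMod (up x)) : ℤ)

/-- quadratic character of `-1` -/
noncomputable def mO (p : ℕ) [Fact p.Prime] : ℚ := (quadraticChar (ZMod p) (-1) : ℤ)

/-- tame symbol -/
noncomputable def SO (x y : ℚ_[p]) : ℚ :=
  fO x ^ y.valuation * fO y ^ x.valuation * mO p ^ (x.valuation * y.valuation)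

lemma toZMod_up_ne {x : ℚ_[p]} (hx : x ≠ 0) : toZMod (up x) ≠ 0 := by
  rw [Ne, toZMod_eq_zero, norm_up hx]; simp

lemma fO_pm {x : ℚ_[p]} (hx : x ≠ 0) : fO x = 1 ∨ fO x = -1 := by
  unfold fO
  rcases quadraticChar_dichotomy (toZMod_up_ne hx) with h | h <;> rw [h] <;> simp

lemma mO_pm : mO p = 1 ∨ mO p = -1 := by
  unfold mO
  rcases quadraticChar_dichotomy (F := ZMod p) (a := -1) (by simp) with h | h <;> rw [h] <;> simp

lemma fO_mul {x y : ℚ_[p]} (hx : x ≠ 0) (hy : y ≠ 0) : fO (x * y) = fO x * fO y := by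
  unfold fO; rw [up_mul hx hy, map_mul, map_mul]; push_cast; rfl

lemma fO_neg {x : ℚ_[p]} (hx : x ≠ 0) : fO (-x) = mO p * fO x := by
  unfold fO mO; rw [up_neg hx, map_neg, neg_eq_neg_one_mul, map_mul]; push_cast; rfl

lemma zpow_pm {r : ℚ} (h : r = 1 ∨ r = -1) (n : ℤ) : r ^ n = 1 ∨ r ^ n = -1 := by
  rcases h with rfl | rfl
  · simp
  · rcases Int.even_or_odd n with h | h
    · left; exact h.neg_one_zpow
    · right; exact h.neg_one_zpow

lemma mul_pm {r s : ℚ} (h : r = 1 ∨ r = -1) (h' : s = 1 ∨ s = -1) : r * s = 1 ∨ r * s = -1 := by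
  rcases h with rfl | rfl <;> rcases h' with rfl | rfl <;> simp

lemma ne_of_pm {r : ℚ} (h : r = 1 ∨ r = -1) : r ≠ 0 := by
  rcases h with rfl | rfl <;> simp

lemma zpow_even_pm {r : ℚ} (h : r = 1 ∨ r = -1) {n : ℤ} (hn : Even n) : r ^ n = 1 := by
  rcases h with rfl | rfl
  · simp
  · exact hn.neg_one_zpow

lemma fO_one_sub {s : ℚ_[p]} (hs : s ≠ 0) (hv : 0 < s.valuation) : fO (1 - s) = 1 := by
  unfold fO
  rw [(one_sub_val hs hv).2, map_sub, map_mul, map_pow, map_natCast]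
  have : s.valuation.toNat ≠ 0 := by omega
  simp [this]

lemma isSym_SO : IsSym (SO (p := p)) := by
  have pm : ∀ x y : ℚ_[p], x ≠ 0 → y ≠ 0 → SO x y = 1 ∨ SO x y = -1 := by
    intro x y hx hy
    exact mul_pm (mul_pm (zpow_pm (fO_pm hx) _) (zpow_pm (fO_pm hy) _)) (zpow_pm mO_pm _)
  apply stein_of pm
  · intro x x' y hx hx' hy
    unfold SO
    rw [fO_mul hx hx', Padic.valuation_mul hx hx', mul_zpow, zpow_add₀ (ne_of_pm (fO_pm hy)),
      add_mul, zpow_add₀ (ne_of_pm mO_pm)]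
    ring
  · intro x y
    unfold SO
    rw [mul_comm x.valuation]; ring
  · intro x hx
    unfold SO
    rw [val_neg, fO_neg hx, mul_zpow]
    have h1 : fO x ^ x.valuation * fO x ^ x.valuation = 1 := by
      rcases zpow_pm (fO_pm hx) x.valuation with h | h <;> rw [h] <;> norm_num
    have h2 : mO p ^ x.valuation * mO p ^ (x.valuation * x.valuation) = 1 := by
      rw [← zpow_add₀ (ne_of_pm mO_pm)]
      apply zpow_even_pm mO_pm
      have := Int.even_mul_succ_self x.valuation
      convert this using 1; ring
    calc _ = (fO x ^ x.valuation * fO x ^ x.valuation) *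
          (mO p ^ x.valuation * mO p ^ (x.valuation * x.valuation)) := by ring
      _ = 1 := by rw [h1, h2, one_mul]
  · intro s hs hv
    unfold SO
    rw [(one_sub_val hs hv).1, fO_one_sub hs hv]; simp
  · intro s hs hs1 h h'
    unfold SO
    rw [h, h']; simp

lemma SO_units {x y : ℚ_[p]} (hx : x.valuation = 0) (hy : y.valuation = 0) : SO x y = 1 := by
  unfold SO; simp [hx, hy]

lemma isSquare_of_fO (hp : p ≠ 2) {x : ℚ_[p]} (hx : x ≠ 0) (hv : Even x.valuation)
    (h : fO x = 1) : IsSquare x := by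
  apply isSquare_of_up hx hv
  apply isSquare_of_toZMod hp (norm_up hx)
  unfold fO at h
  rw [← quadraticChar_one_iff_isSquare (toZMod_up_ne hx)]
  exact_mod_cast h

lemma nrm_of_units (hp : p ≠ 2) {x y : ℤ_[p]} (hx : ‖x‖ = 1) (hy : ‖y‖ = 1) :
    Nrm (y : ℚ_[p]) (x : ℚ_[p]) := by
  have hy' : toZMod y ≠ 0 := by rw [Ne, toZMod_eq_zero, hy]; simp
  have hx' : toZMod x ≠ 0 := by rw [Ne, toZMod_eq_zero, hx]; simp
  obtain ⟨t0, z0, h0⟩ : ∃ t z : ZMod p, toZMod y * t ^ 2 + toZMod x = z ^ 2 := by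
    obtain ⟨a, b, hab⟩ := FiniteField.exists_root_sum_quadratic (R := ZMod p)
      (f := (Polynomial.C (toZMod y) * Polynomial.X ^ 2 + Polynomial.C (0 : ZMod p) * Polynomial.X
        + Polynomial.C (toZMod x)))
      (g := (Polynomial.C (-1 : ZMod p) * Polynomial.X ^ 2 + Polynomial.C (0 : ZMod p) * Polynomial.X
        + Polynomial.C 0))
      (Polynomial.degree_quadratic hy') (Polynomial.degree_quadratic (by simp))
      (by rw [ZMod.card]; exact Nat.odd_iff.1 ((Fact.out : p.Prime).odd_of_ne_two hp))
    refine ⟨a, b, ?_⟩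
    simp at hab
    linear_combination hab
  obtain ⟨t, rfl⟩ := ZMod.ringHom_surjective (toZMod : ℤ_[p] →+* ZMod p) t0
  by_cases hz : z0 = 0
  · subst hz
    have ht : toZMod t ≠ 0 := by
      intro h; rw [h] at h0; simp at h0; exact hx' h0
    have hsq : IsSquare (- (x * y)) := by
      apply isSquare_of_toZMod hp (by rw [norm_neg, norm_mul, hx, hy, one_mul])
      refine ⟨toZMod y * toZMod t, ?_⟩
      rw [map_neg, map_mul]
      linear_combination (-toZMod y) * h0
    obtain ⟨r, hr⟩ := hsq
    have hy0 : (y : ℚ_[p]) ≠ 0 := by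
      intro h; rw [norm_def, h] at hy; simp at hy
    refine ⟨0, r / y, ?_⟩
    have : -((x : ℚ_[p]) * y) = r * r := by exact_mod_cast congrArg (fun u : ℤ_[p] => (u : ℚ_[p])) hr
    field_simp
    linear_combination -this
  · have hn : toZMod (y * t ^ 2 + x) = z0 ^ 2 := by simpa using h0
    have hsq : IsSquare (y * t ^ 2 + x) := by
      apply isSquare_of_toZMod hp
      · by_contra hne
        have := lt_of_le_of_ne (PadicInt.norm_le_one _) hne
        rw [← toZMod_eq_zero, hn] at this
        exact hz (by simpa using this)
      · exact ⟨z0, by rw [hn]; ring⟩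
    obtain ⟨r, hr⟩ := hsq
    refine ⟨r, t, ?_⟩
    have : ((y : ℚ_[p]) * t ^ 2 + x) = r * r := by
      exact_mod_cast congrArg (fun u : ℤ_[p] => (u : ℚ_[p])) hr
    linear_combination this

lemma nrm_congr_left {K : Type*} [Field K] {x y s : K} (hs : s ≠ 0) (h : Nrm y (x * s ^ 2)) :
    Nrm y x := by
  rw [mul_comm] at h
  exact Nrm.of_mul_left (pow_ne_zero 2 hs) (Nrm.sq y s) h

lemma nrm_of_SO (hp : p ≠ 2) {x y : ℚ_[p]} (hx : x ≠ 0) (hy : y ≠ 0) (h : SO x y = 1) :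
    Nrm y x := by
  have h2 : (2 : ℚ_[p]) ≠ 0 := two_ne_zero
  rcases Int.even_or_odd x.valuation with ex | ox <;>
    rcases Int.even_or_odd y.valuation with ey | oy
  · have key := nrm_of_units hp (norm_up hx) (norm_up hy)
    obtain ⟨i, hi⟩ := ex
    obtain ⟨j, hj⟩ := ey
    have h1 : x = up x * ((p : ℚ_[p]) ^ i) ^ 2 := by
      conv_lhs => rw [up_spec hx, hi, zpow_add₀ pne]
      ring
    have h3 : (up y : ℚ_[p]) = y * ((p : ℚ_[p]) ^ (-j)) ^ 2 := by
      conv_rhs => rw [up_spec hy, hj, zpow_add₀ pne, zpow_neg]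
      have : (p : ℚ_[p]) ^ j ≠ 0 := zpow_ne_zero _ pne
      field_simp
    rw [h3] at key
    rw [h1]
    exact key.of_sq_eq.mul (Nrm.sq _ _)
  · have hf : fO x = 1 := by
      unfold SO at h
      rw [zpow_even_pm (fO_pm hy) ex, zpow_even_pm mO_pm (ex.mul_right _)] at h
      rcases fO_pm hx with h' | h'
      · exact h'
      · rw [h', oy.neg_one_zpow] at h; norm_num at h
    obtain ⟨r, hr⟩ := isSquare_of_fO hp hx ex hf
    rw [hr, ← pow_two]; exact Nrm.sq _ _
  · have hf : fO y = 1 := by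
      unfold SO at h
      rw [zpow_even_pm (fO_pm hx) ey, zpow_even_pm mO_pm (ey.mul_left _)] at h
      rcases fO_pm hy with h' | h'
      · exact h'
      · rw [h', ox.neg_one_zpow] at h; norm_num at h
    exact Nrm.of_isSquare h2 hy (isSquare_of_fO hp hy ey hf) x
  · have hxy : -(x * y) ≠ 0 := neg_ne_zero.2 (mul_ne_zero hx hy)
    have odd_pm : ∀ {r : ℚ} {n : ℤ}, (r = 1 ∨ r = -1) → Odd n → r ^ n = r := by
      rintro r n (rfl | rfl) hn
      · simp
      · exact hn.neg_one_zpow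
    have hf : fO (-(x * y)) = 1 := by
      unfold SO at h
      rw [odd_pm (fO_pm hx) oy, odd_pm (fO_pm hy) ox, odd_pm mO_pm (ox.mul oy)] at h
      rw [fO_neg (mul_ne_zero hx hy), fO_mul hx hy, ← h]; ring
    obtain ⟨r, hr⟩ := isSquare_of_fO hp hxy
      (by rw [val_neg, Padic.valuation_mul hx hy]; exact ox.add_odd oy) hf
    refine ⟨0, r / y, ?_⟩
    field_simp
    linear_combination -hr

lemma SO_iff (hp : p ≠ 2) {x y : ℚ_[p]} (hx : x ≠ 0) (hy : y ≠ 0) : SO x y = 1 ↔ Nrm y x :=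
  ⟨nrm_of_SO hp hx hy, isSym_SO.of_nrm hx hy⟩

end Odd

section Two

/-- residue mod 8 -/
noncomputable def tauEight : ℤ_[2] →+* ZMod 8 := (toZModPow 3 : ℤ_[2] →+* ZMod (2 ^ 3))

/-- residue of the unit part -/
noncomputable def R8 (x : ℚ_[2]) : ZMod 8 := tauEight (up x)

/-- the sign `(-1)^(ε(u)ε(v))` -/
def E8 (u v : ZMod 8) : ℤ := if (u = 3 ∨ u = 7) ∧ (v = 3 ∨ v = 7) then -1 else 1

/-- units mod 8 -/
def U8 (u : ZMod 8) : Prop := u = 1 ∨ u = 3 ∨ u = 5 ∨ u = 7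

instance : DecidablePred U8 := fun u => by unfold U8; infer_instance

lemma U8_of_isUnit : ∀ u v : ZMod 8, u * v = 1 → U8 u := by decide

lemma U8_R8 {x : ℚ_[2]} (hx : x ≠ 0) : U8 (R8 x) := by
  obtain ⟨v, hv⟩ := (isUnit_up hx).exists_right_inv
  apply U8_of_isUnit (R8 x) (tauEight v)
  unfold R8
  rw [← map_mul, hv, map_one]

/-- χ₈ of the unit part -/
noncomputable def f2 (x : ℚ_[2]) : ℚ := (ZMod.χ₈ (R8 x) : ℤ)

/-- Hilbert symbol at 2 -/
noncomputable def S2 (x y : ℚ_[2]) : ℚ :=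
  f2 x ^ y.valuation * f2 y ^ x.valuation * (E8 (R8 x) (R8 y) : ℤ)

lemma chi_eight_pm : ∀ u, U8 u → ZMod.χ₈ u = 1 ∨ ZMod.χ₈ u = -1 := by decide

lemma E8_pm : ∀ u v, E8 u v = 1 ∨ E8 u v = -1 := by decide
lemma E8_symm : ∀ u v, E8 u v = E8 v u := by decide
lemma E8_mul : ∀ u u' v, U8 u → U8 u' → U8 v → E8 (u * u') v = E8 u v * E8 u' v := by decide
lemma E8_neg : ∀ u, U8 u → E8 u (-u) = 1 := by decide
lemma chi_eight_neg : ∀ u, U8 u → ZMod.χ₈ (-u) = ZMod.χ₈ u := by decide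

lemma f2_pm {x : ℚ_[2]} (hx : x ≠ 0) : f2 x = 1 ∨ f2 x = -1 := by
  unfold f2
  rcases chi_eight_pm _ (U8_R8 hx) with h | h <;> rw [h] <;> simp

lemma R8_mul {x y : ℚ_[2]} (hx : x ≠ 0) (hy : y ≠ 0) : R8 (x * y) = R8 x * R8 y := by
  unfold R8; rw [up_mul hx hy, map_mul]

lemma R8_neg {x : ℚ_[2]} (hx : x ≠ 0) : R8 (-x) = - R8 x := by
  unfold R8; rw [up_neg hx, map_neg]

lemma f2_mul {x y : ℚ_[2]} (hx : x ≠ 0) (hy : y ≠ 0) : f2 (x * y) = f2 x * f2 y := by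
  unfold f2; rw [R8_mul hx hy, map_mul]; push_cast; rfl

lemma stein2_1 : ∀ u, U8 u → ZMod.χ₈ (1 - 2 * u) * E8 u (1 - 2 * u) = 1 := by decide
lemma stein2_2 : ∀ u, U8 u → E8 u (1 - 4 * u) = 1 := by decide
lemma stein2_3 : ∀ u, U8 u → E8 u 1 = 1 := by decide

lemma isSym_S2 : IsSym S2 := by
  have pm : ∀ x y : ℚ_[2], x ≠ 0 → y ≠ 0 → S2 x y = 1 ∨ S2 x y = -1 := by
    intro x y hx hy
    refine mul_pm (mul_pm (zpow_pm (f2_pm hx) _) (zpow_pm (f2_pm hy) _)) ?_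
    rcases E8_pm (R8 x) (R8 y) with h | h <;> rw [h] <;> simp
  apply stein_of pm
  · intro x x' y hx hx' hy
    unfold S2
    rw [f2_mul hx hx', Padic.valuation_mul hx hx', mul_zpow, zpow_add₀ (ne_of_pm (f2_pm hy)),
      R8_mul hx hx', E8_mul _ _ _ (U8_R8 hx) (U8_R8 hx') (U8_R8 hy)]
    push_cast
    ring
  · intro x y
    unfold S2
    rw [E8_symm]; ring
  · intro x hx
    unfold S2
    have hf : f2 (-x) = f2 x := by unfold f2; rw [R8_neg hx, chi_eight_neg _ (U8_R8 hx)]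
    rw [val_neg, hf, R8_neg hx, E8_neg _ (U8_R8 hx)]
    rcases zpow_pm (f2_pm hx) x.valuation with h | h <;> rw [h] <;> norm_num
  · intro s hs hv
    unfold S2
    rw [(one_sub_val hs hv).1, zpow_zero, one_mul]
    have hR : R8 (1 - s) = 1 - 2 ^ s.valuation.toNat * R8 s := by
      unfold R8
      rw [(one_sub_val hs hv).2, map_sub, map_mul, map_pow, map_natCast, map_one]; rfl
    have hu := U8_R8 hs
    obtain ⟨n, hn⟩ : ∃ n : ℕ, s.valuation = n := ⟨s.valuation.toNat, by omega⟩
    have hn0 : 0 < n := by omega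
    unfold f2
    rw [hR, hn, Int.toNat_natCast, zpow_natCast]
    match n, hn0 with
    | 1, _ =>
      have := stein2_1 _ hu
      rw [pow_one, pow_one]
      exact_mod_cast this
    | 2, _ =>
      have e : (2 : ZMod 8) ^ 2 = 4 := by decide
      rw [e, stein2_2 _ hu]
      have h5 : ZMod.χ₈ (1 - 4 * R8 s) = -1 := by
        have : ∀ u, U8 u → ZMod.χ₈ (1 - 4 * u) = -1 := by decide
        exact this _ hu
      rw [h5]; norm_num
    | k + 3, _ =>
      have e : (2 : ZMod 8) ^ (k + 3) = 0 := by
        rw [pow_add]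
        have : (2 : ZMod 8) ^ 3 = 0 := by decide
        rw [this, mul_zero]
      rw [e, zero_mul, sub_zero, stein2_3 _ hu]; simp
  · intro s hs hs1 h h'
    exfalso
    have e1 : s = up s := by
      have := up_spec hs
      rwa [h, zpow_zero, one_mul] at this
    have e2 : 1 - s = (up (1 - s) : ℚ_[2]) := by
      have := up_spec hs1
      rwa [h', zpow_zero, one_mul] at this
    have h4 : up s + up (1 - s) = 1 := by
      apply PadicInt.ext; push_cast
      rw [← e1, ← e2]; ring
    have h5 := congrArg tauEight h4
    rw [map_add, map_one] at h5
    have : ∀ u v, U8 u → U8 v → u + v ≠ 1 := by decide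
    exact this _ _ (U8_R8 hs) (U8_R8 hs1) h5

lemma isSquare_of_R8 {x : ℚ_[2]} (hx : x ≠ 0) (hv : Even x.valuation) (h : R8 x = 1) :
    IsSquare x := by
  apply isSquare_of_up hx hv
  exact isSquare_of_toZModPow h

set_option maxRecDepth 100000 in
set_option maxHeartbeats 4000000 in
lemma table2 : ∀ i j : Fin 2, ∀ u v : ZMod 8, U8 u → U8 v →
    ZMod.χ₈ u ^ (j : ℕ) * ZMod.χ₈ v ^ (i : ℕ) * E8 u v = 1 →
    ∃ k : Fin 2, ∃ z t : Fin 6, (8 * 2 ^ (i : ℕ) * 4 ^ (k : ℕ) : ℤ) ∣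
      ((z : ℕ) : ℤ) ^ 2 - 2 ^ (j : ℕ) * ((v.val : ℕ) : ℤ) * ((t : ℕ) : ℤ) ^ 2
        - 2 ^ (i : ℕ) * ((u.val : ℕ) : ℤ) * 4 ^ (k : ℕ) := by
  decide

lemma norm_odd_int {m : ℤ} (h : U8 (m : ZMod 8)) : ‖(m : ℤ_[2])‖ = 1 := by
  by_contra hne
  have h1 := lt_of_le_of_ne (PadicInt.norm_le_one _) hne
  rw [PadicInt.norm_int_lt_one_iff_dvd] at h1
  obtain ⟨k, rfl⟩ := h1
  push_cast at h
  have : ∀ k : ZMod 8, ¬ U8 (2 * k) := by decide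
  exact this _ h

lemma val_R8_int {n : ℕ} {m : ℤ} (h : U8 (m : ZMod 8)) :
    ((2 ^ n * m : ℤ) : ℚ_[2]) ≠ 0 ∧ ((2 ^ n * m : ℤ) : ℚ_[2]).valuation = n ∧
      R8 ((2 ^ n * m : ℤ) : ℚ_[2]) = m := by
  have h1 := norm_odd_int h
  have e : ((2 ^ n * m : ℤ) : ℚ_[2]) = ((2 : ℕ) : ℚ_[2]) ^ (n : ℤ) * ((m : ℤ_[2]) : ℚ_[2]) := by
    push_cast; rw [zpow_natCast]
  refine ⟨?_, val_eq h1 e, ?_⟩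
  · have : m ≠ 0 := by
      rintro rfl; revert h; decide
    exact_mod_cast mul_ne_zero (pow_ne_zero n two_ne_zero) this
  · unfold R8; rw [up_eq h1 e, map_intCast]

lemma zpow_parity {r : ℚ} (h : r = 1 ∨ r = -1) (n : ℤ) : r ^ n = r ^ (n % 2).toNat := by
  have h2 : 0 ≤ n % 2 := by omega
  rw [← zpow_natCast, Int.toNat_of_nonneg h2]
  conv_lhs => rw [← Int.emod_add_mul_ediv n 2]
  rw [zpow_add₀ (ne_of_pm h), zpow_even_pm h (even_two_mul _), mul_one]

lemma U8_sq : ∀ u, U8 u → u * u = 1 := by decide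

lemma nrm_of_S2 {x y : ℚ_[2]} (hx : x ≠ 0) (hy : y ≠ 0) (h : S2 x y = 1) : Nrm y x := by
  obtain ⟨i, hi⟩ : ∃ i : Fin 2, (x.valuation % 2).toNat = i :=
    ⟨⟨(x.valuation % 2).toNat, by omega⟩, rfl⟩
  obtain ⟨j, hj⟩ : ∃ j : Fin 2, (y.valuation % 2).toNat = j :=
    ⟨⟨(y.valuation % 2).toNat, by omega⟩, rfl⟩
  have hu := U8_R8 hx
  have hv := U8_R8 hy
  have h1 : ZMod.χ₈ (R8 x) ^ (j : ℕ) * ZMod.χ₈ (R8 y) ^ (i : ℕ) * E8 (R8 x) (R8 y) = 1 := by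
    unfold S2 at h
    rw [zpow_parity (f2_pm hx), zpow_parity (f2_pm hy), hi, hj] at h
    unfold f2 at h
    exact_mod_cast h
  obtain ⟨k, z, t, q, hq⟩ := table2 i j _ _ hu hv h1
  have cu : (((R8 x).val : ℤ) : ZMod 8) = R8 x := by simp
  have cv : (((R8 y).val : ℤ) : ZMod 8) = R8 y := by simp
  have e1 : ((z : ℕ) : ℤ) ^ 2 - 2 ^ (j : ℕ) * (((R8 y).val : ℕ) : ℤ) * ((t : ℕ) : ℤ) ^ 2
      = 2 ^ ((i : ℕ) + 2 * k) * (((R8 x).val : ℤ) + 8 * q) := by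
    have e4 : (4 : ℤ) ^ (k : ℕ) = 2 ^ (2 * (k : ℕ)) := by rw [pow_mul]; norm_num
    rw [pow_add, ← e4]; linear_combination hq
  have cu' : ((((R8 x).val : ℤ) + 8 * q : ℤ) : ZMod 8) = R8 x := by
    push_cast
    have : (8 : ZMod 8) = 0 := by decide
    rw [this]; simp
  obtain ⟨n0, nv, nr⟩ := val_R8_int (n := (i : ℕ) + 2 * k) (m := ((R8 x).val : ℤ) + 8 * q)
    (by rw [cu']; exact hu)
  obtain ⟨y0, yv, yr⟩ := val_R8_int (n := (j : ℕ)) (m := ((R8 y).val : ℤ)) (by rw [cv]; exact hv)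
  rw [cu'] at nr
  rw [cv] at yr
  rw [← e1] at n0 nv nr
  set N : ℚ_[2] := ((((z : ℕ) : ℤ) ^ 2 -
    2 ^ (j : ℕ) * (((R8 y).val : ℕ) : ℤ) * ((t : ℕ) : ℤ) ^ 2 : ℤ) : ℚ_[2]) with hN
  set Y : ℚ_[2] := ((2 ^ (j : ℕ) * ((R8 y).val : ℤ) : ℤ) : ℚ_[2]) with hY
  have hNn : Nrm Y N := ⟨(z : ℕ), (t : ℕ), by rw [hN, hY]; push_cast; ring⟩
  obtain ⟨r, hr⟩ : IsSquare (N * x) := by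
    apply isSquare_of_R8 (mul_ne_zero n0 hx)
    · rw [Padic.valuation_mul n0 hx, nv, ← hi, Int.even_iff]
      push_cast; omega
    · rw [R8_mul n0 hx, nr, U8_sq _ hu]
  obtain ⟨s, hs⟩ : IsSquare (Y * y) := by
    apply isSquare_of_R8 (mul_ne_zero y0 hy)
    · rw [Padic.valuation_mul y0 hy, yv, ← hj, Int.even_iff]
      omega
    · rw [R8_mul y0 hy, yr, U8_sq _ hv]
  have h3 : Nrm Y x := hNn.of_mul_left n0 (by rw [hr, ← pow_two]; exact Nrm.sq _ _)
  have h4 : Y = y * (s / y) ^ 2 := by field_simp; rw [hs]; ring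
  rw [h4] at h3
  exact h3.of_sq_eq

lemma S2_iff {x y : ℚ_[2]} (hx : x ≠ 0) (hy : y ≠ 0) : S2 x y = 1 ↔ Nrm y x :=
  ⟨nrm_of_S2 hx hy, isSym_S2.of_nrm hx hy⟩

end Two
end HilbertAux


namespace HilbertAux

open PadicInt

instance factPrimes (p : Nat.Primes) : Fact (p : ℕ).Prime := ⟨p.2⟩

/-- Hilbert symbol on rationals -/
noncomputable def H (p : Nat.Primes) (x y : ℚ) : ℚ :=
  if (p : ℕ) = 2 then S2 (x : ℚ_[2]) (y : ℚ_[2]) else SO (x : ℚ_[(p : ℕ)]) (y : ℚ_[(p : ℕ)])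

/-- real Hilbert symbol -/
def Hinf (x y : ℚ) : ℚ := if x < 0 ∧ y < 0 then -1 else 1

lemma cast_ne {p : ℕ} [Fact p.Prime] {x : ℚ} (hx : x ≠ 0) : (x : ℚ_[p]) ≠ 0 := by exact_mod_cast hx

lemma IsSym.comap {p : ℕ} [Fact p.Prime] {S : ℚ_[p] → ℚ_[p] → ℚ} (h : IsSym S) :
    IsSym (fun x y : ℚ => S (x : ℚ_[p]) (y : ℚ_[p])) := by
  refine ⟨?_, ?_, ?_, ?_, ?_⟩
  · intro x y hx hy; exact h.pm _ _ (cast_ne hx) (cast_ne hy)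
  · intro x x' y hx hx' hy
    have := h.mul _ _ _ (cast_ne hx) (cast_ne hx') (cast_ne hy)
    push_cast; exact this
  · intro x y; exact h.symm _ _
  · intro x hx
    have := h.neg _ (cast_ne hx)
    push_cast; exact this
  · intro s hs hs1
    have := h.stein (s : ℚ_[p]) (cast_ne hs) (by exact_mod_cast hs1)
    push_cast; exact this

lemma isSym_H (p : Nat.Primes) : IsSym (H p) := by
  by_cases h : (p : ℕ) = 2
  · have : H p = fun x y : ℚ => S2 (x : ℚ_[2]) (y : ℚ_[2]) := by
      funext x y; simp [H, h]
    rw [this]; exact isSym_S2.comap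
  · have : H p = fun x y : ℚ => SO (x : ℚ_[(p : ℕ)]) (y : ℚ_[(p : ℕ)]) := by
      funext x y; simp [H, h]
    rw [this]; exact isSym_SO.comap

lemma isSym_Hinf : IsSym Hinf := by
  refine ⟨?_, ?_, ?_, ?_, ?_⟩
  · intro x y _ _; unfold Hinf; split_ifs <;> simp
  · intro x x' y hx hx' hy
    unfold Hinf
    rcases lt_or_gt_of_ne hx with h | h <;> rcases lt_or_gt_of_ne hx' with h' | h' <;>
      rcases lt_or_gt_of_ne hy with h'' | h'' <;>
      simp [mul_neg_iff, h, h', h'', not_lt_of_gt]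
  · intro x y; unfold Hinf; simp [and_comm]
  · intro x hx; unfold Hinf
    rw [if_neg]; rintro ⟨h1, h2⟩; linarith
  · intro x hx _; unfold Hinf
    rw [if_neg]; rintro ⟨h1, h2⟩; linarith

lemma H_iff (p : Nat.Primes) {x y : ℚ} (hx : x ≠ 0) (hy : y ≠ 0) :
    H p x y = 1 ↔ Nrm (y : ℚ_[(p : ℕ)]) (x : ℚ_[(p : ℕ)]) := by
  by_cases h : (p : ℕ) = 2
  · obtain ⟨p, hp⟩ := p
    simp only at h
    subst h
    have : H ⟨2, hp⟩ x y = S2 x y := by simp [H]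
    rw [this]
    exact S2_iff (cast_ne hx) (cast_ne hy)
  · have : H p x y = SO (x : ℚ_[(p : ℕ)]) (y : ℚ_[(p : ℕ)]) := by simp [H, h]
    rw [this]
    exact SO_iff h (cast_ne hx) (cast_ne hy)

lemma H_units (p : Nat.Primes) (hp : (p : ℕ) ≠ 2) {x y : ℚ} (hx : padicValRat p x = 0)
    (hy : padicValRat p y = 0) : H p x y = 1 := by
  have : H p x y = SO (x : ℚ_[(p : ℕ)]) (y : ℚ_[(p : ℕ)]) := by simp [H, hp]
  rw [this]
  apply SO_units <;> rwa [Padic.valuation_ratCast]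

lemma finite_val {x : ℚ} (hx : x ≠ 0) : {p : Nat.Primes | padicValRat p x ≠ 0}.Finite := by
  have h1 : ((x.num.natAbs * x.den).primeFactors : Set ℕ).Finite := Finset.finite_toSet _
  have h2 := h1.preimage (f := ((↑) : Nat.Primes → ℕ)) Subtype.val_injective.injOn
  refine h2.subset ?_
  intro p hp
  simp only [Set.mem_preimage, Finset.mem_coe, Nat.mem_primeFactors]
  refine ⟨p.2, ?_, by simp [hx]⟩
  by_contra hd
  apply hp
  rw [p.2.dvd_mul, not_or] at hd
  rw [padicValRat_def, padicValInt, padicValNat.eq_zero_of_not_dvd hd.1,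
    padicValNat.eq_zero_of_not_dvd hd.2]; simp

/-- the prime 2 -/
def two' : Nat.Primes := ⟨2, Nat.prime_two⟩

lemma finite_H {x y : ℚ} (hx : x ≠ 0) (hy : y ≠ 0) :
    (Function.mulSupport (fun p => H p x y)).Finite := by
  refine (((finite_val hx).union (finite_val hy)).union (Set.finite_singleton two')).subset ?_
  intro p hp
  by_contra h
  simp only [Set.mem_union, Set.mem_ofPred_eq, Set.mem_singleton_iff, not_or, not_not] at h
  apply hp
  exact H_units p (fun h2 => h.2 (Subtype.ext h2)) h.1.1 h.1.2

/-- product of all symbols -/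
noncomputable def Tot (x y : ℚ) : ℚ := Hinf x y * ∏ᶠ p, H p x y

lemma Tot_mul {x x' y : ℚ} (hx : x ≠ 0) (hx' : x' ≠ 0) (hy : y ≠ 0) :
    Tot (x * x') y = Tot x y * Tot x' y := by
  unfold Tot
  rw [isSym_Hinf.mul _ _ _ hx hx' hy]
  have : ∀ p, H p (x * x') y = H p x y * H p x' y := fun p => (isSym_H p).mul _ _ _ hx hx' hy
  simp_rw [this]
  rw [finprod_mul_distrib (finite_H hx hy) (finite_H hx' hy)]
  ring

lemma Tot_symm (x y : ℚ) : Tot x y = Tot y x := by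
  unfold Tot
  rw [isSym_Hinf.symm]
  simp_rw [fun p => (isSym_H p).symm x y]

lemma Tot_neg {x : ℚ} (hx : x ≠ 0) : Tot x (-x) = 1 := by
  unfold Tot
  rw [isSym_Hinf.neg x hx]
  simp_rw [fun p => (isSym_H p).neg x hx]
  simp

lemma Tot_eq (x y : ℚ) (T : Finset Nat.Primes) (h : ∀ p ∉ T, H p x y = 1) :
    Tot x y = Hinf x y * ∏ p ∈ T, H p x y := by
  unfold Tot
  rw [finprod_eq_prod_of_mulSupport_subset]
  intro p hp
  by_contra h'
  exact hp (h p (by simpa using h'))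

lemma Tot_one {y : ℚ} (hy : y ≠ 0) : Tot 1 y = 1 := by
  unfold Tot
  rw [isSym_Hinf.isSquare one_ne_zero hy (IsSquare.one)]
  simp_rw [fun p => (isSym_H p).isSquare one_ne_zero hy (IsSquare.one)]
  simp

lemma rat_induction {P : ℚ → Prop} (h1 : P 1) (hneg : P (-1)) (hp : ∀ p : Nat.Primes, P (p : ℕ))
    (hmul : ∀ x y, x ≠ 0 → y ≠ 0 → P x → P y → P (x * y))
    (hinv : ∀ x, x ≠ 0 → P x → P x⁻¹) : ∀ x, x ≠ 0 → P x := by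
  have hnat : ∀ n : ℕ, n ≠ 0 → P n := by
    intro n
    induction n using induction_on_primes with
    | zero => simp
    | one => intro _; simpa using h1
    | prime_mul p a hpp ih =>
      intro h
      have ha : a ≠ 0 := by rintro rfl; simp at h
      have := hmul p a (by exact_mod_cast hpp.ne_zero) (by exact_mod_cast ha) (hp ⟨p, hpp⟩) (ih ha)
      exact_mod_cast this
  have hZall : ∀ n : ℤ, n ≠ 0 → P n := by
    intro n hn
    rcases Int.natAbs_eq n with h | h
    · rw [h, Int.cast_natCast]; exact hnat n.natAbs (by simpa using hn)
    · rw [h]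
      have := hmul (-1) n.natAbs (by simp) (by simpa using hn) hneg (hnat n.natAbs (by simpa using hn))
      rw [neg_one_mul] at this
      rw [Int.cast_neg, Int.cast_natCast]
      exact this
  intro x hx
  rw [← Rat.num_div_den x, div_eq_mul_inv]
  apply hmul
  · simpa using hx
  · simp
  · exact hZall _ (by simpa using hx)
  · apply hinv _ (by simp)
    exact hnat _ (by simp)

section values
variable {p : ℕ} [Fact p.Prime]

lemma val_nat_unit {q : ℕ} (h : ¬ p ∣ q) :
    ((q : ℚ) : ℚ_[p]).valuation = 0 ∧ up ((q : ℚ) : ℚ_[p]) = q := by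
  have h1 : ‖(q : ℤ_[p])‖ = 1 := by
    rw [PadicInt.norm_natCast_eq_one_iff]
    exact (Nat.Prime.coprime_iff_not_dvd Fact.out).2 h
  have e : ((q : ℚ) : ℚ_[p]) = ((q : ℤ_[p]) : ℚ_[p]) := by push_cast; rfl
  rw [e]
  exact ⟨val_unit h1, up_coe h1⟩

lemma val_p' : ((p : ℚ) : ℚ_[p]).valuation = 1 ∧ up ((p : ℚ) : ℚ_[p]) = 1 := by
  rw [Rat.cast_natCast]
  exact ⟨Padic.valuation_p, up_p⟩

lemma val_neg_one : (((-1 : ℚ)) : ℚ_[p]).valuation = 0 ∧ up ((-1 : ℚ) : ℚ_[p]) = -1 := by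
  push_cast
  refine ⟨by rw [val_neg, Padic.valuation_one], ?_⟩
  rw [up_neg one_ne_zero, up_one]

end values

lemma prime_not_dvd {p q : Nat.Primes} (h : p ≠ q) : ¬ (p : ℕ) ∣ (q : ℕ) := by
  rw [Nat.prime_dvd_prime_iff_eq p.2 q.2]
  intro h'; exact h (Subtype.ext h')

lemma two'_ne {p : Nat.Primes} : p ≠ two' ↔ (p : ℕ) ≠ 2 :=
  ⟨fun h h' => h (Subtype.ext h'), fun h h' => h (by rw [h']; rfl)⟩

lemma H_two (x y : ℚ) : H two' x y = S2 x y := by simp [H, two']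

lemma H_odd {p : Nat.Primes} (h : p ≠ two') (x y : ℚ) :
    H p x y = SO (x : ℚ_[(p : ℕ)]) (y : ℚ_[(p : ℕ)]) := by
  rw [two'_ne] at h; simp [H, h]

lemma H_pp {p q : Nat.Primes} (h : p ≠ two') (hq : q ≠ p) :
    H p (p : ℕ) (q : ℕ) = (legendreSym (p : ℕ) (q : ℕ) : ℤ) := by
  rw [H_odd h, SO]
  have h1 := val_p' (p := (p : ℕ))
  have h2 := val_nat_unit (p := (p : ℕ)) (q := q) (prime_not_dvd hq.symm)
  rw [h1.1, h2.1, zpow_zero, one_mul, mul_zero, zpow_zero, mul_one, zpow_one, fO, h2.2]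
  simp [legendreSym]

lemma H_neg_p {p : Nat.Primes} (h : p ≠ two') :
    H p (-1) (p : ℕ) = (legendreSym (p : ℕ) (-1) : ℤ) := by
  rw [H_odd h, SO]
  have h1 := val_p' (p := (p : ℕ))
  have h2 := val_neg_one (p := (p : ℕ))
  rw [h1.1, h2.1, zpow_zero, zero_mul, zpow_zero, mul_one, zpow_one, fO, h2.2]
  simp [legendreSym]

lemma R8_neg_one : R8 ((-1 : ℚ) : ℚ_[2]) = 7 := by
  unfold R8; rw [val_neg_one.2, map_neg, map_one]; decide

lemma R8_two : R8 (((2 : ℕ) : ℚ) : ℚ_[2]) = 1 := by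
  unfold R8; rw [val_p'.2, map_one]

lemma R8_nat {q : Nat.Primes} (h : q ≠ two') : R8 (((q : ℕ) : ℚ) : ℚ_[2]) = (q : ℕ) := by
  unfold R8
  rw [(val_nat_unit (p := 2) (q := q) (prime_not_dvd (p := two') h.symm)).2, map_natCast]

lemma val2_nat {q : Nat.Primes} (h : q ≠ two') : (((q : ℕ) : ℚ) : ℚ_[2]).valuation = 0 :=
  (val_nat_unit (p := 2) (q := q) (prime_not_dvd (p := two') h.symm)).1

lemma H_units_val {p : Nat.Primes} (h : p ≠ two') {x y : ℚ} (hx : (x : ℚ_[(p : ℕ)]).valuation = 0)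
    (hy : (y : ℚ_[(p : ℕ)]).valuation = 0) : H p x y = 1 := by
  rw [H_odd h]; exact SO_units hx hy

lemma Hinf_pos_right {x y : ℚ} (hy : 0 < y) : Hinf x y = 1 := by
  unfold Hinf; rw [if_neg]; rintro ⟨_, h⟩; linarith

lemma odd_mod8 {q : Nat.Primes} (h : q ≠ two') : (q : ℕ) % 2 = 1 :=
  (q.2.eq_two_or_odd).resolve_left (two'_ne.1 h)

lemma U8_nat {q : ℕ} (h : q % 2 = 1) : U8 (q : ZMod 8) := by
  rw [← ZMod.natCast_mod q 8]
  have : q % 8 = 1 ∨ q % 8 = 3 ∨ q % 8 = 5 ∨ q % 8 = 7 := by omega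
  rcases this with h | h | h | h <;> rw [h] <;> decide

lemma E8_nat {q r : ℕ} (hq : q % 2 = 1) (hr : r % 2 = 1) :
    E8 (q : ZMod 8) (r : ZMod 8) = (-1) ^ (q / 2 * (r / 2)) := by
  rw [pow_mul]
  rw [← ZMod.natCast_mod q 8, ← ZMod.natCast_mod r 8]
  rcases (show q % 4 = 1 ∨ q % 4 = 3 by omega) with h | h <;>
  rcases (show r % 4 = 1 ∨ r % 4 = 3 by omega) with h' | h'
  · rw [(show Even (q / 2) by rw [Nat.even_iff]; omega).neg_one_pow, one_pow]
    rcases (show q % 8 = 1 ∨ q % 8 = 5 by omega) with h | h <;>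
    rcases (show r % 8 = 1 ∨ r % 8 = 5 by omega) with h' | h' <;> rw [h, h'] <;> decide
  · rw [(show Even (q / 2) by rw [Nat.even_iff]; omega).neg_one_pow, one_pow]
    rcases (show q % 8 = 1 ∨ q % 8 = 5 by omega) with h | h <;>
    rcases (show r % 8 = 3 ∨ r % 8 = 7 by omega) with h' | h' <;> rw [h, h'] <;> decide
  · rw [(show Odd (q / 2) by rw [Nat.odd_iff]; omega).neg_one_pow,
      (show Even (r / 2) by rw [Nat.even_iff]; omega).neg_one_pow]
    rcases (show q % 8 = 3 ∨ q % 8 = 7 by omega) with h | h <;>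
    rcases (show r % 8 = 1 ∨ r % 8 = 5 by omega) with h' | h' <;> rw [h, h'] <;> decide
  · rw [(show Odd (q / 2) by rw [Nat.odd_iff]; omega).neg_one_pow,
      (show Odd (r / 2) by rw [Nat.odd_iff]; omega).neg_one_pow]
    rcases (show q % 8 = 3 ∨ q % 8 = 7 by omega) with h | h <;>
    rcases (show r % 8 = 3 ∨ r % 8 = 7 by omega) with h' | h' <;> rw [h, h'] <;> decide

lemma Tot_neg_neg : Tot (-1) (-1) = 1 := by
  rw [Tot_eq _ _ {two'}]
  · rw [Finset.prod_singleton, H_two, S2, R8_neg_one, val_neg_one.1]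
    have : E8 7 7 = -1 := by decide
    rw [this]; simp [Hinf]
  · intro p hp
    exact H_units_val (by simpa using hp) val_neg_one.1 val_neg_one.1

lemma Tot_neg_prime (q : Nat.Primes) : Tot (-1) (q : ℕ) = 1 := by
  have hpos : (0 : ℚ) < (q : ℕ) := by exact_mod_cast q.2.pos
  by_cases hq : q = two'
  · subst hq
    rw [Tot_eq _ _ {two'}]
    · rw [Finset.prod_singleton, H_two, S2, f2, R8_neg_one, val_neg_one.1]
      rw [show ((two' : Nat.Primes) : ℕ) = 2 from rfl, R8_two, val_p'.1]
      have : E8 7 1 = 1 := by decide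
      have h2 : ZMod.χ₈ 7 = 1 := by decide
      rw [this, h2]; simp [Hinf]
    · intro p hp
      have hp' : p ≠ two' := by simpa using hp
      exact H_units_val hp' val_neg_one.1 (val_nat_unit (prime_not_dvd hp')).1
  · rw [Tot_eq _ _ {two', q}]
    · rw [Finset.prod_pair (Ne.symm hq), H_two, S2, R8_neg_one, val_neg_one.1, R8_nat hq, val2_nat hq,
        H_neg_p hq, legendreSym.at_neg_one (two'_ne.1 hq), Hinf_pos_right hpos]
      have : E8 7 ((q : ℕ) : ZMod 8) = ZMod.χ₄ (q : ℕ) := by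
        rw [ZMod.χ₄_eq_neg_one_pow (odd_mod8 hq)]
        have := E8_nat (q := 7) (r := q) (by norm_num) (odd_mod8 hq)
        rw [show ((7 : ℕ) : ZMod 8) = 7 from rfl] at this
        rw [this, pow_mul]; norm_num
      rw [this, ZMod.χ₄_eq_neg_one_pow (odd_mod8 hq)]
      simp only [zpow_zero, one_mul]
      push_cast
      rw [← mul_pow]; norm_num
    · intro p hp
      simp only [Finset.mem_insert, Finset.mem_singleton, not_or] at hp
      exact H_units_val hp.1 val_neg_one.1 (val_nat_unit (prime_not_dvd hp.2)).1

lemma Tot_two_prime (q : Nat.Primes) (hq : q ≠ two') : Tot ((two' : Nat.Primes) : ℕ) (q : ℕ) = 1 := by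
  have hpos : (0 : ℚ) < (q : ℕ) := by exact_mod_cast q.2.pos
  rw [Tot_eq _ _ {two', q}]
  · rw [Finset.prod_pair (Ne.symm hq), H_two, S2, (isSym_H q).symm, H_pp hq (Ne.symm hq)]
    rw [show ((two' : Nat.Primes) : ℕ) = 2 from rfl, f2, f2, R8_two, R8_nat hq, val_p'.1, val2_nat hq]
    rw [show (((2 : ℕ) : ℤ)) = 2 from rfl, legendreSym.at_two (two'_ne.1 hq), Hinf_pos_right hpos]
    have h1 : ∀ u, U8 u → E8 1 u = 1 := by decide
    rw [h1 _ (U8_nat (odd_mod8 hq))]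
    rcases chi_eight_pm _ (U8_nat (odd_mod8 hq)) with h | h <;> rw [h] <;> norm_num
  · intro p hp
    simp only [Finset.mem_insert, Finset.mem_singleton, not_or] at hp
    exact H_units_val hp.1 (val_nat_unit (prime_not_dvd hp.1)).1 (val_nat_unit (prime_not_dvd hp.2)).1

lemma Tot_prime_prime (p q : Nat.Primes) : Tot (p : ℕ) (q : ℕ) = 1 := by
  have hq0 : ((q : ℕ) : ℚ) ≠ 0 := by exact_mod_cast q.2.ne_zero
  have hpos : (0 : ℚ) < (q : ℕ) := by exact_mod_cast q.2.pos
  by_cases hpq : p = q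
  · subst hpq
    have h1 := Tot_neg hq0
    rw [Tot_symm, neg_eq_neg_one_mul, Tot_mul (by simp) hq0 hq0, Tot_neg_prime, one_mul] at h1
    exact h1
  by_cases hp : p = two'
  · subst hp; exact Tot_two_prime q (Ne.symm hpq)
  by_cases hq : q = two'
  · subst hq; rw [Tot_symm]; exact Tot_two_prime p hp
  rw [Tot_eq _ _ {two', p, q}]
  · rw [Finset.prod_insert (by simp [Ne.symm hp, Ne.symm hq]), Finset.prod_pair hpq, H_two, S2,
      H_pp hp (Ne.symm hpq), (isSym_H q).symm, H_pp hq hpq, R8_nat hp, R8_nat hq, val2_nat hp,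
      val2_nat hq, E8_nat (odd_mod8 hp) (odd_mod8 hq), Hinf_pos_right hpos]
    have := legendreSym.quadratic_reciprocity (p := p) (q := q) (two'_ne.1 hp) (two'_ne.1 hq)
      (fun h => hpq (Subtype.ext h))
    rw [← this]
    have hs : (legendreSym (p : ℕ) (q : ℕ)) ^ 2 = 1 := by
      apply legendreSym.sq_one
      intro h
      have := (ZMod.natCast_eq_zero_iff (q : ℕ) (p : ℕ)).1 (by exact_mod_cast h)
      exact prime_not_dvd hpq this
    have hs' : (legendreSym (q : ℕ) (p : ℕ)) ^ 2 = 1 := by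
      apply legendreSym.sq_one
      intro h
      have := (ZMod.natCast_eq_zero_iff (p : ℕ) (q : ℕ)).1 (by exact_mod_cast h)
      exact prime_not_dvd (Ne.symm hpq) this
    simp only [zpow_zero, one_mul]
    norm_cast
    linear_combination (legendreSym (q : ℕ) (p : ℕ)) ^ 2 * hs + hs'
  · intro r hr
    simp only [Finset.mem_insert, Finset.mem_singleton, not_or] at hr
    exact H_units_val hr.1 (val_nat_unit (prime_not_dvd hr.2.1)).1
      (val_nat_unit (prime_not_dvd hr.2.2)).1

lemma product_formula {x y : ℚ} (hx : x ≠ 0) (hy : y ≠ 0) : Tot x y = 1 := by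
  have hgen : ∀ x : ℚ, x ≠ 0 → (Tot x (-1) = 1 ∧ ∀ q : Nat.Primes, Tot x (q : ℕ) = 1) →
      ∀ y, y ≠ 0 → Tot x y = 1 := by
    intro x hx h
    apply rat_induction
    · rw [Tot_symm]; exact Tot_one hx
    · exact h.1
    · exact h.2
    · intro a b ha hb h1 h2
      rw [Tot_symm, Tot_mul ha hb hx, Tot_symm a, Tot_symm b, h1, h2, one_mul]
    · intro a ha h1
      have := Tot_mul (x := a) (x' := a⁻¹) ha (inv_ne_zero ha) hx
      rw [mul_inv_cancel₀ ha, Tot_one hx, Tot_symm, h1, one_mul] at this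
      rw [Tot_symm]; exact this.symm
  have hneg : ∀ y, y ≠ 0 → Tot (-1) y = 1 := hgen (-1) (by simp) ⟨Tot_neg_neg, Tot_neg_prime⟩
  have hpr : ∀ p : Nat.Primes, ∀ y, y ≠ 0 → Tot (p : ℕ) y = 1 := by
    intro p
    have hp0 : ((p : ℕ) : ℚ) ≠ 0 := by exact_mod_cast p.2.ne_zero
    exact hgen _ hp0 ⟨by rw [Tot_symm]; exact hneg _ hp0, Tot_prime_prime p⟩
  refine hgen x hx ⟨?_, fun q => ?_⟩ y hy
  · rw [Tot_symm]; exact hneg x hx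
  · rw [Tot_symm]; exact hpr q x hx

end HilbertAux


namespace HilbertAux

open PadicInt

lemma int_sqfree {n : ℤ} (hn : n ≠ 0) : ∃ m s : ℤ, Squarefree m ∧ s ≠ 0 ∧ n = m * s ^ 2 := by
  obtain ⟨a, b, ha, hb, h, hs⟩ := Nat.sq_mul_squarefree_of_pos (Int.natAbs_pos.2 hn)
  have hs' : Squarefree (a : ℤ) := by rwa [Int.squarefree_natCast]
  have h' : (n.natAbs : ℤ) = (b : ℤ) ^ 2 * a := by rw [← h]; push_cast; ring
  rcases Int.natAbs_eq n with e | e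
  · exact ⟨a, b, hs', by omega, by rw [e, h']; ring⟩
  · refine ⟨-a, b, ?_, by omega, by rw [e, h']; ring⟩
    rw [← Int.squarefree_natAbs] at hs' ⊢
    rwa [Int.natAbs_neg]

lemma rat_sqfree {x : ℚ} (hx : x ≠ 0) :
    ∃ (m : ℤ) (s : ℚ), Squarefree m ∧ s ≠ 0 ∧ x = m * s ^ 2 := by
  have hd : x.den ≠ 0 := x.den_nz
  obtain ⟨m, s, hm, hs, h⟩ := int_sqfree (n := x.num * x.den)
    (mul_ne_zero (Rat.num_ne_zero.2 hx) (by exact_mod_cast hd))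
  have hd' : (x.den : ℚ) ≠ 0 := by exact_mod_cast hd
  refine ⟨m, s / x.den, hm, div_ne_zero (by exact_mod_cast hs) hd', ?_⟩
  have h' : (x.num : ℚ) * x.den = m * (s : ℚ) ^ 2 := by exact_mod_cast h
  have e : x = x.num / x.den := (Rat.num_div_den x).symm
  rw [div_pow, mul_div_assoc', ← h']
  nth_rw 1 [e]
  field_simp

lemma int_val_unit {p : ℕ} [Fact p.Prime] {a : ℤ} (h : ¬ (p : ℤ) ∣ a) :
    ((a : ℚ) : ℚ_[p]).valuation = 0 ∧ up ((a : ℚ) : ℚ_[p]) = a := by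
  have hn : ‖(a : ℤ_[p])‖ = 1 := by
    have := PadicInt.norm_int_lt_one_iff_dvd (p := p) a
    have h1 := PadicInt.norm_le_one (a : ℤ_[p])
    by_contra hne
    exact h (this.1 (lt_of_le_of_ne h1 hne))
  have e : ((a : ℚ) : ℚ_[p]) = ((a : ℤ_[p]) : ℚ_[p]) := by push_cast; rfl
  rw [e]
  exact ⟨val_unit hn, up_coe hn⟩

lemma local_sq {p : Nat.Primes} {a b : ℤ} (ha : a ≠ 0) (hb : Squarefree b)
    (hpb : ((p : ℕ) : ℤ) ∣ b) (h : H p b a = 1) : ∃ t : ℤ, ((p : ℕ) : ℤ) ∣ t ^ 2 - a := by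
  by_cases h2 : p = two'
  · subst h2
    refine ⟨a, ?_⟩
    have : Even (a ^ 2 - a) := by
      rw [pow_two, ← mul_sub_one]; exact Int.even_mul_pred_self a
    simpa [two'] using this.two_dvd
  by_cases hpa : ((p : ℕ) : ℤ) ∣ a
  · exact ⟨0, by simpa using hpa⟩
  obtain ⟨k, rfl⟩ := hpb
  have hpk : ¬ ((p : ℕ) : ℤ) ∣ k := by
    rintro ⟨l, rfl⟩
    have := hb ((p : ℕ) : ℤ) ⟨l, by ring⟩
    exact (Nat.prime_iff_prime_int.1 p.2).not_isUnit this
  have hk : k ≠ 0 := by rintro rfl; simp at hpk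
  obtain ⟨va, ua⟩ := int_val_unit hpa
  obtain ⟨vk, -⟩ := int_val_unit hpk
  rw [H_odd h2] at h
  have vb : ((((p : ℕ) * k : ℤ) : ℚ) : ℚ_[(p : ℕ)]).valuation = 1 := by
    have e : ((((p : ℕ) * k : ℤ) : ℚ) : ℚ_[(p : ℕ)]) =
      (((p : ℕ) : ℚ) : ℚ_[(p : ℕ)]) * ((k : ℚ) : ℚ_[(p : ℕ)]) := by push_cast; rfl
    rw [e, Padic.valuation_mul, vk, val_p'.1]; rfl
    · exact cast_ne (by exact_mod_cast p.2.ne_zero)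
    · exact cast_ne (by exact_mod_cast hk)
  unfold SO at h
  rw [va, vb] at h
  simp only [zpow_zero, zpow_one, one_mul, mul_zero, mul_one] at h
  unfold fO at h
  rw [ua] at h
  have h' : quadraticChar (ZMod p) (toZMod (a : ℤ_[(p : ℕ)])) = 1 := by exact_mod_cast h
  rw [map_intCast] at h'
  have hne : ((a : ℤ) : ZMod p) ≠ 0 := by
    rwa [Ne, ZMod.intCast_zmod_eq_zero_iff_dvd]
  rw [quadraticChar_one_iff_isSquare hne] at h'
  obtain ⟨r, hr⟩ := h'
  obtain ⟨t, rfl⟩ := ZMod.intCast_surjective r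
  refine ⟨t, ?_⟩
  rw [← ZMod.intCast_zmod_eq_zero_iff_dvd]
  push_cast
  rw [hr]; ring

lemma crt_sq (a : ℤ) (n : ℕ) : Squarefree n →
    (∀ p : ℕ, p.Prime → p ∣ n → ∃ t : ℤ, (p : ℤ) ∣ t ^ 2 - a) → ∃ t : ℤ, (n : ℤ) ∣ t ^ 2 - a := by
  induction n using induction_on_primes with
  | zero => intro h; exact absurd h not_squarefree_zero
  | one => intro _ _; exact ⟨0, by simp⟩
  | prime_mul p m hp ih =>
    intro hs h
    obtain ⟨hc, -, hm⟩ := Nat.squarefree_mul_iff.1 hs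
    obtain ⟨t2, d2, h2⟩ := ih hm fun q hq hd => h q hq (hd.mul_left _)
    obtain ⟨t1, d1, h1⟩ := h p hp (dvd_mul_right _ _)
    obtain ⟨u, v, huv⟩ := Nat.isCoprime_iff_coprime.2 hc
    refine ⟨t1 * (v * m) + t2 * (u * p), ?_⟩
    push_cast
    apply IsCoprime.mul_dvd (Nat.isCoprime_iff_coprime.2 hc)
    · have : t1 * (v * m) + t2 * (u * p) = t1 + p * (u * (t2 - t1)) := by
        linear_combination t1 * huv
      rw [this]
      exact ⟨d1 + 2 * t1 * (u * (t2 - t1)) + p * (u * (t2 - t1)) ^ 2, by linear_combination h1⟩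
    · have : t1 * (v * m) + t2 * (u * p) = t2 + m * (v * (t1 - t2)) := by
        linear_combination t2 * huv
      rw [this]
      exact ⟨d2 + 2 * t2 * (v * (t1 - t2)) + m * (v * (t1 - t2)) ^ 2, by linear_combination h2⟩

lemma exists_small_sq {a b : ℤ} (ha : a ≠ 0) (hb : Squarefree b) 
    (h : ∀ p, H p b a = 1) : ∃ t : ℤ, b ∣ t ^ 2 - a ∧ 2 * |t| ≤ |b| := by
  obtain ⟨t, ht⟩ := crt_sq a b.natAbs (Int.squarefree_natAbs.2 hb) fun p hp hd =>
    local_sq (p := ⟨p, hp⟩) ha hb (Int.natCast_dvd.2 hd) (h _)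
  have hb0 : 0 < b.natAbs := Int.natAbs_pos.2 hb.ne_zero
  refine ⟨t.bmod b.natAbs, ?_, ?_⟩
  · rw [← Int.natAbs_dvd]
    obtain ⟨k, hk⟩ := Int.dvd_bmod_sub_self (x := t) (m := b.natAbs)
    obtain ⟨l, hl⟩ := ht
    rw [sub_eq_iff_eq_add.1 hk]
    exact ⟨l + 2 * k * t + b.natAbs * k ^ 2, by linear_combination hl⟩
  · have h1 := Int.bmod_lt (x := t) hb0
    have h2 := Int.le_bmod (x := t) hb0
    rw [Int.abs_eq_natAbs b]
    rcases abs_cases (t.bmod b.natAbs) with ⟨e, _⟩ | ⟨e, _⟩ <;> rw [e] <;> omega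

lemma hasse_int (N : ℕ) : ∀ a b : ℤ, Squarefree a → Squarefree b → a.natAbs + b.natAbs ≤ N →
    (∀ p, H p b a = 1) → Hinf b a = 1 → Nrm (a : ℚ) (b : ℚ) := by
  induction N with
  | zero =>
    intro a b ha hb hN
    have := ha.ne_zero; omega
  | succ N ih =>
    intro a b ha hb hN hp hinf
    have ha0 := ha.ne_zero
    have hb0 := hb.ne_zero
    have haQ : (a : ℚ) ≠ 0 := by exact_mod_cast ha0
    have hbQ : (b : ℚ) ≠ 0 := by exact_mod_cast hb0
    have h2 : (2 : ℚ) ≠ 0 := two_ne_zero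
    wlog hab : |a| ≤ |b| generalizing a b
    · apply Nrm.symm h2 haQ
      refine this b a hb ha (by omega) (fun p => ?_) ?_ hb0 ha0 hbQ haQ (by omega)
      · rw [(isSym_H p).symm]; exact hp p
      · rw [isSym_Hinf.symm]; exact hinf
    rcases le_or_gt |b| 1 with h1 | h1
    · have ea : a = 1 ∨ a = -1 := by
        have := abs_pos.2 ha0
        have : |a| = 1 := by omega
        exact (abs_eq (by norm_num)).1 this
      have eb : b = 1 ∨ b = -1 := by
        have := abs_pos.2 hb0
        have : |b| = 1 := by omega
        exact (abs_eq (by norm_num)).1 this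
      rcases eb with rfl | rfl
      · exact ⟨1, 0, by norm_num⟩
      rcases ea with rfl | rfl
      · exact ⟨0, 1, by norm_num⟩
      · norm_num [Hinf] at hinf
    obtain ⟨t, ⟨b', hb'⟩, ht⟩ := exists_small_sq ha0 hb hp
    by_cases hz : b' = 0
    · subst hz
      apply Nrm.of_isSquare h2 haQ
      refine ⟨t, ?_⟩
      have : a = t * t := by linear_combination -hb'
      exact_mod_cast this
    obtain ⟨m, s, hm, hs, e⟩ := int_sqfree hz
    have hm0 := hm.ne_zero
    have hmQ : (m : ℚ) ≠ 0 := by exact_mod_cast hm0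
    have hsQ : (s : ℚ) ≠ 0 := by exact_mod_cast hs
    have hn : Nrm (a : ℚ) (((b * s ^ 2 : ℤ) : ℚ) * m) := by
      refine ⟨t, 1, ?_⟩
      have : b * s ^ 2 * m = t ^ 2 - a := by rw [hb', e]; ring
      have : (b : ℚ) * s ^ 2 * m = t ^ 2 - a := by exact_mod_cast this
      push_cast; linear_combination this
    have key : ∀ S : ℚ → ℚ → ℚ, IsSym S → S b a = 1 → S m a = 1 := by
      intro S hS h
      have := hS.of_nrm (mul_ne_zero (by push_cast; positivity) hmQ) haQ hn
      push_cast at this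
      rw [hS.mul _ _ _ (mul_ne_zero hbQ (pow_ne_zero 2 hsQ)) hmQ haQ,
        hS.mul _ _ _ hbQ (pow_ne_zero 2 hsQ) haQ, h, hS.sq hsQ haQ] at this
      simpa using this
    have hlt : |m| < |b| := by
      have h3 : |m| ≤ |b'| := by
        rw [e, abs_mul]
        have : 1 ≤ |s ^ 2| := Int.one_le_abs (pow_ne_zero 2 hs)
        nlinarith [abs_nonneg m]
      have h4 : |b| * |b'| ≤ |t| ^ 2 + |a| := by
        rw [← abs_mul, ← hb', ← abs_pow]; exact abs_sub _ _
      have h5 : 4 * |t| ^ 2 ≤ |b| ^ 2 := by nlinarith [abs_nonneg t]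
      by_contra hcon
      have h6 : |b| ≤ |b'| := by omega
      nlinarith
    rw [Int.abs_eq_natAbs, Int.abs_eq_natAbs] at hlt
    have hm' := ih a m ha hm (by omega) (fun p => key _ (isSym_H p) (hp p))
      (key _ isSym_Hinf hinf)
    have h7 : Nrm (a : ℚ) (((b * s ^ 2 : ℤ) : ℚ)) := by
      rw [mul_comm] at hn
      exact Nrm.of_mul_left hmQ hm' hn
    push_cast at h7
    exact nrm_congr_left hsQ h7

theorem hasse {a x : ℚ} (ha : a ≠ 0) (hx : x ≠ 0) (hp : ∀ p, H p x a = 1) (hinf : Hinf x a = 1) :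
    Nrm a x := by
  obtain ⟨m, s, hm, hs, rfl⟩ := rat_sqfree ha
  obtain ⟨n, r, hn, hr, rfl⟩ := rat_sqfree hx
  have hmQ : (m : ℚ) ≠ 0 := by exact_mod_cast hm.ne_zero
  have hnQ : (n : ℚ) ≠ 0 := by exact_mod_cast hn.ne_zero
  have key : ∀ S : ℚ → ℚ → ℚ, IsSym S → S (n * r ^ 2) (m * s ^ 2) = 1 → S n m = 1 := by
    intro S hS h
    rw [hS.mul _ _ _ hnQ (pow_ne_zero 2 hr) ha, hS.sq hr ha, mul_one, hS.symm,
      hS.mul _ _ _ hmQ (pow_ne_zero 2 hs) hnQ, hS.sq hs hnQ, mul_one, hS.symm] at h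
    exact h
  have := hasse_int _ m n hm hn le_rfl (fun p => key _ (isSym_H p) (hp p)) (key _ isSym_Hinf hinf)
  refine Nrm.mul ?_ (Nrm.sq _ _)
  apply Nrm.of_sq_eq (s := s⁻¹)
  have e : (m : ℚ) * s ^ 2 * s⁻¹ ^ 2 = m := by field_simp
  rw [e]; exact this

end HilbertAux


namespace HilbertAux

open PadicInt

lemma val_prime (q r : Nat.Primes) : padicValRat q (r : ℕ) = if q = r then 1 else 0 := by
  rw [padicValRat.of_nat]
  split_ifs with h
  · subst h; simp
  · rw [padicValNat.eq_zero_of_not_dvd (prime_not_dvd h)]; rfl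

lemma prime_ne (r : Nat.Primes) : ((r : ℕ) : ℚ) ≠ 0 := by exact_mod_cast r.2.ne_zero

lemma val_prod (q : Nat.Primes) (T : Finset Nat.Primes) (e : Nat.Primes → ℤ) :
    padicValRat q (∏ r ∈ T, ((r : ℕ) : ℚ) ^ e r) = if q ∈ T then e q else 0 := by
  classical
  induction T using Finset.induction_on with
  | empty => simp
  | insert r T hr ih =>
    rw [Finset.prod_insert hr, padicValRat.mul (zpow_ne_zero _ (prime_ne r))
      (Finset.prod_ne_zero_iff.2 fun r _ => zpow_ne_zero _ (prime_ne r)), ih,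
      padicValRat.zpow, val_prime]
    by_cases h : q = r
    · subst h; simp [hr]
    · simp [h]

lemma approx (T : Finset Nat.Primes) (τ : Nat.Primes → ℚ) (hτ : ∀ q, τ q ≠ 0) (s : ℚ)
    (hs : s = 1 ∨ s = -1) : ∃ (α : ℚ) (l : Nat.Primes), l ∉ T ∧ α ≠ 0 ∧ 0 < α * s ∧
      (∀ q ∈ T, IsSquare ((α / τ q : ℚ) : ℚ_[(q : ℕ)])) ∧
      ∀ q, q ∉ T → q ≠ l → padicValRat q α = 0 := by
  classical
  set P : ℚ := ∏ r ∈ T, ((r : ℕ) : ℚ) ^ padicValRat r (τ r) with hP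
  have hPpos : 0 < P := Finset.prod_pos fun r _ => zpow_pos (by exact_mod_cast r.2.pos) _
  have hs0 : s ≠ 0 := ne_of_pm hs
  have hvs : ∀ q : Nat.Primes, padicValRat q s = 0 := by
    intro q; rcases hs with rfl | rfl <;> simp
  set M := s * P with hM
  have hM0 : M ≠ 0 := mul_ne_zero hs0 hPpos.ne'
  have hvM : ∀ q : Nat.Primes, padicValRat q M = if q ∈ T then padicValRat q (τ q) else 0 := by
    intro q
    rw [hM, padicValRat.mul hs0 hPpos.ne', hvs, zero_add, hP,
      val_prod q T fun r => padicValRat r (τ r)]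
  have hw0 : ∀ q : Nat.Primes, ((τ q / M : ℚ) : ℚ_[(q : ℕ)]) ≠ 0 := fun q =>
    cast_ne (div_ne_zero (hτ q) hM0)
  have hwv : ∀ q ∈ T, ((τ q / M : ℚ) : ℚ_[(q : ℕ)]).valuation = 0 := by
    intro q hq
    rw [Padic.valuation_ratCast, padicValRat.div (hτ q) hM0, hvM, if_pos hq, sub_self]
  let n : Nat.Primes → ℕ := fun q => (toZModPow 3 (up ((τ q / M : ℚ) : ℚ_[(q : ℕ)]))).val
  have hcop : ∀ q, (n q).Coprime ((q : ℕ) ^ 3) := by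
    intro q
    have : IsUnit (toZModPow 3 (up ((τ q / M : ℚ) : ℚ_[(q : ℕ)]))) := (isUnit_up (hw0 q)).map _
    obtain ⟨u, hu⟩ := this
    have h := ZMod.val_coe_unit_coprime u
    rw [hu] at h; exact h
  obtain ⟨k, hk⟩ := Nat.chineseRemainderOfFinset n (fun q : Nat.Primes => (q : ℕ) ^ 3) T
    (fun q _ => pow_ne_zero 3 q.2.ne_zero) (by
      intro q _ r _ hqr
      apply Nat.Coprime.pow
      exact (Nat.coprime_primes q.2 r.2).2 fun h => hqr (Subtype.ext h))
  have hkc : k.Coprime (∏ q ∈ T, (q : ℕ) ^ 3) := by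
    apply Nat.Coprime.prod_right
    intro q hq
    have := (hk q hq).gcd_eq
    rw [Nat.Coprime, this]; exact hcop q
  obtain ⟨l, hl, hlp, hlk⟩ := Nat.forall_exists_prime_gt_and_modEq
    (T.sup fun q : Nat.Primes => (q : ℕ)) 
    (Finset.prod_ne_zero_iff.2 fun (q : Nat.Primes) _ => pow_ne_zero 3 q.2.ne_zero) hkc
  have hl0 : (l : ℚ) ≠ 0 := by exact_mod_cast hlp.ne_zero
  have hlT : (⟨l, hlp⟩ : Nat.Primes) ∉ T := by
    intro h
    have := Finset.le_sup (f := fun q : Nat.Primes => (q : ℕ)) h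
    simp only at this; omega
  refine ⟨M * l, ⟨l, hlp⟩, hlT, mul_ne_zero hM0 hl0, ?_, ?_, ?_⟩
  · have h1 : s * s = 1 := by rcases hs with rfl | rfl <;> norm_num
    have : M * l * s = P * l := by rw [hM]; linear_combination P * l * h1
    rw [this]
    exact mul_pos hPpos (by exact_mod_cast hlp.pos)
  · intro q hq
    set w : ℚ := τ q / M with hw
    have hwup : (w : ℚ_[(q : ℕ)]) = (up (w : ℚ_[(q : ℕ)]) : ℤ_[(q : ℕ)]) := by
      have := up_spec (hw0 q)
      rw [hwv q hq, zpow_zero, one_mul] at this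
      exact this
    obtain ⟨v, hv⟩ := (isUnit_up (hw0 q)).exists_right_inv
    rw [← hw] at hv
    have hlq : l ≡ n q [MOD (q : ℕ) ^ 3] :=
      (hlk.of_dvd (Finset.dvd_prod_of_mem (fun q : Nat.Primes => (q : ℕ) ^ 3) hq)).trans (hk q hq)
    have hz : toZModPow 3 (l : ℤ_[(q : ℕ)]) = toZModPow 3 (up (w : ℚ_[(q : ℕ)])) := by
      rw [map_natCast]
      have := (ZMod.natCast_eq_natCast_iff _ _ _).2 hlq
      rw [this]
      exact ZMod.natCast_zmod_val _
    have hsq : IsSquare ((l : ℤ_[(q : ℕ)]) * v) := by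
      apply isSquare_of_toZModPow
      rw [map_mul, hz, ← map_mul, hv, map_one]
    have hsq' := hsq.map (PadicInt.Coe.ringHom (p := (q : ℕ)))
    have e : ((M * l / τ q : ℚ) : ℚ_[(q : ℕ)]) = PadicInt.Coe.ringHom ((l : ℤ_[(q : ℕ)]) * v) := by
      have e1 : M * l / τ q = l / w := by rw [hw]; have := hτ q; field_simp
      rw [e1]
      have hv' : (up (w : ℚ_[(q : ℕ)]) : ℚ_[(q : ℕ)]) * (v : ℚ_[(q : ℕ)]) = 1 := by
        exact_mod_cast congrArg (fun x : ℤ_[(q : ℕ)] => (x : ℚ_[(q : ℕ)])) hv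
      rw [← hwup] at hv'
      have h0 := hw0 q
      rw [← hw] at h0
      have : PadicInt.Coe.ringHom ((l : ℤ_[(q : ℕ)]) * v) = (l : ℚ_[(q : ℕ)]) * (v : ℚ_[(q : ℕ)]) := by
        rw [map_mul, map_natCast]; rfl
      rw [this]
      push_cast
      rw [div_eq_iff h0]
      linear_combination -(l : ℚ_[(q : ℕ)]) * hv'
    rw [e]; exact hsq'
  · intro q hq hql
    rw [padicValRat.mul hM0 hl0, hvM, if_neg hq, zero_add]
    have := val_prime q ⟨l, hlp⟩
    rw [if_neg hql] at this
    exact this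

end HilbertAux


namespace HilbertAux

open PadicInt

lemma H_sq {p : Nat.Primes} {x y : ℚ} (hx : x ≠ 0) (hy : y ≠ 0)
    (h : IsSquare (y : ℚ_[(p : ℕ)])) : H p x y = 1 :=
  (H_iff p hx hy).2 (Nrm.of_isSquare two_ne_zero (cast_ne hy) h _)

lemma H_congr {p : Nat.Primes} {x x' y : ℚ} (hx : x ≠ 0) (hx' : x' ≠ 0) (hy : y ≠ 0)
    (h : IsSquare ((x / x' : ℚ) : ℚ_[(p : ℕ)])) : H p x y = H p x' y := by
  have e : x = x / x' * x' := by field_simp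
  have h0 : x / x' ≠ 0 := div_ne_zero hx hx'
  rw [e, (isSym_H p).mul _ _ _ h0 hx' hy, (isSym_H p).symm (x / x'), H_sq hy h0 h, one_mul]

lemma Hinf_pos_left {x y : ℚ} (hx : 0 < x) : Hinf x y = 1 := by
  rw [isSym_Hinf.symm]; exact Hinf_pos_right hx

lemma last {x y : ℚ} (hx : x ≠ 0) (hy : y ≠ 0) (l : Nat.Primes) (h : ∀ q, q ≠ l → H q x y = 1)
    (hinf : Hinf x y = 1) (q : Nat.Primes) : H q x y = 1 := by
  by_cases hq : q = l
  · subst hq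
    have h1 := product_formula hx hy
    rw [Tot_eq x y {q} (fun p hp => h p (by simpa using hp)), hinf] at h1
    simpa using h1
  · exact h q hq

lemma fwd {S : ℚ → ℚ → ℚ} (hS : IsSym S) {a b α β γ : ℚ} (ha : a ≠ 0) (hb : b ≠ 0) (hα : α ≠ 0)
    (hβ : β ≠ 0) (hγ : γ ≠ 0) (nα : Nrm a α) (nβ : Nrm b β) (nγ : Nrm (a * b) γ) :
    ((∀ x, x ≠ 0 → S x a = 1) → S α b = S (α * β * γ) b) ∧
    ((∀ x, x ≠ 0 → S x b = 1) ∨ (∀ x, x ≠ 0 → S x (a * b) = 1) → S α b = 1) := by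
  have h1 := hS.of_nrm hα ha nα
  have h2 := hS.of_nrm hβ hb nβ
  have h3 := hS.of_nrm hγ (mul_ne_zero ha hb) nγ
  rw [hS.mul_right hγ ha hb] at h3
  refine ⟨fun h => ?_, ?_⟩
  · rw [hS.mul _ _ _ (mul_ne_zero hα hβ) hγ hb, hS.mul _ _ _ hα hβ hb, h2]
    rw [h γ hγ, one_mul] at h3
    rw [h3]; ring
  · rintro (h | h)
    · exact h α hα
    · have := h α hα
      rw [hS.mul_right hα ha hb, h1, one_mul] at this
      exact this

open Classical in
/-- local factor -/
noncomputable def eloc (a b c : ℚ) (p : Nat.Primes) : ℚ :=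
  if IsSquare (a : ℚ_[(p : ℕ)]) then H p c b else 1

/-- real factor -/
def einf (a b c : ℚ) : ℚ := if 0 < a then Hinf c b else 1

lemma forward {a b c α β γ : ℚ} (ha : a ≠ 0) (hb : b ≠ 0) (hα : α ≠ 0)
    (hβ : β ≠ 0) (hγ : γ ≠ 0) (nα : Nrm a α) (nβ : Nrm b β) (nγ : Nrm (a * b) γ)
    (hc : α * β * γ = c)
    (hloc : ∀ (p : ℕ) [Fact p.Prime],
      IsSquare (a : ℚ_[p]) ∨ IsSquare (b : ℚ_[p]) ∨ IsSquare ((a * b : ℚ) : ℚ_[p])) :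
    (∀ p, H p α b = eloc a b c p) ∧ Hinf α b = einf a b c := by
  have hab : a * b ≠ 0 := mul_ne_zero ha hb
  subst hc
  constructor
  · intro p
    have := fwd (isSym_H p) ha hb hα hβ hγ nα nβ nγ
    unfold eloc
    split_ifs with h
    · exact this.1 fun x hx => H_sq hx ha h
    · apply this.2
      rcases hloc p with h' | h' | h'
      · exact absurd h' h
      · exact Or.inl fun x hx => H_sq hx hb h'
      · exact Or.inr fun x hx => H_sq hx hab h'
  · have := fwd isSym_Hinf ha hb hα hβ hγ nα nβ nγ
    unfold einf
    split_ifs with h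
    · exact this.1 fun x hx => Hinf_pos_right h
    · apply this.2
      have h' : a < 0 := lt_of_le_of_ne (not_lt.1 h) ha
      rcases lt_or_gt_of_ne hb with hb' | hb'
      · exact Or.inr fun x hx => Hinf_pos_right (mul_pos_of_neg_of_neg h' hb')
      · exact Or.inl fun x hx => Hinf_pos_right hb'

lemma eloc_pm {a b c : ℚ} (hb : b ≠ 0) (hc : c ≠ 0) (p : Nat.Primes) :
    eloc a b c p = 1 ∨ eloc a b c p = -1 := by
  unfold eloc; split_ifs
  · exact (isSym_H p).pm _ _ hc hb
  · simp

lemma einf_eq {a b c : ℚ} :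
    einf a b c = (-1) ^ (if 0 < a ∧ b < 0 ∧ c < 0 then 1 else 0) := by
  unfold einf Hinf
  by_cases h1 : 0 < a <;> by_cases h2 : b < 0 <;> by_cases h3 : c < 0 <;> simp [h1, h2, h3]

lemma parity {a b c : ℚ} (hb : b ≠ 0) (hc : c ≠ 0) (T : Finset Nat.Primes)
    (hT : ∀ p ∉ T, eloc a b c p = 1) (ε : ℕ) :
    (-1) ^ ε * ∏ p ∈ T, eloc a b c p = 1 ↔ Even ({p | eloc a b c p ≠ 1}.ncard + ε) := by
  classical
  have e : {p | eloc a b c p ≠ 1} = ((T.filter fun p => eloc a b c p ≠ 1 : Finset Nat.Primes) : Set _) := by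
    ext p
    simp only [Set.mem_ofPred_eq, Finset.coe_filter]
    constructor
    · intro h; exact ⟨by by_contra h'; exact h (hT p h'), h⟩
    · exact fun h => h.2
  rw [e, Set.ncard_coe_finset, ← Finset.prod_filter_ne_one]
  rw [Finset.prod_congr rfl (g := fun _ => (-1 : ℚ))]
  · rw [Finset.prod_const, ← pow_add, neg_one_pow_eq_one_iff_even (by norm_num), add_comm]
  · intro p hp
    rw [Finset.mem_filter] at hp
    exact (eloc_pm hb hc p).resolve_left hp.2

lemma backward {a b c : ℚ} (ha : a ≠ 0) (hb : b ≠ 0) (hc : c ≠ 0) 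
    (hloc : ∀ (p : ℕ) [Fact p.Prime],
      IsSquare (a : ℚ_[p]) ∨ IsSquare (b : ℚ_[p]) ∨ IsSquare ((a * b : ℚ) : ℚ_[p]))
    (T : Finset Nat.Primes) (hT2 : two' ∈ T) (hTa : ∀ p ∉ T, padicValRat p a = 0)
    (hTb : ∀ p ∉ T, padicValRat p b = 0) (hTc : ∀ p ∉ T, padicValRat p c = 0)
    (hE : einf a b c * ∏ p ∈ T, eloc a b c p = 1) :
    ∃ α β γ : ℚ, Nrm a α ∧ Nrm b β ∧ Nrm (a * b) γ ∧ α * β * γ = c := by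
  classical
  have hab : a * b ≠ 0 := mul_ne_zero ha hb
  have hodd : ∀ q ∉ T, (q : ℕ) ≠ 2 := by
    intro q hq; rw [← two'_ne]; rintro rfl; exact hq hT2
  have hTab : ∀ p ∉ T, padicValRat p (a * b) = 0 := by
    intro p hp; rw [padicValRat.mul ha hb, hTa p hp, hTb p hp, add_zero]
  obtain ⟨α, l, hlT, hα, sα, tα, vα⟩ := approx T
    (fun q => if IsSquare (a : ℚ_[(q : ℕ)]) then c else 1)
    (by intro q; split_ifs <;> simp [hc])
    (if 0 < a ∧ c < 0 then -1 else 1) (by split_ifs <;> simp)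
  have α1 : ∀ q ∈ T, IsSquare (a : ℚ_[(q : ℕ)]) → ∀ y, y ≠ 0 → H q α y = H q c y := by
    intro q hq hA y hy
    have := tα q hq
    rw [if_pos hA] at this
    exact H_congr hα hc hy this
  have α2 : ∀ q ∈ T, ¬ IsSquare (a : ℚ_[(q : ℕ)]) → ∀ y, y ≠ 0 → H q α y = 1 := by
    intro q hq hA y hy
    have := tα q hq
    rw [if_neg hA] at this
    rw [H_congr hα one_ne_zero hy this, (isSym_H q).isSquare one_ne_zero hy ⟨1, by norm_num⟩]
  have α3 : ¬ 0 < a → 0 < α := by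
    intro h; simpa [h] using sα
  have α4 : 0 < a → 0 < c * α := by
    intro h
    rcases lt_or_gt_of_ne hc with hc' | hc'
    · simp only [h, hc', and_self, if_true] at sα; nlinarith
    · simp only [h, hc'.not_gt, and_false, if_false] at sα; nlinarith
  have αa_inf : Hinf α a = 1 := by
    by_cases h : 0 < a
    · exact Hinf_pos_right h
    · exact Hinf_pos_left (α3 h)
  have αa : ∀ q, H q α a = 1 := by
    refine last hα ha l (fun q hql => ?_) αa_inf
    by_cases hq : q ∈ T
    · by_cases hA : IsSquare (a : ℚ_[(q : ℕ)])
      · exact H_sq hα ha hA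
      · exact α2 q hq hA a ha
    · exact H_units q (hodd q hq) (vα q hq hql) (hTa q hq)
  have αb_inf : Hinf α b = einf a b c := by
    unfold einf
    split_ifs with h
    · have h4 := α4 h
      unfold Hinf
      have : α < 0 ↔ c < 0 := by
        constructor <;> intro h' <;> by_contra h'' <;> nlinarith
      simp only [this]
    · exact Hinf_pos_left (α3 h)
  have αb_l : H l α b = 1 := by
    have h1 := product_formula hα hb
    rw [Tot_eq α b (insert l T) (fun p hp => by
        rw [Finset.mem_insert, not_or] at hp
        exact H_units p (hodd p hp.2) (vα p hp.2 hp.1) (hTb p hp.2)),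
      Finset.prod_insert hlT, αb_inf] at h1
    have h2 : ∏ p ∈ T, H p α b = ∏ p ∈ T, eloc a b c p := by
      refine Finset.prod_congr rfl fun q hq => ?_
      unfold eloc
      split_ifs with hA
      · exact α1 q hq hA b hb
      · exact α2 q hq hA b hb
    rw [h2] at h1
    linear_combination h1 - H l α b * hE
  obtain ⟨β, l', hlT', hβ, sβ, tβ, vβ⟩ := approx (insert l T)
    (fun q => if q ∈ T ∧ ¬ IsSquare (a : ℚ_[(q : ℕ)]) ∧ IsSquare (b : ℚ_[(q : ℕ)]) then c else 1)
    (by intro q; split_ifs <;> simp [hc])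
    (if ¬ 0 < a ∧ 0 < b ∧ c < 0 then -1 else 1) (by split_ifs <;> simp)
  have β1 : ∀ q ∈ T, ¬ IsSquare (a : ℚ_[(q : ℕ)]) → IsSquare (b : ℚ_[(q : ℕ)]) →
      ∀ y, y ≠ 0 → H q β y = H q c y := by
    intro q hq hA hB y hy
    have := tβ q (Finset.mem_insert_of_mem hq)
    rw [if_pos ⟨hq, hA, hB⟩] at this
    exact H_congr hβ hc hy this
  have β2 : ∀ q ∈ insert l T,
      ¬ (q ∈ T ∧ ¬ IsSquare (a : ℚ_[(q : ℕ)]) ∧ IsSquare (b : ℚ_[(q : ℕ)])) →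
      ∀ y, y ≠ 0 → H q β y = 1 := by
    intro q hq hA y hy
    have := tβ q hq
    rw [if_neg hA] at this
    rw [H_congr hβ one_ne_zero hy this, (isSym_H q).isSquare one_ne_zero hy ⟨1, by norm_num⟩]
  have β3 : ¬ (¬ 0 < a ∧ 0 < b) → 0 < β := by
    intro h
    rw [if_neg (fun h' => h ⟨h'.1, h'.2.1⟩)] at sβ
    simpa using sβ
  have β4 : ¬ 0 < a → 0 < b → 0 < c * β := by
    intro h h'
    rcases lt_or_gt_of_ne hc with hc' | hc'
    · rw [if_pos ⟨h, h', hc'⟩] at sβ; nlinarith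
    · rw [if_neg (fun h'' => by linarith [h''.2.2])] at sβ; nlinarith
  have βb_inf : Hinf β b = 1 := by
    by_cases h : 0 < b
    · exact Hinf_pos_right h
    · exact Hinf_pos_left (β3 fun h' => h h'.2)
  have βb : ∀ q, H q β b = 1 := by
    refine last hβ hb l' (fun q hql => ?_) βb_inf
    by_cases hq : q ∈ insert l T
    · by_cases hA : IsSquare (b : ℚ_[(q : ℕ)])
      · exact H_sq hβ hb hA
      · exact β2 q hq (fun h => hA h.2.2) b hb
    · have hq' : q ∉ T := fun h => hq (Finset.mem_insert_of_mem h)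
      exact H_units q (hodd q hq') (vβ q hq hql) (hTb q hq')
  have hcα : c * α ≠ 0 := mul_ne_zero hc hα
  have hg : c * α * β ≠ 0 := mul_ne_zero hcα hβ
  have g_inf : Hinf (c * α * β) (a * b) = 1 := by
    by_cases h : 0 < a
    · exact Hinf_pos_left (mul_pos (α4 h) (β3 fun h' => h'.1 h))
    · by_cases h' : 0 < b
      · have := mul_pos (β4 h h') (α3 h)
        exact Hinf_pos_left (by linarith)
      · exact Hinf_pos_right (mul_pos_of_neg_of_neg (lt_of_le_of_ne (not_lt.1 h) ha)
          (lt_of_le_of_ne (not_lt.1 h') hb))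
  have gab : ∀ q, H q (c * α * β) (a * b) = 1 := by
    refine last hg hab l' (fun q hql => ?_) g_inf
    rw [(isSym_H q).mul _ _ _ hcα hβ hab, (isSym_H q).mul _ _ _ hc hα hab]
    have hpm : H q c (a * b) * H q c (a * b) = 1 := by
      rcases (isSym_H q).pm _ _ hc hab with h | h <;> rw [h] <;> norm_num
    by_cases hq : q ∈ T
    · by_cases hA : IsSquare (a : ℚ_[(q : ℕ)])
      · rw [α1 q hq hA _ hab, β2 q (Finset.mem_insert_of_mem hq) (fun h => h.2.1 hA) _ hab, hpm,
          one_mul]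
      · by_cases hB : IsSquare (b : ℚ_[(q : ℕ)])
        · rw [α2 q hq hA _ hab, β1 q hq hA hB _ hab, mul_one, hpm]
        · have hAB := ((hloc q).resolve_left hA).resolve_left hB
          rw [H_sq hc hab hAB, H_sq hα hab hAB, H_sq hβ hab hAB]; norm_num
    · rw [H_units q (hodd q hq) (hTc q hq) (hTab q hq)]
      by_cases hl : q = l
      · subst hl
        rw [(isSym_H q).mul_right hα ha hb, αa, αb_l,
          β2 q (Finset.mem_insert_self _ _) (fun h => hq h.1) _ hab]
        norm_num
      · rw [H_units q (hodd q hq) (vα q hq hl) (hTab q hq),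
          H_units q (hodd q hq) (vβ q (by simp [hq, hl]) hql) (hTab q hq)]
        norm_num
  refine ⟨α, β, c * α * β * (α * β)⁻¹ ^ 2, hasse ha hα αa αa_inf, hasse hb hβ βb βb_inf,
    (hasse hab hg gab g_inf).mul (Nrm.sq _ _), ?_⟩
  field_simp

end HilbertAux

open HilbertAux in
lemma obstructionPrimes_eq {a b c : ℚ} (hb : b ≠ 0) (hc : c ≠ 0) :
    obstructionPrimes a b c = {p | eloc a b c p ≠ 1} := by
  ext p
  have : p ∈ obstructionPrimes a b c ↔
    (IsSquare (a : ℚ_[(p : ℕ)]) ∧ ¬ Nrm (b : ℚ_[(p : ℕ)]) (c : ℚ_[(p : ℕ)])) := Iff.rfl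
  rw [this, Set.mem_ofPred_eq, ← H_iff p hc hb]
  unfold eloc
  split_ifs with h <;> simp [h]

/-- Suppose that for every prime `p`, at least one of `a`, `b`, `ab` is a square in
`ℚ_[p]`. Then the set `S` of primes where `a` is a square in `ℚ_[p]` but `c` is not a
local norm from `ℚ_[p](√b)` is finite, and — adding the contribution
`ε ∈ {0, 1}` of the real place, where `ε = 1` iff `a > 0`, `b < 0`, `c < 0` — the
product equation `(x² - a·y²)(z² - b·t²)(u² - (a·b)·w²) = c` has a rational solution
if and only if `|S| + ε` is even (the Brauer–Manin condition). -/
theorem product_equation_rational_solution_iff_brauer_manin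
    (a b c : ℚ) (ha : a ≠ 0) (hb : b ≠ 0) (hc : c ≠ 0)
    (hloc : ∀ (p : ℕ) [Fact p.Prime],
      IsSquare (a : ℚ_[p]) ∨ IsSquare (b : ℚ_[p]) ∨ IsSquare ((a * b : ℚ) : ℚ_[p])) :
    (obstructionPrimes a b c).Finite ∧
    ((∃ x y z t u w : ℚ,
        (x ^ 2 - a * y ^ 2) * (z ^ 2 - b * t ^ 2) * (u ^ 2 - (a * b) * w ^ 2) = c) ↔
      Even ((obstructionPrimes a b c).ncard
        + (if 0 < a ∧ b < 0 ∧ c < 0 then 1 else 0))) := by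
  classical
  rw [obstructionPrimes_eq hb hc]
  have fa := HilbertAux.finite_val ha
  have fb := HilbertAux.finite_val hb
  have fc := HilbertAux.finite_val hc
  set T : Finset Nat.Primes := insert HilbertAux.two' (fa.toFinset ∪ fb.toFinset ∪ fc.toFinset)
    with hT
  have hT2 : HilbertAux.two' ∈ T := Finset.mem_insert_self _ _
  have hTall : ∀ p ∉ T, p ≠ HilbertAux.two' ∧ padicValRat p a = 0 ∧ padicValRat p b = 0 ∧
      padicValRat p c = 0 := by
    intro p hp
    simp only [hT, Finset.mem_insert, Finset.mem_union, Set.Finite.mem_toFinset,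
      Set.mem_ofPred_eq, not_or, not_not] at hp
    tauto
  have hTe : ∀ p ∉ T, HilbertAux.eloc a b c p = 1 := by
    intro p hp
    obtain ⟨h1, h2, h3, h4⟩ := hTall p hp
    unfold HilbertAux.eloc
    split_ifs
    · exact HilbertAux.H_units p (HilbertAux.two'_ne.1 h1) h4 h3
    · rfl
  constructor
  · apply T.finite_toSet.subset
    intro p hp
    by_contra h
    exact hp (hTe p h)
  rw [← HilbertAux.parity hb hc T hTe, ← HilbertAux.einf_eq]
  constructor
  · rintro ⟨x, y, z, t, u, w, h⟩
    have hne := hc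
    rw [← h] at hne
    have hγ := right_ne_zero_of_mul hne
    have hβ := right_ne_zero_of_mul (left_ne_zero_of_mul hne)
    have hα := left_ne_zero_of_mul (left_ne_zero_of_mul hne)
    obtain ⟨h1, h2⟩ := HilbertAux.forward ha hb hα hβ hγ ⟨x, y, rfl⟩ ⟨z, t, rfl⟩ ⟨u, w, rfl⟩ h hloc
    have h3 := HilbertAux.product_formula hα hb
    rw [HilbertAux.Tot_eq _ _ T (fun p hp => by rw [h1, hTe p hp]), h2,
      Finset.prod_congr rfl fun p _ => h1 p] at h3
    exact h3
  · intro h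
    obtain ⟨α, β, γ, ⟨x, y, h1⟩, ⟨z, t, h2⟩, ⟨u, w, h3⟩, h4⟩ := HilbertAux.backward ha hb hc hloc T hT2
      (fun p hp => (hTall p hp).2.1) (fun p hp => (hTall p hp).2.2.1)
      (fun p hp => (hTall p hp).2.2.2) h
    exact ⟨x, y, z, t, u, w, by rw [← h1, ← h2, ← h3, h4]⟩
end

section
/- For every prime number p, at least one of 13, 17, 221 is a square in the field ℚ_p of p-adic numbers; that is, there exists x ∈ ℚ_p with x² = 13, or x² = 17, or x² = 221. -/
lemma sq_of_hensel (p : ℕ) [Fact p.Prime] (a n : ℤ)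
    (h : ‖((a ^ 2 - n : ℤ) : ℤ_[p])‖ < ‖((2 * a : ℤ) : ℤ_[p])‖ ^ 2) :
    ∃ x : ℚ_[p], x ^ 2 = n := by
  obtain ⟨z, hz, -⟩ := hensels_lemma (p := p) (R := ℤ_[p])
    (F := (Polynomial.X ^ 2 - Polynomial.C (n : ℤ_[p]))) (a := (a : ℤ_[p])) (by
      have e : (1 + 1 : ℤ_[p]) = 2 := by norm_num
      simp [mul_comm] at h ⊢
      rw [e]
      exact h)
  refine ⟨z, ?_⟩
  have hz2 : z ^ 2 = (n : ℤ_[p]) := by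
    simpa [sub_eq_zero] using hz
  exact_mod_cast congrArg (fun t : ℤ_[p] => (t : ℚ_[p])) hz2

lemma sq_of_dvd (p : ℕ) [Fact p.Prime] (a n : ℤ)
    (h : (p : ℤ) ∣ a ^ 2 - n) (h2 : ¬ (p : ℤ) ∣ 2 * a) :
    ∃ x : ℚ_[p], x ^ 2 = n := by
  apply sq_of_hensel p a n
  have h1 := (PadicInt.norm_int_lt_one_iff_dvd (p := p) (a ^ 2 - n)).2 h
  have h3 : ‖((2 * a : ℤ) : ℤ_[p])‖ = 1 := by
    apply le_antisymm (PadicInt.norm_le_one _)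
    rw [← not_lt, PadicInt.norm_int_lt_one_iff_dvd]
    exact h2
  rw [h3]
  simpa using h1

lemma sq_of_legendre (p : ℕ) [Fact p.Prime] (n : ℤ) (hp : p ≠ 2)
    (h : legendreSym p n = 1) : ∃ x : ℚ_[p], x ^ 2 = n := by
  have hn : (n : ZMod p) ≠ 0 := by
    intro h0
    rw [(legendreSym.eq_zero_iff p n).2 h0] at h
    exact absurd h (by norm_num)
  obtain ⟨y, hy⟩ := (legendreSym.eq_one_iff p hn).1 h
  obtain ⟨a, rfl⟩ := ZMod.intCast_surjective y
  apply sq_of_dvd p a n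
  · rw [← ZMod.intCast_zmod_eq_zero_iff_dvd]
    push_cast
    rw [hy]; ring
  · intro hd
    have hpp : Prime (p : ℤ) := Nat.prime_iff_prime_int.1 Fact.out
    rcases hpp.dvd_or_dvd hd with h2 | h2
    · have : p ∣ 2 := by exact_mod_cast h2
      exact hp ((Nat.prime_dvd_prime_iff_eq Fact.out Nat.prime_two).1 this)
    · rw [← ZMod.intCast_zmod_eq_zero_iff_dvd] at h2
      exact hn (by rw [hy, h2]; ring)

/-- For every prime `p`, at least one of `13`, `17`, `221` is a square in `ℚ_[p]`. -/
theorem padic_square_13_17_221 (p : ℕ) [Fact p.Prime] :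
    (∃ x : ℚ_[p], x ^ 2 = 13) ∨ (∃ x : ℚ_[p], x ^ 2 = 17) ∨ (∃ x : ℚ_[p], x ^ 2 = 221) := by
  by_cases h2 : p = 2
  · subst h2
    right; left
    suffices h : _ from mod_cast sq_of_hensel 2 1 17 h
    have h1 : ‖((1 ^ 2 - 17 : ℤ) : ℤ_[2])‖ ≤ ((2 : ℕ) : ℝ) ^ (-(4 : ℕ) : ℤ) :=
      PadicInt.norm_int_le_pow_iff_dvd.2 (by norm_num)
    have h3 : ‖((2 * 1 : ℤ) : ℤ_[2])‖ = 2⁻¹ := by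
      simpa using PadicInt.norm_p (p := 2)
    rw [h3]
    refine lt_of_le_of_lt h1 ?_
    norm_num
  by_cases h13 : p = 13
  · subst h13
    right; left
    exact_mod_cast sq_of_dvd 13 2 17 (by norm_num) (by norm_num)
  by_cases h17 : p = 17
  · subst h17
    left
    exact_mod_cast sq_of_dvd 17 8 13 (by norm_num) (by norm_num)
  have n13 : ((13 : ℤ) : ZMod p) ≠ 0 := by
    rw [Ne, ZMod.intCast_zmod_eq_zero_iff_dvd]
    intro h
    have : p ∣ 13 := by exact_mod_cast h
    exact h13 ((Nat.prime_dvd_prime_iff_eq Fact.out (by norm_num)).1 this)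
  have n17 : ((17 : ℤ) : ZMod p) ≠ 0 := by
    rw [Ne, ZMod.intCast_zmod_eq_zero_iff_dvd]
    intro h
    have : p ∣ 17 := by exact_mod_cast h
    exact h17 ((Nat.prime_dvd_prime_iff_eq Fact.out (by norm_num)).1 this)
  rcases legendreSym.eq_one_or_neg_one p n13 with h | h
  · left; exact_mod_cast sq_of_legendre p 13 h2 h
  rcases legendreSym.eq_one_or_neg_one p n17 with h' | h'
  · right; left; exact_mod_cast sq_of_legendre p 17 h2 h'
  right; right
  suffices h0 : legendreSym p 221 = 1 from mod_cast sq_of_legendre p 221 h2 h0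
  rw [show (221 : ℤ) = 13 * 17 by norm_num, legendreSym.mul, h, h']
  norm_num
end
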